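/- Let k ≥ 1, let n_1, …, n_k ≥ 1 be integers, let X = S^{n_1} × ⋯ × S^{n_k}, and let k_o be the number of indices i with n_i odd. If the torus (S^1)^r acts freely and continuously on X (for some r ≥ 0), then r ≤ k_o. -/

import Mathlib

namespace FreeToralRank

open Polynomial

section Families

variable {σ A B : Type} [Ring A] [Algebra ℂ A] [Ring B] [Algebra ℂ B]

/-- Polynomial families of elements of `A`, parametrised by `σ → ℂ`. -/
def polyFam (σ A : Type) [Ring A] [Algebra ℂ A] : Submodule ℂ ((σ → ℂ) → A) :=
  Submodule.span ℂ (Set.range fun q : MvPolynomial σ ℂ × A => fun p => MvPolynomial.eval p q.1 • q.2)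

lemma polyFam_smul_const (f : MvPolynomial σ ℂ) (a : A) :
    (fun p => MvPolynomial.eval p f • a) ∈ polyFam σ A :=
  Submodule.subset_span ⟨(f, a), rfl⟩

lemma polyFam_const (a : A) : (fun _ => a) ∈ polyFam σ A := by
  simpa using polyFam_smul_const (σ := σ) 1 a

lemma polyFam_map (u : A →ₗ[ℂ] B) {g : (σ → ℂ) → A} (hg : g ∈ polyFam σ A) :
    (fun p => u (g p)) ∈ polyFam σ B := by
  induction hg using Submodule.span_induction with
  | mem x h =>
    obtain ⟨⟨f, a⟩, rfl⟩ := h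
    simpa using polyFam_smul_const f (u a)
  | zero => simpa using polyFam_const (σ := σ) (0 : B)
  | add x y _ _ hx hy => simpa [Pi.add_def] using (polyFam σ B).add_mem hx hy
  | smul c x _ hx => simpa [Pi.smul_def] using (polyFam σ B).smul_mem c hx

lemma polyFam_smul (f : MvPolynomial σ ℂ) {g : (σ → ℂ) → A} (hg : g ∈ polyFam σ A) :
    (fun p => MvPolynomial.eval p f • g p) ∈ polyFam σ A := by
  induction hg using Submodule.span_induction with
  | mem x h =>
    obtain ⟨⟨f', a⟩, rfl⟩ := h
    simpa [mul_smul] using polyFam_smul_const (f * f') a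
  | zero => simpa using polyFam_const (σ := σ) (0 : A)
  | add x y _ _ hx hy => simpa [Pi.add_def] using (polyFam σ A).add_mem hx hy
  | smul c x _ hx =>
    have := (polyFam σ A).smul_mem c hx
    convert this using 1
    ext p
    simp [smul_comm c]

lemma polyFam_apply {D : (σ → ℂ) → A →ₗ[ℂ] B} (hD : ∀ a, (fun p => D p a) ∈ polyFam σ B)
    {g : (σ → ℂ) → A} (hg : g ∈ polyFam σ A) : (fun p => D p (g p)) ∈ polyFam σ B := by
  induction hg using Submodule.span_induction with
  | mem x h =>
    obtain ⟨⟨f, a⟩, rfl⟩ := h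
    simpa using polyFam_smul f (hD a)
  | zero => simpa using polyFam_const (σ := σ) (0 : B)
  | add x y _ _ hx hy => simpa [Pi.add_def] using (polyFam σ B).add_mem hx hy
  | smul c x _ hx => simpa [Pi.smul_def] using (polyFam σ B).smul_mem c hx

lemma polyFam_functional (u : A →ₗ[ℂ] ℂ) {g : (σ → ℂ) → A} (hg : g ∈ polyFam σ A) :
    ∃ f : MvPolynomial σ ℂ, ∀ p, MvPolynomial.eval p f = u (g p) := by
  induction hg using Submodule.span_induction with
  | mem x h =>
    obtain ⟨⟨f, a⟩, rfl⟩ := h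
    exact ⟨f * MvPolynomial.C (u a), fun p => by simp⟩
  | zero => exact ⟨0, by simp⟩
  | add x y _ _ hx hy =>
    obtain ⟨f, hf⟩ := hx
    obtain ⟨g, hg⟩ := hy
    exact ⟨f + g, by simp [hf, hg]⟩
  | smul c x _ hx =>
    obtain ⟨f, hf⟩ := hx
    exact ⟨c • f, by simp [hf]⟩

end Families

/-- Fewer than `N` polynomials in `N` variables without constant terms have a common nonzero
zero. -/
lemma exists_common_zero {σ : Type} [Finite σ] (G : List (MvPolynomial σ ℂ))
    (hG : ∀ f ∈ G, MvPolynomial.eval 0 f = 0) (hcard : G.length < Nat.card σ) :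
    ∃ p : σ → ℂ, p ≠ 0 ∧ ∀ f ∈ G, MvPolynomial.eval p f = 0 := by
  classical
  by_contra! hcon
  have hdim : ringKrullDim (MvPolynomial σ ℂ) ≤ ((G.length : ℕ∞) : WithBot ℕ∞) := by
    rw [ringKrullDim_le_iff_isMaximal_height_le]
    intro m hm
    obtain ⟨x, rfl⟩ := (MvPolynomial.isMaximal_iff_eq_vanishingIdeal_singleton (K := ℂ)).1 hm
    let τ : MvPolynomial σ ℂ →ₐ[ℂ] MvPolynomial σ ℂ :=
      MvPolynomial.bind₁ fun i => MvPolynomial.X i - MvPolynomial.C (x i)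
    have hτ : ∀ p f, MvPolynomial.aeval p (τ f) = MvPolynomial.eval (p - x) f := by
      intro p f
      rw [MvPolynomial.aeval_bind₁, ← MvPolynomial.aeval_eq_eval]
      congr 2
      ext i
      simp
    let I : Ideal (MvPolynomial σ ℂ) := Ideal.span (G.toFinset.image τ : Finset _)
    have hIm : I ≤ MvPolynomial.vanishingIdeal ℂ {x} := by
      rw [Ideal.span_le]
      intro f hf
      obtain ⟨g, hg, rfl⟩ := Finset.mem_image.1 (Finset.mem_coe.1 hf)
      rw [SetLike.mem_coe, MvPolynomial.mem_vanishingIdeal_singleton_iff, hτ, sub_self]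
      exact hG g (by simpa using hg)
    have hzero : MvPolynomial.zeroLocus ℂ I ⊆ {x} := by
      intro p hp
      by_contra hne
      obtain ⟨f, hf, hfp⟩ := hcon (p - x) (sub_ne_zero.2 hne)
      apply hfp
      rw [← hτ]
      exact hp _ (Ideal.subset_span (Finset.mem_coe.2
        (Finset.mem_image_of_mem _ (List.mem_toFinset.2 hf))))
    have hrad : MvPolynomial.vanishingIdeal ℂ {x} ≤ I.radical := by
      rw [← MvPolynomial.vanishingIdeal_zeroLocus_eq_radical (K := ℂ)]
      exact MvPolynomial.vanishingIdeal_anti_mono hzero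
    have hmin : MvPolynomial.vanishingIdeal ℂ {x} ∈ I.minimalPrimes :=
      ⟨⟨hm.isPrime, hIm⟩, fun q hq _ => hrad.trans (hq.1.radical_le_iff.2 hq.2)⟩
    have h1 := Ideal.height_le_card_of_mem_minimalPrimes_span_finset hmin
    have h2 : (G.toFinset.image τ).card ≤ G.length :=
      Finset.card_image_le.trans G.toFinset_card_le
    exact_mod_cast h1.trans (by exact_mod_cast h2)
  rw [MvPolynomial.ringKrullDim_of_isNoetherianRing, ringKrullDim_eq_zero_of_field, zero_add] at hdim
  have : Nat.card σ ≤ G.length := by exact_mod_cast hdim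
  omega

end FreeToralRank

namespace FreeToralRank

open Polynomial

/-- A `ℂ`-algebra with parity, grading projections and a polynomial family of odd derivations
`D p`, the family at `0` being homogeneous of degree one. Only coordinates in `S` matter. -/
structure Stage (σ A : Type) [Ring A] [Algebra ℂ A] where
  ε : A →ₐ[ℂ] A
  pr : ℤ → A →ₗ[ℂ] A
  D : (σ → ℂ) → A →ₗ[ℂ] A
  S : Set σ
  εε : ∀ a, ε (ε a) = a
  even_comm : ∀ x a, ε x = x → x * a = a * x
  odd_comm : ∀ x a, ε x = -x → x * a = ε a * x
  pr_pr : ∀ i a, pr i (pr i a) = pr i a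
  pr_pr_ne : ∀ i j a, i ≠ j → pr i (pr j a) = 0
  pr_neg : ∀ i a, i < 0 → pr i a = 0
  pr_one : pr 0 1 = 1
  pr_bdd : ∀ a, ∃ N : ℤ, ∀ m, N < m → pr m a = 0
  pr_ext : ∀ a, (∀ m, pr m a = 0) → a = 0
  pr_mul : ∀ i j a b, pr i a = a → pr j (a * b) = a * pr (j - i) b
  ε_pr : ∀ m a, ε (pr m a) = ((-1 : ℂ) ^ m) • pr m a
  pr_ε : ∀ m a, pr m (ε a) = ((-1 : ℂ) ^ m) • pr m a
  D_mul : ∀ p a b, D p (a * b) = D p a * b + ε a * D p b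
  D_ε : ∀ p a, D p (ε a) = -ε (D p a)
  D_poly : ∀ a, (fun p => D p a) ∈ polyFam σ A
  d_pr : ∀ m a, D 0 (pr m a) = pr (m + 1) (D 0 a)
  d_d : ∀ a, D 0 (D 0 a) = 0
  D_filt : ∀ p m a, (∀ j, m < j → pr j a = 0) → ∀ j, m - 1 < j → pr j (D p a) = pr j (D 0 a)
  D_S : ∀ p, (∀ s ∈ S, p s = 0) → D p = D 0

/-- Coefficients of square-free monomials in `n` variables. -/
def Coef : ℕ → Type
  | 0 => ℂ
  | n + 1 => Coef n × Coef n

noncomputable instance Coef.addCommGroup : ∀ n, AddCommGroup (Coef n)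
  | 0 => inferInstanceAs (AddCommGroup ℂ)
  | n + 1 => by
    have := Coef.addCommGroup n
    exact inferInstanceAs (AddCommGroup (Coef n × Coef n))

/-- A homogeneous generator `w` of degree `deg`; `e` is a primitive of its square. -/
structure Gen (A : Type) where
  w : A
  e : A
  deg : ℤ

/-- The value of the square-free polynomial with given coefficients on a list of generators. -/
noncomputable def evalC {A : Type} [Ring A] [Algebra ℂ A] : (L : List (Gen A)) → Coef L.length → A
  | [], c => algebraMap ℂ A c
  | g :: L, c => evalC L c.1 + g.w * evalC L c.2

section

variable {A : Type} [Ring A] [Algebra ℂ A]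

lemma evalC_cons (g : Gen A) (L : List (Gen A)) (c c' : Coef L.length) :
    evalC (g :: L) (c, c') = evalC L c + g.w * evalC L c' := rfl

lemma evalC_zero (L : List (Gen A)) : evalC L 0 = 0 := by
  induction L with
  | nil => exact map_zero (algebraMap ℂ A)
  | cons g L ih =>
    change evalC L 0 + g.w * evalC L 0 = 0
    rw [ih]
    simp

lemma evalC_add (L : List (Gen A)) (c c' : Coef L.length) :
    evalC L (c + c') = evalC L c + evalC L c' := by
  induction L with
  | nil => exact map_add (algebraMap ℂ A) c c'
  | cons g L ih =>
    change evalC L (c.1 + c'.1) + g.w * evalC L (c.2 + c'.2) =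
      (evalC L c.1 + g.w * evalC L c.2) + (evalC L c'.1 + g.w * evalC L c'.2)
    rw [ih, ih]
    noncomm_ring

lemma evalC_neg (L : List (Gen A)) (c : Coef L.length) : evalC L (-c) = -evalC L c := by
  have := evalC_add L c (-c)
  rw [add_neg_cancel, evalC_zero] at this
  exact (neg_eq_of_add_eq_zero_right this.symm).symm

end

namespace Stage

variable {σ A : Type} [Ring A] [Algebra ℂ A] (T : Stage σ A)

/-- Validity of a generator. -/
structure IsGen (g : Gen A) : Prop where
  closed : T.D 0 g.w = 0
  homog : T.pr g.deg g.w = g.w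
  pos : 1 ≤ g.deg
  sq : Even g.deg → T.D 0 g.e = g.w * g.w
  homog_e : Even g.deg → T.pr (2 * g.deg - 1) g.e = g.e

/-- The cohomology of `D 0` has the square-free monomials in the generators as a basis. -/
structure Sph (L : List (Gen A)) : Prop where
  gen : ∀ g ∈ L, T.IsGen g
  span : ∀ a, T.D 0 a = 0 → ∃ c b, a = evalC L c + T.D 0 b
  ind : ∀ c b, evalC L c = T.D 0 b → c = 0

variable {T}

lemma D_one (p) : T.D p 1 = 0 := by
  have := T.D_mul p 1 1
  simp only [mul_one, map_one, one_mul] at this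
  simpa using this

lemma IsGen.ε_w {g : Gen A} (hg : T.IsGen g) : T.ε g.w = ((-1 : ℂ) ^ g.deg) • g.w := by
  rw [← hg.homog, T.ε_pr]

lemma IsGen.ε_even {g : Gen A} (hg : T.IsGen g) (h : Even g.deg) : T.ε g.w = g.w := by
  rw [hg.ε_w, h.neg_one_zpow, one_smul]

lemma IsGen.ε_odd {g : Gen A} (hg : T.IsGen g) (h : Odd g.deg) : T.ε g.w = -g.w := by
  rw [hg.ε_w, h.neg_one_zpow, neg_one_smul]

lemma sq_zero_of_odd {x : A} (h : T.ε x = -x) : x * x = 0 := by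
  have := T.odd_comm x x h
  rw [h, neg_mul] at this
  have h2 : (2 : ℂ) • (x * x) = 0 := by
    rw [two_smul]
    nth_rewrite 1 [this]
    simp
  exact (smul_eq_zero.1 h2).resolve_left two_ne_zero

lemma D_algebraMap (p) (c : ℂ) : T.D p (algebraMap ℂ A c) = 0 := by
  rw [Algebra.algebraMap_eq_smul_one, map_smul, D_one, smul_zero]

lemma closed_evalC {L : List (Gen A)} (hL : ∀ g ∈ L, T.IsGen g) (c : Coef L.length) :
    T.D 0 (evalC L c) = 0 := by
  induction L with
  | nil => exact D_algebraMap _ _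
  | cons g L ih =>
    change T.D 0 (evalC L c.1 + g.w * evalC L c.2) = 0
    have h := hL g (by simp)
    have ih := fun c => ih (fun g hg => hL g (by simp [hg])) c
    rw [map_add, T.D_mul, ih, ih, h.closed]
    simp

lemma w_comm {g g' : Gen A} (hg : T.IsGen g) (hg' : T.IsGen g') :
    ∃ u : ℂ, u ≠ 0 ∧ g.w * g'.w = u • (g'.w * g.w) := by
  rcases Int.even_or_odd g.deg with h | h
  · exact ⟨1, one_ne_zero, by rw [T.even_comm _ _ (hg.ε_even h), one_smul]⟩
  · refine ⟨(-1) ^ g'.deg, zpow_ne_zero _ (by simp), ?_⟩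
    rw [T.odd_comm _ _ (hg.ε_odd h), hg'.ε_w, smul_mul_assoc]

noncomputable def smulC (u : ℂ) : (n : ℕ) → Coef n → Coef n
  | 0, c => @HMul.hMul ℂ ℂ ℂ _ u c
  | n + 1, c => (smulC u n c.1, smulC u n c.2)

lemma evalC_smulC (u : ℂ) (L : List (Gen A)) (c : Coef L.length) :
    evalC L (smulC u _ c) = u • evalC L c := by
  induction L with
  | nil =>
    have h : ∀ z : ℂ, algebraMap ℂ A (u * z) = u • algebraMap ℂ A z := fun z => by
      rw [map_mul, Algebra.smul_def]
    exact h c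
  | cons g L ih =>
    change evalC L (smulC u _ c.1) + g.w * evalC L (smulC u _ c.2) = u • (evalC L c.1 + g.w * evalC L c.2)
    rw [ih, ih]
    simp

lemma smulC_smulC (u v : ℂ) (h : u * v = 1) (n : ℕ) (c : Coef n) : smulC u n (smulC v n c) = c := by
  induction n with
  | zero =>
    have h : ∀ z : ℂ, u * (v * z) = z := fun z => by rw [← mul_assoc, h, one_mul]
    exact h c
  | succ n ih => exact Prod.ext (ih _) (ih _)

lemma smulC_zero (u : ℂ) (n : ℕ) : smulC u n 0 = 0 := by
  induction n with
  | zero => exact (mul_zero u : u * 0 = 0)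
  | succ n ih => exact Prod.ext ih ih

lemma perm_aux {L L' : List (Gen A)} (h : L.Perm L') (hL : ∀ g ∈ L, T.IsGen g) :
    ∃ φ : Coef L.length → Coef L'.length, (∀ c, evalC L' (φ c) = evalC L c) ∧
      Function.Surjective φ ∧ φ 0 = 0 := by
  induction h with
  | nil => exact ⟨id, fun _ => rfl, Function.surjective_id, rfl⟩
  | cons x h ih =>
    obtain ⟨φ, h1, h2, h3⟩ := ih fun g hg => hL g (by simp [hg])
    refine ⟨fun c => (φ c.1, φ c.2), fun c => ?_, fun c => ?_, Prod.ext h3 h3⟩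
    · exact congrArg₂ (fun a b => a + x.w * b) (h1 c.1) (h1 c.2)
    · obtain ⟨c1, hc1⟩ := h2 c.1
      obtain ⟨c2, hc2⟩ := h2 c.2
      exact ⟨(c1, c2), Prod.ext hc1 hc2⟩
  | swap x y l =>
    obtain ⟨u, hu, hxy⟩ := w_comm (hL y (by simp)) (hL x (by simp))
    refine ⟨fun c => ((c.1.1, c.2.1), (c.1.2, smulC u _ c.2.2)), fun c => ?_, fun c => ?_, ?_⟩
    · change (evalC l c.1.1 + y.w * evalC l c.2.1) +
        x.w * (evalC l c.1.2 + y.w * evalC l (smulC u _ c.2.2)) =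
        (evalC l c.1.1 + x.w * evalC l c.1.2) + y.w * (evalC l c.2.1 + x.w * evalC l c.2.2)
      rw [evalC_smulC, mul_add y.w, ← mul_assoc y.w, hxy]
      simp only [mul_add, smul_mul_assoc, mul_smul_comm, ← mul_assoc]
      abel
    · exact ⟨((c.1.1, c.2.1), (c.1.2, smulC u⁻¹ _ c.2.2)),
        Prod.ext rfl (Prod.ext rfl (smulC_smulC _ _ (mul_inv_cancel₀ hu) _ _))⟩
    · exact Prod.ext rfl (Prod.ext rfl (smulC_zero _ _))
  | trans h1 h2 ih1 ih2 =>
    obtain ⟨φ, a1, a2, a3⟩ := ih1 hL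
    obtain ⟨ψ, b1, b2, b3⟩ := ih2 fun g hg => hL g (h1.mem_iff.2 hg)
    exact ⟨ψ ∘ φ, fun c => (b1 _).trans (a1 c), b2.comp a2, (congrArg ψ a3).trans b3⟩

lemma Sph.perm {L L' : List (Gen A)} (hL : T.Sph L) (h : L.Perm L') : T.Sph L' := by
  obtain ⟨φ, h1, h2, h3⟩ := perm_aux h hL.gen
  refine ⟨fun g hg => hL.gen g (h.mem_iff.2 hg), fun a ha => ?_, fun c b hcb => ?_⟩
  · obtain ⟨c, b, h⟩ := hL.span a ha
    exact ⟨φ c, b, by rw [h1, h]⟩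
  · obtain ⟨c, rfl⟩ := h2 c
    rw [h1] at hcb
    rw [hL.ind c b hcb, h3]

lemma Sph.one_ne_zero {L : List (Gen A)} (hL : T.Sph L) : (1 : A) ≠ 0 := by
  intro h
  have key : ∀ L : List (Gen A), ∃ c : Coef L.length, c ≠ 0 := by
    intro L
    induction L with
    | nil => exact ⟨(show ℂ from 1), (_root_.one_ne_zero : (1 : ℂ) ≠ 0)⟩
    | cons g L ih =>
      obtain ⟨c, hc⟩ := ih
      exact ⟨(c, c), fun h => hc (congrArg Prod.fst h)⟩
  obtain ⟨c, hc⟩ := key L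
  exact hc (hL.ind c 0 (by rw [← one_mul (evalC L c), h]; simp))

lemma pr_algebraMap (m : ℤ) (c : ℂ) :
    T.pr m (algebraMap ℂ A c) = if m = 0 then algebraMap ℂ A c else 0 := by
  rw [Algebra.algebraMap_eq_smul_one, map_smul, ← T.pr_one]
  split_ifs with h
  · rw [h, T.pr_pr]
  · rw [T.pr_pr_ne _ _ _ h, smul_zero]

/-- Below the degrees of the generators the cohomology is that of a point. -/
lemma pr_evalC {L : List (Gen A)} (hL : ∀ g ∈ L, T.IsGen g) {n m : ℤ} (hn : ∀ g ∈ L, n ≤ g.deg)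
    (hm : m < n) (c : Coef L.length) : ∃ c0 : ℂ, T.pr m (evalC L c) = algebraMap ℂ A c0 := by
  induction L with
  | nil =>
    have h : ∀ z : ℂ, ∃ c0 : ℂ, T.pr m (algebraMap ℂ A z) = algebraMap ℂ A c0 := fun z => by
      refine ⟨if m = 0 then z else 0, ?_⟩
      rw [pr_algebraMap]
      split_ifs <;> simp
    exact h c
  | cons g L ih =>
    obtain ⟨c0, h⟩ := ih (fun g hg => hL g (by simp [hg])) (fun g hg => hn g (by simp [hg])) c.1
    refine ⟨c0, ?_⟩
    change T.pr m (evalC L c.1 + g.w * evalC L c.2) = _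
    rw [map_add, h, T.pr_mul g.deg _ _ _ (hL g (by simp)).homog,
      T.pr_neg _ _ (by have := hn g (by simp); omega)]
    simp

lemma Sph.low {L : List (Gen A)} (hL : T.Sph L) {n m : ℤ} (hn : ∀ g ∈ L, n ≤ g.deg)
    (hm : m < n) {a : A} (ha : T.D 0 (T.pr m a) = 0) :
    ∃ (c : ℂ) (b : A), T.pr m a = algebraMap ℂ A c + T.D 0 (T.pr (m - 1) b) ∧
      (m ≠ 0 → c = 0 ∨ (1 : A) = 0) := by
  obtain ⟨c, b, h⟩ := hL.span _ ha
  obtain ⟨c0, hc⟩ := pr_evalC hL.gen hn hm c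
  have h1 := congrArg (T.pr m) h
  rw [T.pr_pr, map_add, hc] at h1
  refine ⟨c0, b, ?_, fun h0 => ?_⟩
  · rw [h1, T.d_pr, sub_add_cancel]
  · have h2 := congrArg (T.pr m) hc
    rw [T.pr_pr, hc, pr_algebraMap, if_neg h0, Algebra.algebraMap_eq_smul_one] at h2
    exact smul_eq_zero.1 h2

end Stage

end FreeToralRank

namespace FreeToralRank

open Polynomial

namespace Stage

variable {σ A : Type} [Ring A] [Algebra ℂ A] {T : Stage σ A}

lemma eq_sum_pr (T : Stage σ A) (a : A) : ∃ s : Finset ℤ, a = ∑ i ∈ s, T.pr i a := by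
  obtain ⟨N, hN⟩ := T.pr_bdd a
  refine ⟨Finset.Icc 0 N, sub_eq_zero.1 (T.pr_ext _ fun m => ?_)⟩
  rw [map_sub, map_sum, Finset.sum_eq_single m, T.pr_pr, sub_self]
  · exact fun b _ hb => T.pr_pr_ne _ _ _ hb.symm
  · intro hm
    rw [T.pr_pr]
    rcases lt_or_ge m 0 with h | h
    · exact T.pr_neg _ _ h
    · exact hN m (by simp at hm; omega)

lemma pr_mul_filt {a b : A} {i j : ℤ} (ha : ∀ m, i < m → T.pr m a = 0)
    (hb : ∀ m, j < m → T.pr m b = 0) {m : ℤ} (hm : i + j < m) : T.pr m (a * b) = 0 := by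
  obtain ⟨s, hs⟩ := T.eq_sum_pr a
  rw [hs, Finset.sum_mul, map_sum]
  refine Finset.sum_eq_zero fun l _ => ?_
  rw [T.pr_mul l _ _ _ (T.pr_pr _ _)]
  rcases lt_or_ge i l with h | h
  · rw [ha l h, zero_mul]
  · rw [hb _ (by omega), mul_zero]

section Lift

variable {L : List (Gen A)}

lemma lift_aux (hS : T.Sph L) {n : ℤ} (hn : ∀ g ∈ L, n ≤ g.deg) (Z : Set (σ → ℂ))
    (hZ : ∀ p ∈ Z, ∀ a, T.D p (T.D p a) = 0) (N : ℕ) (hN : (N : ℤ) ≤ n) :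
    ∀ β ∈ polyFam σ A, (∀ p ∈ Z, T.D p (β p) = 0) → (∀ p ∈ Z, ∀ j, (N : ℤ) ≤ j → T.pr j (β p) = 0) →
      (∀ p, (∀ s ∈ T.S, p s = 0) → β p = 0) →
      ∃ γ ∈ polyFam σ A, ∃ f : MvPolynomial σ ℂ, (∀ p j, (N : ℤ) - 1 ≤ j → T.pr j (γ p) = 0) ∧
        (∀ p, (∀ s ∈ T.S, p s = 0) → γ p = 0 ∧ MvPolynomial.eval p f = 0) ∧
        ∀ p ∈ Z, β p - T.D p (γ p) = MvPolynomial.eval p f • (1 : A) := by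
  induction N with
  | zero =>
    intro β hβ hc hf hs
    refine ⟨fun _ => 0, polyFam_const 0, 0, by simp, by simp, fun p hp => ?_⟩
    rw [T.pr_ext (β p) fun m => ?_]
    · simp
    · rcases lt_or_ge m 0 with h | h
      · exact T.pr_neg _ _ h
      · exact hf p hp m (by simpa using h)
  | succ N ih =>
    intro β hβ hc hf hs
    have htop : ∀ p ∈ Z, T.D 0 (T.pr N (β p)) = 0 := by
      intro p hp
      rw [T.d_pr, ← T.D_filt p N (β p) (fun j hj => hf p hp j (by push_cast; omega)) _ (by omega),
        hc p hp, map_zero]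
    have hnt : Nontrivial A := ⟨⟨1, 0, hS.one_ne_zero⟩⟩
    rcases Nat.eq_zero_or_pos N with rfl | hN0
    · obtain ⟨u, hu⟩ := LinearMap.exists_leftInverse_of_injective (Algebra.linearMap ℂ A)
        (LinearMap.ker_eq_bot.2 (algebraMap ℂ A).injective)
      obtain ⟨f, hf'⟩ := polyFam_functional u hβ
      refine ⟨fun _ => 0, polyFam_const 0, f, by simp, fun p hp => ⟨rfl, by simp [hf', hs p hp]⟩,
        fun p hp => ?_⟩
      have h0 : β p = T.pr 0 (β p) := by
        refine sub_eq_zero.1 (T.pr_ext _ fun m => ?_)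
        rw [map_sub]
        rcases lt_trichotomy m 0 with h | rfl | h
        · rw [T.pr_neg _ _ h, T.pr_neg _ _ h, sub_zero]
        · rw [T.pr_pr, sub_self]
        · rw [T.pr_pr_ne _ _ _ h.ne', hf p hp m (by push_cast; omega), sub_zero]
      obtain ⟨c, b, hb, -⟩ := hS.low hn (m := 0) (by push_cast at hN; omega) (htop p hp)
      rw [T.pr_neg (0 - 1) b (by omega), map_zero, add_zero, ← h0] at hb
      have huc : u (algebraMap ℂ A c) = c := LinearMap.congr_fun hu c
      rw [map_zero, sub_zero, hf', hb, huc, Algebra.algebraMap_eq_smul_one]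
    · obtain ⟨h, hh⟩ := (T.D 0).rangeRestrict.exists_rightInverse_of_surjective
        (LinearMap.range_rangeRestrict _)
      obtain ⟨h, rfl⟩ := LinearMap.exists_extend h
      have hd : ∀ b, T.D 0 (h (T.D 0 b)) = T.D 0 b := fun b =>
        congrArg Subtype.val (LinearMap.congr_fun hh ⟨T.D 0 b, b, rfl⟩)
      let v : A →ₗ[ℂ] A := T.pr (N - 1) ∘ₗ h ∘ₗ T.pr N
      have hv : ∀ p ∈ Z, T.D 0 (v (β p)) = T.pr N (β p) := by
        intro p hp
        obtain ⟨c, b, hb, hc0⟩ := hS.low hn (m := N) (by push_cast at hN; omega) (htop p hp)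
        rw [(hc0 (by omega)).resolve_right hS.one_ne_zero, map_zero, zero_add] at hb
        change T.D 0 (T.pr (N - 1) (h (T.pr N (β p)))) = _
        rw [T.d_pr, hb, hd, ← hb, sub_add_cancel, T.pr_pr]
      have hγ : (fun p => v (β p)) ∈ polyFam σ A := polyFam_map v hβ
      obtain ⟨γ, h1, f, h2, h3, h4⟩ := ih (by push_cast at hN; omega)
        (fun p => β p - T.D p (v (β p)))
        ((polyFam σ A).sub_mem hβ (polyFam_apply T.D_poly hγ))
        (fun p hp => by rw [map_sub, hc p hp, hZ p hp, sub_zero])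
        (fun p hp j hj => by
          rw [map_sub, T.D_filt p (N - 1) (v (β p)) (fun j hj => T.pr_pr_ne _ _ _ (by omega)) _
            (by omega), hv p hp]
          rcases eq_or_lt_of_le hj with rfl | hj
          · rw [T.pr_pr, sub_self]
          · rw [T.pr_pr_ne _ _ _ hj.ne', hf p hp j (by push_cast; omega), sub_zero])
        (fun p hp => by simp [hs p hp])
      refine ⟨fun p => v (β p) + γ p, (polyFam σ A).add_mem hγ h1, f, fun p j hj => ?_,
        fun p hp => ⟨by simp [hs p hp, (h3 p hp).1], (h3 p hp).2⟩, fun p hp => ?_⟩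
      · push_cast at hj
        rw [map_add, h2 p j (by omega), add_zero]
        exact T.pr_pr_ne _ _ _ (by omega)
      · rw [map_add, ← sub_sub, h4 p hp]

/-- A generator of minimal degree extends to a polynomial family of elements which are closed up
to constants. -/
lemma lift {g : Gen A} (hS : T.Sph (g :: L)) (hn : ∀ g' ∈ L, g.deg ≤ g'.deg) (Z : Set (σ → ℂ))
    (hZ : ∀ p ∈ Z, ∀ a, T.D p (T.D p a) = 0) :
    ∃ γ ∈ polyFam σ A, ∃ f : MvPolynomial σ ℂ, (∀ p j, g.deg - 1 ≤ j → T.pr j (γ p) = 0) ∧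
      (∀ p, (∀ s ∈ T.S, p s = 0) → γ p = 0 ∧ MvPolynomial.eval p f = 0) ∧
      (∀ p ∈ Z, T.D p (g.w - γ p) = MvPolynomial.eval p f • (1 : A)) ∧
      (∀ p, T.ε (γ p) = (-1 : ℂ) ^ g.deg • γ p) ∧ (Even g.deg → f = 0) := by
  have hg := hS.gen g (by simp)
  have hdeg : ((g.deg.toNat : ℕ) : ℤ) = g.deg := Int.toNat_of_nonneg (by have := hg.pos; omega)
  obtain ⟨γ, h1, f, h2, h3, h4⟩ := lift_aux hS (n := g.deg) (by simpa using hn) Z hZ g.deg.toNat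
    hdeg.le (fun p => T.D p g.w) (T.D_poly _) (fun p hp => hZ p hp _)
    (fun p _ j hj => by
      rw [T.D_filt p g.deg _ (fun j hj => by rw [← hg.homog, T.pr_pr_ne _ _ _ hj.ne']) _ (by omega),
        hg.closed, map_zero])
    (fun p hp => by rw [T.D_S p hp, hg.closed])
  rw [hdeg] at h2
  let u : ℂ := (-1) ^ g.deg
  have huu : u * u = 1 := by
    rw [← zpow_add₀ (by simp), Even.neg_one_zpow ⟨_, rfl⟩]
  let v : A →ₗ[ℂ] A := (2 : ℂ)⁻¹ • (LinearMap.id + u • T.ε.toLinearMap)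
  have hv : ∀ a, v a = (2 : ℂ)⁻¹ • (a + u • T.ε a) := fun a => rfl
  refine ⟨fun p => v (γ p), polyFam_map v h1, if Even g.deg then 0 else f, fun p j hj => ?_,
    fun p hp => ⟨by simp [(h3 p hp).1], by split_ifs <;> simp [(h3 p hp).2]⟩, fun p hp => ?_,
    fun p => ?_, fun h => by simp [h]⟩
  · change T.pr j (v (γ p)) = 0
    rw [hv, map_smul, map_add, map_smul, T.pr_ε, h2 p j hj]
    simp
  · have hvw : v g.w = g.w := by
      rw [hv, hg.ε_w, smul_smul, huu, one_smul, ← two_smul ℂ, smul_smul, inv_mul_cancel₀ two_ne_zero,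
        one_smul]
    have h5 : T.D p (g.w - γ p) = MvPolynomial.eval p f • (1 : A) := by rw [map_sub, h4 p hp]
    nth_rewrite 1 [← hvw]
    rw [← map_sub, hv, map_smul, map_add, map_smul, T.D_ε, h5, map_smul, map_one]
    split_ifs with h
    · simp [u, h.neg_one_zpow]
    · simp only [u, (Int.not_even_iff_odd.1 h).neg_one_zpow]
      rw [smul_neg, neg_one_smul, neg_neg, ← two_smul ℂ, smul_smul, inv_mul_cancel₀ two_ne_zero,
        one_smul]
  · change T.ε (v (γ p)) = u • v (γ p)
    rw [hv, map_smul, map_add, map_smul, T.εε]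
    rw [smul_comm u, smul_add u, smul_smul u, huu, one_smul, add_comm]

end Lift

/-- The base case: without generators, constants are never exact. -/
lemma not_exact (hS : T.Sph []) (p : σ → ℂ) (hp : ∀ a, T.D p (T.D p a) = 0) (b : A) :
    T.D p b ≠ 1 := by
  have key : ∀ N : ℕ, ∀ b, (∀ j, (N : ℤ) ≤ j → T.pr j b = 0) → T.D p b ≠ 1 := by
    intro N
    induction N with
    | zero =>
      intro b hb h
      rw [T.pr_ext b fun m => ?_, map_zero] at h
      · exact hS.one_ne_zero h.symm
      · rcases lt_or_ge m 0 with h | h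
        · exact T.pr_neg _ _ h
        · exact hb m (by simpa using h)
    | succ N ih =>
      intro b hb h
      have h0 : T.D 0 (T.pr N b) = 0 := by
        rw [T.d_pr, ← T.D_filt p N b (fun j hj => hb j (by push_cast; omega)) _ (by omega), h,
          ← T.pr_one, T.pr_pr_ne _ _ _ (by omega)]
      obtain ⟨c, e, he, hc⟩ := hS.low (n := N + 1) (by simp) (by omega) h0
      refine ih (b - algebraMap ℂ A c - T.D p (T.pr (N - 1) e)) (fun j hj => ?_) ?_
      · rw [map_sub, map_sub, T.D_filt p (N - 1) _ (fun j hj => T.pr_pr_ne _ _ _ (by omega)) _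
          (by omega), eq_sub_of_add_eq' he.symm, map_sub, pr_algebraMap]
        rcases eq_or_lt_of_le hj with rfl | hj
        · rw [T.pr_pr]
          simp
        · rw [T.pr_pr_ne _ _ _ hj.ne', hb j (by push_cast; omega)]
          simp
      · rw [map_sub, map_sub, hp, D_algebraMap, h]
        simp
  obtain ⟨N, hN⟩ := T.pr_bdd b
  exact key (N + 1).toNat b fun j hj => hN j (by omega)

end Stage

end FreeToralRank

namespace FreeToralRank

open Polynomial

section CoeffMap

variable {A : Type} [Ring A] [Algebra ℂ A]

/-- Apply linear maps coefficientwise. -/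
noncomputable def cmap (u : ℕ → A →ₗ[ℂ] A) : A[X] →ₗ[ℂ] A[X] :=
  Polynomial.lsum fun j => ((monomial j : A →ₗ[A] A[X]).restrictScalars ℂ) ∘ₗ u j

lemma cmap_monomial (u : ℕ → A →ₗ[ℂ] A) (j : ℕ) (a : A) :
    cmap u (monomial j a) = monomial j (u j a) := by
  simp [cmap, Polynomial.lsum, Polynomial.sum_monomial_index]

@[simp] lemma coeff_cmap (u : ℕ → A →ₗ[ℂ] A) (q : A[X]) (j : ℕ) :
    (cmap u q).coeff j = u j (q.coeff j) := by
  induction q using Polynomial.induction_on' with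
  | add p q hp hq => simp [hp, hq]
  | monomial n a =>
    rw [cmap_monomial, coeff_monomial, coeff_monomial]
    split_ifs with h
    · rw [h]
    · simp

/-- The derivation of `A[X]` extending `D` and sending `X` to `x`. -/
noncomputable def polyD (D : A →ₗ[ℂ] A) (x : A) : A[X] →ₗ[ℂ] A[X] :=
  cmap (fun _ => D) + (LinearMap.mulLeft ℂ (C x)) ∘ₗ (derivative : A[X] →ₗ[A] A[X]).restrictScalars ℂ

lemma polyD_apply (D : A →ₗ[ℂ] A) (x : A) (q : A[X]) :
    polyD D x q = cmap (fun _ => D) q + C x * derivative q := rfl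

lemma coeff_polyD (D : A →ₗ[ℂ] A) (x : A) (q : A[X]) (j : ℕ) :
    (polyD D x q).coeff j = D (q.coeff j) + ((j : ℂ) + 1) • (x * q.coeff (j + 1)) := by
  rw [polyD_apply, coeff_add, coeff_cmap, coeff_C_mul, coeff_derivative, ← mul_assoc]
  congr 1
  rw [Algebra.smul_def, Algebra.commutes]
  simp

lemma polyD_monomial (D : A →ₗ[ℂ] A) (x : A) (j : ℕ) (a : A) :
    polyD D x (monomial j a) = monomial j (D a) + monomial (j - 1) ((j : ℂ) • (x * a)) := by
  rw [polyD_apply, cmap_monomial, derivative_monomial, C_mul_monomial]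
  congr 2
  rw [Algebra.smul_def, Algebra.commutes, mul_assoc]
  simp

lemma polyD_C (D : A →ₗ[ℂ] A) (x : A) (a : A) : polyD D x (C a) = C (D a) := by
  simpa using polyD_monomial D x 0 a

end CoeffMap

namespace Stage

variable {σ A : Type} [Ring A] [Algebra ℂ A] (T : Stage σ A)

/-- Data for adjoining a variable of degree `k` whose image under `D p` is `x p`. -/
structure KillData (x : (σ → ℂ) → A) (k : ℤ) (S : Set σ) : Prop where
  hk : 0 ≤ k
  poly : x ∈ polyFam σ A
  closed : T.D 0 (x 0) = 0
  homog : T.pr (k + 1) (x 0) = x 0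
  filt : ∀ p j, k ≤ j → T.pr j (x p) = T.pr j (x 0)
  parity : ∀ p, T.ε (x p) = (-1 : ℂ) ^ (k + 1) • x p
  const : ∀ p, (∀ s ∈ S, p s = 0) → x p = x 0

variable {T}

lemma D_mul_w {p : σ → ℂ} {x b : A} (hx : T.D p x = 0) (ho : T.ε x = -x) :
    T.D p (x * b) = -(x * T.D p b) := by
  rw [T.D_mul, hx, ho, zero_mul, zero_add, neg_mul]

lemma D_mul_even {p : σ → ℂ} {x b : A} (hx : T.D p x = 0) (ho : T.ε x = x) :
    T.D p (x * b) = x * T.D p b := by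
  rw [T.D_mul, hx, ho, zero_mul, zero_add]

lemma polyD_sq {p : σ → ℂ} (hp : ∀ a, T.D p (T.D p a) = 0) {x : A} (hx : T.D p x = 0)
    (ho : T.ε x = -x) (q : A[X]) : polyD (T.D p) x (polyD (T.D p) x q) = 0 := by
  ext j
  simp only [coeff_polyD, map_add, map_smul, hp, D_mul_w hx ho, mul_add, mul_smul_comm, ← mul_assoc,
    sq_zero_of_odd ho, zero_mul, smul_zero, add_zero, coeff_zero, zero_add]
  simp

lemma pr_mul_diff {x : (σ → ℂ) → A} {k : ℤ} {S : Set σ} (h : T.KillData x k S) (p : σ → ℂ) {a : A}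
    {m j : ℤ} (ha : ∀ i, m < i → T.pr i a = 0) (hj : m + k - 1 < j) :
    T.pr j (x p * a) = T.pr j (x 0 * a) := by
  rw [← sub_eq_zero, ← map_sub, ← sub_mul]
  refine pr_mul_filt (i := k - 1) (j := m) (fun i hi => ?_) ha (by omega)
  rw [map_sub, h.filt p i (by omega), sub_self]

/-- Adjoin an even variable of degree `k`. -/
noncomputable def oddKill (x : (σ → ℂ) → A) (k : ℤ) (h : T.KillData x k T.S) (hk : Even k) :
    Stage σ A[X] :=
  have ho : ∀ p, T.ε (x p) = -x p := fun p => by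
    rw [h.parity p, hk.add_one.neg_one_zpow, neg_one_smul]
  have hs : ∀ (m : ℤ) (j : ℕ), (-1 : ℂ) ^ (m - j * k) = (-1) ^ m := fun m j => by
    rw [zpow_sub₀ (by simp), (hk.mul_left _).neg_one_zpow, div_one]
  { ε := Polynomial.mapAlgHom T.ε
    pr := fun m => cmap fun j => T.pr (m - j * k)
    D := fun p => polyD (T.D p) (x p)
    S := T.S
    εε := fun q => by ext j; simp [T.εε]
    even_comm := fun q r hq => by
      have hq : ∀ j, T.ε (q.coeff j) = q.coeff j := fun j => by
        simpa using congrArg (fun r => coeff r j) hq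
      ext j
      rw [coeff_mul, coeff_mul, ← Finset.Nat.sum_antidiagonal_swap]
      exact Finset.sum_congr rfl fun i _ => T.even_comm _ _ (hq _)
    odd_comm := fun q r hq => by
      have hq : ∀ j, T.ε (q.coeff j) = -q.coeff j := fun j => by
        simpa using congrArg (fun r => coeff r j) hq
      ext j
      rw [coeff_mul, coeff_mul, ← Finset.Nat.sum_antidiagonal_swap]
      refine Finset.sum_congr rfl fun i _ => ?_
      rw [T.odd_comm _ _ (hq _)]
      simp
    pr_pr := fun i q => by ext j; simp [T.pr_pr]
    pr_pr_ne := fun i j q hij => by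
      ext l
      simp only [coeff_cmap, coeff_zero]
      exact T.pr_pr_ne _ _ _ (by omega)
    pr_neg := fun i q hi => by
      ext l
      simp only [coeff_cmap, coeff_zero]
      exact T.pr_neg _ _ (by have := mul_nonneg (Int.natCast_nonneg l) h.hk; omega)
    pr_one := by
      ext l
      rw [coeff_cmap, coeff_one]
      split_ifs with hl
      · simp [hl, T.pr_one]
      · simp
    pr_bdd := fun q => by
      choose N hN using fun j => T.pr_bdd (q.coeff j)
      obtain ⟨M, hM⟩ := (q.support.image fun j => N j + j * k).exists_le
      refine ⟨M, fun m hm => ?_⟩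
      ext j
      rw [coeff_cmap, coeff_zero]
      by_cases hj : q.coeff j = 0
      · simp [hj]
      · have := hM _ (Finset.mem_image_of_mem (fun j => N j + j * k) (mem_support_iff.2 hj))
        exact hN j _ (by linarith)
    pr_ext := fun q hq => by
      ext j
      rw [coeff_zero]
      refine T.pr_ext _ fun m => ?_
      simpa using congrArg (fun r => coeff r j) (hq (m + j * k))
    pr_mul := fun i m a b hab => by
      have hq : ∀ j : ℕ, T.pr (i - j * k) (a.coeff j) = a.coeff j := fun j => by
        simpa using congrArg (fun r => coeff r j) hab
      ext j
      rw [coeff_cmap, coeff_mul, coeff_mul, map_sum]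
      refine Finset.sum_congr rfl fun l hl => ?_
      rw [T.pr_mul _ _ _ _ (hq _), coeff_cmap]
      congr 3
      have hl' : l.1 + l.2 = j := by simpa using hl
      rw [← hl']
      push_cast
      ring
    ε_pr := fun m a => by
      ext j
      simp [T.ε_pr, hs]
    pr_ε := fun m a => by
      ext j
      simp [T.pr_ε, hs]
    D_mul := fun p a b => by
      have h1 : cmap (fun _ => T.D p) (a * b) =
          cmap (fun _ => T.D p) a * b + Polynomial.mapAlgHom T.ε a * cmap (fun _ => T.D p) b := by
        ext j
        simp only [coeff_cmap, coeff_mul, map_sum, coeff_add, T.D_mul, Finset.sum_add_distrib]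
        simp
      have h2 : C (x p) * a = Polynomial.mapAlgHom T.ε a * C (x p) := by
        ext j
        rw [coeff_C_mul, coeff_mul_C, T.odd_comm _ _ (ho p)]
        simp
      rw [polyD_apply, polyD_apply, polyD_apply, h1, derivative_mul, mul_add, mul_add,
        ← mul_assoc (C (x p)) a, h2]
      noncomm_ring
    D_ε := fun p a => by
      ext j
      rw [coeff_neg]
      have hc : ∀ q : A[X], (Polynomial.mapAlgHom T.ε q).coeff j = T.ε (q.coeff j) := fun q => by
        simp
      rw [hc]
      rw [coeff_polyD, coeff_polyD, map_add, map_smul, map_mul, ho]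
      simp [T.D_ε]
      abel
    D_poly := fun q => by
      induction q using Polynomial.induction_on' with
      | add q r hq hr => simpa [Pi.add_def] using (polyFam σ A[X]).add_mem hq hr
      | monomial j a =>
        simp only [polyD_monomial]
        refine (polyFam σ A[X]).add_mem
          (polyFam_map ((monomial j : A →ₗ[A] A[X]).restrictScalars ℂ) (T.D_poly a))
          (polyFam_map (((monomial (j - 1) : A →ₗ[A] A[X]).restrictScalars ℂ) ∘ₗ
            ((j : ℂ) • LinearMap.mulRight ℂ a)) h.poly)
    d_pr := fun m q => by
      ext j
      have e1 : m + 1 - j * k = m - j * k + 1 := by ring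
      have e2 : m + 1 - j * k - (k + 1) = m - ((j + 1 : ℕ) : ℤ) * k := by push_cast; ring
      rw [coeff_polyD, coeff_cmap, coeff_cmap, coeff_cmap, coeff_polyD, map_add, map_smul,
        T.pr_mul (k + 1) _ _ _ h.homog, T.d_pr, e2, e1]
    d_d := fun q => polyD_sq T.d_d h.closed (ho 0) q
    D_filt := fun p m q hq i hi => by
      have hq : ∀ (l : ℕ) (i : ℤ), m - l * k < i → T.pr i (q.coeff l) = 0 := fun l i hi => by
        simpa using congrArg (fun r => coeff r l) (hq (i + l * k) (by omega))
      ext l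
      simp only [coeff_polyD, coeff_cmap, map_add, map_smul]
      rw [T.D_filt p (m - l * k) _ (hq l) _ (by omega),
        pr_mul_diff h p (hq (l + 1)) (by push_cast; linarith)]
    D_S := fun p hp => by
      rw [T.D_S p hp, h.const p hp] }

end Stage

end FreeToralRank

namespace FreeToralRank

open Polynomial

/-- Transport of a generator. -/
def Gen.map {A B : Type} (u : A → B) (g : Gen A) : Gen B := ⟨u g.w, u g.e, g.deg⟩

section

variable {A B : Type} [Ring A] [Algebra ℂ A] [Ring B] [Algebra ℂ B]

lemma evalC_map (u : A →ₐ[ℂ] B) (L : List (Gen A)) :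
    ∃ φ : Coef L.length → Coef (L.map (Gen.map u)).length,
      (∀ c, evalC (L.map (Gen.map u)) (φ c) = u (evalC L c)) ∧ Function.Surjective φ ∧ φ 0 = 0 := by
  induction L with
  | nil => exact ⟨id, fun c => (u.commutes c).symm, Function.surjective_id, rfl⟩
  | cons g L ih =>
    obtain ⟨φ, h1, h2, h3⟩ := ih
    refine ⟨fun c => (φ c.1, φ c.2), fun c => ?_, fun c => ?_, Prod.ext h3 h3⟩
    · change evalC _ (φ c.1) + u g.w * evalC _ (φ c.2) = u (evalC L c.1 + g.w * evalC L c.2)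
      rw [h1, h1, map_add, map_mul]
    · obtain ⟨c1, hc1⟩ := h2 c.1
      obtain ⟨c2, hc2⟩ := h2 c.2
      exact ⟨(c1, c2), Prod.ext hc1 hc2⟩

end

namespace Stage

variable {σ A B : Type} [Ring A] [Algebra ℂ A] [Ring B] [Algebra ℂ B] {T : Stage σ A}
  {T' : Stage σ B}

lemma Sph.of_map (u : A →ₐ[ℂ] B) (L : List (Gen A))
    (gen : ∀ g ∈ L, T'.IsGen (g.map u))
    (span : ∀ b, T'.D 0 b = 0 → ∃ c b', b = u (evalC L c) + T'.D 0 b')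
    (ind : ∀ c b, u (evalC L c) = T'.D 0 b → c = 0) : T'.Sph (L.map (Gen.map u)) := by
  obtain ⟨φ, h1, h2, h3⟩ := evalC_map u L
  refine ⟨fun g hg => ?_, fun a ha => ?_, fun c b hcb => ?_⟩
  · obtain ⟨g', hg', rfl⟩ := List.mem_map.1 hg
    exact gen g' hg'
  · obtain ⟨c, b, h⟩ := span a ha
    exact ⟨φ c, b, by rw [h1, h]⟩
  · obtain ⟨c, rfl⟩ := h2 c
    rw [h1] at hcb
    rw [ind c b hcb, h3]

lemma Sph.cons_of_map (u : A →ₐ[ℂ] B) (L : List (Gen A)) (g' : Gen B) (hg' : T'.IsGen g')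
    (gen : ∀ g ∈ L, T'.IsGen (g.map u))
    (span : ∀ b, T'.D 0 b = 0 → ∃ c c' b', b = u (evalC L c) + g'.w * u (evalC L c') + T'.D 0 b')
    (ind : ∀ c c' b, u (evalC L c) + g'.w * u (evalC L c') = T'.D 0 b → c = 0 ∧ c' = 0) :
    T'.Sph (g' :: L.map (Gen.map u)) := by
  obtain ⟨φ, h1, h2, h3⟩ := evalC_map u L
  refine ⟨fun g hg => ?_, fun a ha => ?_, fun c b hcb => ?_⟩
  · rcases List.mem_cons.1 hg with rfl | hg
    · exact hg'
    · obtain ⟨g', hg', rfl⟩ := List.mem_map.1 hg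
      exact gen g' hg'
  · obtain ⟨c, c', b, h⟩ := span a ha
    exact ⟨(φ c, φ c'), b, by rw [evalC_cons, h1, h1, h]⟩
  · obtain ⟨c, c'⟩ := c
    obtain ⟨c, rfl⟩ := h2 c
    obtain ⟨c', rfl⟩ := h2 c'
    rw [evalC_cons, h1, h1] at hcb
    obtain ⟨rfl, rfl⟩ := ind c c' b hcb
    exact Prod.ext h3 h3

lemma closed_gen_mul {g : Gen A} {L : List (Gen A)} (hS : T.Sph (g :: L)) (c : Coef L.length) :
    T.D 0 (evalC L c) = 0 :=
  closed_evalC (fun g hg => hS.gen g (by simp [hg])) c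

/-- If `a` is closed and `g * a` is exact, then `a` is cohomologous to a multiple of `g`,
provided `g * g` is exact in a way compatible with closed elements. -/
lemma Sph.of_mul_exact {g : Gen A} {L : List (Gen A)} (hS : T.Sph (g :: L))
    (hsq : ∀ a, T.D 0 a = 0 → ∃ b, g.w * (g.w * a) = T.D 0 b)
    {a b : A} (ha : T.D 0 a = 0) (hab : g.w * a = T.D 0 b) :
    ∃ c b', a = g.w * evalC L c + T.D 0 b' := by
  obtain ⟨⟨c1, c2⟩, e, he⟩ := hS.span a ha
  have hg := hS.gen g (by simp)
  obtain ⟨b2, hb2⟩ := hsq _ (closed_gen_mul hS c2)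
  have hwe : ∃ b3, g.w * T.D 0 e = T.D 0 b3 := by
    rcases Int.even_or_odd g.deg with h | h
    · exact ⟨g.w * e, by rw [D_mul_even hg.closed (hg.ε_even h)]⟩
    · exact ⟨-(g.w * e), by rw [map_neg, D_mul_w hg.closed (hg.ε_odd h), neg_neg]⟩
  obtain ⟨b3, hb3⟩ := hwe
  rw [evalC_cons] at he
  have h0 := hS.ind (0, c1) (b - b2 - b3) (by
    rw [evalC_cons, evalC_zero, zero_add, map_sub, map_sub, ← hab, he, ← hb2, ← hb3]
    noncomm_ring)
  have hc1 : c1 = 0 := congrArg Prod.snd h0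
  exact ⟨c2, e, by rw [he, hc1, evalC_zero, zero_add]⟩

lemma IsGen.oddKill {x : (σ → ℂ) → A} {k : ℤ} {h : T.KillData x k T.S} {hk : Even k} {g : Gen A}
    (hg : T.IsGen g) : (T.oddKill x k h hk).IsGen (g.map (Polynomial.CAlgHom (R := ℂ))) := by
  have hpr : ∀ m (a : A), T.pr m a = a → (T.oddKill x k h hk).pr m (C a) = C a := fun m a ha => by
    change cmap _ (monomial 0 a) = monomial 0 a
    rw [cmap_monomial]
    simp [ha]
  refine ⟨?_, hpr _ _ hg.homog, hg.pos, fun he => ?_, fun he => hpr _ _ (hg.homog_e he)⟩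
  · change polyD _ _ (C g.w) = 0
    rw [polyD_C, hg.closed, C_0]
  · change polyD _ _ (C g.e) = C g.w * C g.w
    rw [polyD_C, hg.sq he, C_mul]

lemma Sph.oddKill {g : Gen A} {L : List (Gen A)} (hS : T.Sph (g :: L)) {x : (σ → ℂ) → A} {k : ℤ}
    (h : T.KillData x k T.S) (hk : Even k) (hx : x 0 = g.w) (hodd : Odd g.deg) :
    (T.oddKill x k h hk).Sph (L.map (Gen.map (Polynomial.CAlgHom (R := ℂ)))) := by
  have hg := hS.gen g (by simp)
  have ho := hg.ε_odd hodd
  have hww := sq_zero_of_odd ho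
  set T' := T.oddKill x k h hk with hT'
  have hD : ∀ q, T'.D 0 q = polyD (T.D 0) g.w q := fun q => by rw [← hx]; rfl
  have hC : ∀ a, (Polynomial.CAlgHom (R := ℂ) : A →ₐ[ℂ] A[X]) a = C a := fun _ => rfl
  have hmul : ∀ {a b}, T.D 0 a = 0 → g.w * a = T.D 0 b →
      ∃ c b', a = g.w * evalC L c + T.D 0 b' := fun ha hab =>
    hS.of_mul_exact (fun a _ => ⟨0, by rw [← mul_assoc, hww, zero_mul, map_zero]⟩) ha hab
  have hmono : ∀ (n : ℕ) (c) (b : A), polyD (T.D 0) g.w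
      (monomial (n + 1) (((n : ℂ) + 1)⁻¹ • evalC L c) + monomial n b) =
      monomial n (g.w * evalC L c + T.D 0 b) + monomial (n - 1) ((n : ℂ) • (g.w * b)) := by
    intro n c b
    have hn : (n : ℂ) + 1 ≠ 0 := Nat.cast_add_one_ne_zero n
    rw [map_add, polyD_monomial, polyD_monomial, map_smul, closed_gen_mul hS, smul_zero, map_zero,
      zero_add, mul_smul_comm, smul_smul]
    push_cast
    rw [mul_inv_cancel₀ hn, one_smul, map_add]
    simp [add_assoc]
  refine Sph.of_map _ L (fun g' hg' => (hS.gen g' (by simp [hg'])).oddKill) (fun q hq => ?_)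
    (fun c q hcq => ?_)
  · simp only [hD, hC] at hq ⊢
    have key : ∀ N : ℕ, ∀ q : A[X], (∀ j, N < j → q.coeff j = 0) → polyD (T.D 0) g.w q = 0 →
        ∃ c b, q = C (evalC L c) + polyD (T.D 0) g.w b := by
      intro N
      induction N with
      | zero =>
        intro q hN hq
        have hqC : q = C (q.coeff 0) := by
          ext j
          rcases Nat.eq_zero_or_pos j with rfl | hj
          · simp
          · rw [hN j hj, coeff_C_of_ne_zero hj.ne']
        rw [hqC, polyD_C, C_eq_zero] at hq
        obtain ⟨⟨c1, c2⟩, b, hb⟩ := hS.span _ hq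
        refine ⟨c1, monomial (0 + 1) ((((0 : ℕ) : ℂ) + 1)⁻¹ • evalC L c2) + monomial 0 b, ?_⟩
        rw [hmono 0 c2 b, hqC, hb, evalC_cons]
        simp [add_assoc]
      | succ N ih =>
        intro q hN hq
        have h1 := congrArg (fun r => coeff r (N + 1)) hq
        have h2 := congrArg (fun r => coeff r N) hq
        simp only [coeff_polyD, hN (N + 1 + 1) (by omega), mul_zero, smul_zero, add_zero,
          coeff_zero] at h1 h2
        obtain ⟨c, b, hcb⟩ := hmul (b := -((N : ℂ) + 1)⁻¹ • q.coeff N) h1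
          (by
            have hn : (N : ℂ) + 1 ≠ 0 := Nat.cast_add_one_ne_zero N
            rw [map_smul, eq_neg_of_add_eq_zero_left h2, neg_smul, smul_neg, neg_neg, smul_smul,
              inv_mul_cancel₀ hn, one_smul])
        have hr := hmono (N + 1) c b
        rw [← hcb] at hr
        obtain ⟨c', b', hb'⟩ := ih (q - polyD (T.D 0) g.w (monomial (N + 1 + 1)
            ((((N + 1 : ℕ) : ℂ) + 1)⁻¹ • evalC L c) + monomial (N + 1) b)) (fun j hj => by
          rw [hr, coeff_sub, coeff_add, coeff_monomial, coeff_monomial]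
          rcases eq_or_ne (N + 1) j with rfl | hne
          · simp
          · rw [if_neg hne, if_neg (by omega), hN j (by omega)]
            simp) (by
          rw [map_sub, hq, polyD_sq T.d_d hg.closed ho, sub_zero])
        exact ⟨c', _, by rw [sub_eq_iff_eq_add.1 hb', add_assoc, ← map_add]⟩
    exact key q.natDegree q (fun j hj => coeff_eq_zero_of_natDegree_lt hj) hq
  · simp only [hD, hC] at hcq
    have key : ∀ N : ℕ, ∀ q : A[X], (∀ j, N + 1 < j → q.coeff j = 0) →
        C (evalC L c) = polyD (T.D 0) g.w q → c = 0 := by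
      intro N
      induction N with
      | zero =>
        intro q hN hq
        have h0 := congrArg (fun r => coeff r 0) hq
        have h1 := congrArg (fun r => coeff r 1) hq
        simp only [coeff_polyD, hN (1 + 1) (by omega), mul_zero, smul_zero, add_zero,
          coeff_C_zero, coeff_C_succ, Nat.cast_zero, zero_add, one_smul] at h0 h1
        obtain ⟨⟨c1, c2⟩, b, hb⟩ := hS.span _ h1.symm
        have hd := D_mul_w (b := b) hg.closed ho
        have := hS.ind (c, -c1) (q.coeff 0 - g.w * b) (by
          rw [evalC_cons, h0, hb, evalC_cons, evalC_neg, map_sub, hd, mul_add, mul_add, ← mul_assoc,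
            hww]
          noncomm_ring)
        exact congrArg Prod.fst this
      | succ N ih =>
        intro q hN hq
        have h1 := congrArg (fun r => coeff r (N + 1 + 1)) hq
        have h2 := congrArg (fun r => coeff r (N + 1)) hq
        simp only [coeff_polyD, hN (N + 1 + 1 + 1) (by omega), mul_zero, smul_zero, add_zero,
          coeff_C_succ] at h1 h2
        obtain ⟨c', b, hcb⟩ := hmul (b := - (((N + 1 : ℕ) : ℂ) + 1)⁻¹ • q.coeff (N + 1)) h1.symm
          (by
            have hn : ((N + 1 : ℕ) : ℂ) + 1 ≠ 0 := Nat.cast_add_one_ne_zero _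
            rw [map_smul, eq_neg_of_add_eq_zero_left h2.symm,
              neg_smul, smul_neg, neg_neg, smul_smul, inv_mul_cancel₀ hn, one_smul])
        have hr := hmono (N + 1 + 1) c' b
        rw [← hcb] at hr
        refine ih (q - polyD (T.D 0) g.w (monomial (N + 1 + 1 + 1)
            ((((N + 1 + 1 : ℕ) : ℂ) + 1)⁻¹ • evalC L c') + monomial (N + 1 + 1) b)) (fun j hj => ?_) ?_
        · rw [hr, coeff_sub, coeff_add, coeff_monomial, coeff_monomial]
          rcases eq_or_ne (N + 1 + 1) j with rfl | hne
          · simp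
          · rw [if_neg hne, if_neg (by omega), hN j (by omega)]
            simp
        · rw [map_sub, polyD_sq T.d_d hg.closed ho, sub_zero, hq]
    exact key q.natDegree q (fun j hj => coeff_eq_zero_of_natDegree_lt (by omega)) hcq

end Stage

end FreeToralRank

namespace FreeToralRank

open Polynomial

variable {σ A : Type} [Ring A] [Algebra ℂ A]

/-- The algebra obtained by adjoining an odd variable: `(a, b)` stands for `a + z * b`. -/
@[ext] structure OddExt (ε : A →ₐ[ℂ] A) : Type where
  fst : A
  snd : A

namespace OddExt

variable {ε : A →ₐ[ℂ] A}

instance : Zero (OddExt ε) := ⟨⟨0, 0⟩⟩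
instance : One (OddExt ε) := ⟨⟨1, 0⟩⟩
instance : Add (OddExt ε) := ⟨fun a b => ⟨a.fst + b.fst, a.snd + b.snd⟩⟩
instance : Neg (OddExt ε) := ⟨fun a => ⟨-a.fst, -a.snd⟩⟩
instance : Mul (OddExt ε) := ⟨fun a b => ⟨a.fst * b.fst, ε a.fst * b.snd + a.snd * b.fst⟩⟩
noncomputable instance : SMul ℂ (OddExt ε) := ⟨fun c a => ⟨c • a.fst, c • a.snd⟩⟩

@[simp] lemma fst_zero : (0 : OddExt ε).fst = 0 := rfl
@[simp] lemma snd_zero : (0 : OddExt ε).snd = 0 := rfl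
@[simp] lemma fst_one : (1 : OddExt ε).fst = 1 := rfl
@[simp] lemma snd_one : (1 : OddExt ε).snd = 0 := rfl
@[simp] lemma fst_add (a b : OddExt ε) : (a + b).fst = a.fst + b.fst := rfl
@[simp] lemma snd_add (a b : OddExt ε) : (a + b).snd = a.snd + b.snd := rfl
@[simp] lemma fst_neg (a : OddExt ε) : (-a).fst = -a.fst := rfl
@[simp] lemma snd_neg (a : OddExt ε) : (-a).snd = -a.snd := rfl
@[simp] lemma fst_mul (a b : OddExt ε) : (a * b).fst = a.fst * b.fst := rfl
@[simp] lemma snd_mul (a b : OddExt ε) : (a * b).snd = ε a.fst * b.snd + a.snd * b.fst := rfl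
@[simp] lemma fst_smul (c : ℂ) (a : OddExt ε) : (c • a).fst = c • a.fst := rfl
@[simp] lemma snd_smul (c : ℂ) (a : OddExt ε) : (c • a).snd = c • a.snd := rfl

noncomputable instance : Ring (OddExt ε) where
  add_assoc _ _ _ := by ext <;> simp [add_assoc]
  zero_add _ := by ext <;> simp
  add_zero _ := by ext <;> simp
  add_comm _ _ := by ext <;> simp [add_comm]
  neg_add_cancel _ := by ext <;> simp
  nsmul := nsmulRec
  zsmul := zsmulRec
  left_distrib _ _ _ := by
    ext <;> simp [mul_add]
    abel
  right_distrib _ _ _ := by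
    ext <;> simp [add_mul]
    abel
  zero_mul _ := by ext <;> simp
  mul_zero _ := by ext <;> simp
  mul_assoc _ _ _ := by ext <;> simp [mul_add, add_mul, mul_assoc, add_assoc]
  one_mul _ := by ext <;> simp
  mul_one _ := by ext <;> simp

noncomputable instance : Module ℂ (OddExt ε) where
  one_smul _ := by ext <;> simp
  mul_smul _ _ _ := by ext <;> simp [mul_smul]
  smul_zero _ := by ext <;> simp
  smul_add _ _ _ := by ext <;> simp
  add_smul _ _ _ := by ext <;> simp [add_smul]
  zero_smul _ := by ext <;> simp

noncomputable instance : Algebra ℂ (OddExt ε) :=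
  Algebra.ofModule (fun _ _ _ => by ext <;> simp) (fun _ _ _ => by ext <;> simp)

/-- The inclusion of the base algebra. -/
noncomputable def incl (ε : A →ₐ[ℂ] A) : A →ₐ[ℂ] OddExt ε :=
  AlgHom.ofLinearMap
    { toFun := fun a => ⟨a, 0⟩
      map_add' := fun _ _ => by ext <;> simp
      map_smul' := fun _ _ => by ext <;> simp } rfl (fun _ _ => by ext <;> simp)

@[simp] lemma incl_apply (a : A) : incl ε a = ⟨a, 0⟩ := rfl

/-- The linear map with given matrix entries, upper triangular. -/
noncomputable def tri (u v w : A →ₗ[ℂ] A) : OddExt ε →ₗ[ℂ] OddExt ε where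
  toFun a := ⟨u a.fst + v a.snd, w a.snd⟩
  map_add' _ _ := by ext <;> simp [add_add_add_comm]
  map_smul' _ _ := by ext <;> simp

@[simp] lemma tri_fst (u v w : A →ₗ[ℂ] A) (a : OddExt ε) :
    (tri u v w a).fst = u a.fst + v a.snd := rfl
@[simp] lemma tri_snd (u v w : A →ₗ[ℂ] A) (a : OddExt ε) : (tri u v w a).snd = w a.snd := rfl

/-- The inclusion of the multiples of the new variable. -/
noncomputable def incr (ε : A →ₐ[ℂ] A) : A →ₗ[ℂ] OddExt ε where
  toFun a := ⟨0, a⟩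
  map_add' _ _ := by ext <;> simp
  map_smul' _ _ := by ext <;> simp

end OddExt

namespace Stage

variable {T : Stage σ A}

/-- Adjoin an odd variable of degree `k`. -/
noncomputable def evenKill (x : (σ → ℂ) → A) (k : ℤ) (S' : Set σ) (hS : T.S ⊆ S')
    (h : T.KillData x k S') (hk : Odd k) : Stage σ (OddExt T.ε) :=
  have he : ∀ p, T.ε (x p) = x p := fun p => by
    rw [h.parity p, hk.add_one.neg_one_zpow, one_smul]
  have hs : ∀ m : ℤ, (-1 : ℂ) ^ (m - k) = -(-1) ^ m := fun m => by
    rw [zpow_sub₀ (by simp), hk.neg_one_zpow, div_neg, div_one]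
  have hc : ∀ p a, x p * a = a * x p := fun p a => T.even_comm _ _ (he p)
  { ε := AlgHom.ofLinearMap (OddExt.tri T.ε.toLinearMap 0 (-T.ε.toLinearMap))
      (by ext <;> simp) (fun a b => by ext <;> simp; abel)
    pr := fun m => OddExt.tri (T.pr m) 0 (T.pr (m - k))
    D := fun p => OddExt.tri (T.D p) (LinearMap.mulLeft ℂ (x p)) (-T.D p)
    S := S'
    εε := fun a => by ext <;> simp [T.εε]
    even_comm := fun a b ha => by
      have h1 : T.ε a.fst = a.fst := by simpa using congrArg OddExt.fst ha
      have h2 : T.ε a.snd = -a.snd := by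
        rw [← neg_eq_iff_eq_neg]; simpa using congrArg OddExt.snd ha
      ext
      · simpa using T.even_comm _ _ h1
      · simp [h1, T.even_comm _ _ h1, T.odd_comm _ _ h2, add_comm]
    odd_comm := fun a b ha => by
      have h1 : T.ε a.fst = -a.fst := by simpa using congrArg OddExt.fst ha
      have h2 : T.ε a.snd = a.snd := by simpa using congrArg OddExt.snd ha
      ext
      · simpa using T.odd_comm _ _ h1
      · simp [h1, T.odd_comm _ _ h1, T.even_comm _ _ h2, T.εε, add_comm]
    pr_pr := fun i a => by ext <;> simp [T.pr_pr]
    pr_pr_ne := fun i j a hij => by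
      ext
      · simpa using T.pr_pr_ne _ _ _ hij
      · simpa using T.pr_pr_ne _ _ _ (by omega)
    pr_neg := fun i a hi => by
      ext
      · simpa using T.pr_neg _ _ hi
      · simpa using T.pr_neg _ _ (by have := h.hk; omega)
    pr_one := by ext <;> simp [T.pr_one]
    pr_bdd := fun a => by
      obtain ⟨N, hN⟩ := T.pr_bdd a.fst
      obtain ⟨M, hM⟩ := T.pr_bdd a.snd
      refine ⟨max N (M + k), fun m hm => ?_⟩
      have h1 := le_max_left N (M + k)
      have h2 := le_max_right N (M + k)
      ext
      · simpa using hN _ (by omega)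
      · simpa using hM _ (by omega)
    pr_ext := fun a ha => by
      ext
      · exact T.pr_ext _ fun m => by simpa using congrArg OddExt.fst (ha m)
      · exact T.pr_ext _ fun m => by simpa using congrArg OddExt.snd (ha (m + k))
    pr_mul := fun i j a b ha => by
      have h1 : T.pr i a.fst = a.fst := by simpa using congrArg OddExt.fst ha
      have h2 : T.pr (i - k) a.snd = a.snd := by simpa using congrArg OddExt.snd ha
      ext
      · simpa using T.pr_mul _ _ _ _ h1
      · have h3 : T.pr i (T.ε a.fst) = T.ε a.fst := by rw [← h1, T.ε_pr, map_smul, T.pr_pr]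
        simp only [OddExt.tri_snd, OddExt.snd_mul, map_add, T.pr_mul _ _ _ _ h3,
          T.pr_mul _ _ _ _ h2, OddExt.tri_fst, LinearMap.zero_apply, add_zero]
        congr 3
        · ring_nf
        · ring_nf
    ε_pr := fun m a => by ext <;> simp [T.ε_pr, hs]
    pr_ε := fun m a => by ext <;> simp [T.pr_ε, hs]
    D_mul := fun p a b => by
      ext
      · simp [T.D_mul, mul_add, add_mul, ← mul_assoc, hc p (T.ε a.fst)]
        abel
      · simp [T.D_mul, T.D_ε, T.εε, mul_add, add_mul, ← mul_assoc, he, hc p (T.ε a.snd)]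
        abel
    D_ε := fun p a => by ext <;> simp [T.D_ε, he]; abel
    D_poly := fun a => by
      have h1 := polyFam_map (OddExt.incl T.ε).toLinearMap (T.D_poly a.fst)
      have h2 := polyFam_map ((OddExt.incl T.ε).toLinearMap ∘ₗ LinearMap.mulRight ℂ a.snd) h.poly
      have h3 := polyFam_map (-OddExt.incr T.ε) (T.D_poly a.snd)
      convert (polyFam σ _).add_mem ((polyFam σ _).add_mem h1 h2) h3 using 1
      ext p <;> simp [OddExt.incr]
    d_pr := fun m a => by
      ext
      · simp [T.d_pr, T.pr_mul _ _ _ _ h.homog]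
      · simp [T.d_pr]
        congr 2
        ring
    d_d := fun a => by
      ext <;> simp [T.d_d, T.D_mul, h.closed, he]
    D_filt := fun p m a ha j hj => by
      have h1 : ∀ j, m < j → T.pr j a.fst = 0 := fun j hj => by
        simpa using congrArg OddExt.fst (ha j hj)
      have h2 : ∀ j, m - k < j → T.pr j a.snd = 0 := fun j hj => by
        simpa using congrArg OddExt.snd (ha (j + k) (by omega))
      ext
      · simp [T.D_filt p m _ h1 _ hj, pr_mul_diff h p h2 (j := j) (by omega)]
      · simp [T.D_filt p (m - k) _ h2 (j - k) (by omega)]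
    D_S := fun p hp => by
      rw [T.D_S p fun s hs => hp s (hS hs), h.const p hp] }

section

variable {x : (σ → ℂ) → A} {k : ℤ} {S' : Set σ} {hS' : T.S ⊆ S'}

lemma evenKill_D_fst (h : T.KillData x k S') (hk : Odd k) (p) (a : OddExt T.ε) :
    ((T.evenKill x k S' hS' h hk).D p a).fst = T.D p a.fst + x p * a.snd := rfl

lemma evenKill_D_snd (h : T.KillData x k S') (hk : Odd k) (p) (a : OddExt T.ε) :
    ((T.evenKill x k S' hS' h hk).D p a).snd = -T.D p a.snd := rfl

lemma evenKill_pr_fst (h : T.KillData x k S') (hk : Odd k) (m) (a : OddExt T.ε) :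
    ((T.evenKill x k S' hS' h hk).pr m a).fst = T.pr m a.fst := add_zero _

lemma evenKill_pr_snd (h : T.KillData x k S') (hk : Odd k) (m) (a : OddExt T.ε) :
    ((T.evenKill x k S' hS' h hk).pr m a).snd = T.pr (m - k) a.snd := rfl

lemma IsGen.evenKill {h : T.KillData x k S'} {hk : Odd k} {g : Gen A} (hg : T.IsGen g) :
    (T.evenKill x k S' hS' h hk).IsGen (g.map (OddExt.incl T.ε)) := by
  refine ⟨?_, ?_, hg.pos, fun he => ?_, fun he => ?_⟩
  · ext <;> simp [evenKill_D_fst, evenKill_D_snd, Gen.map, hg.closed]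
  · ext <;> simp [evenKill_pr_fst, evenKill_pr_snd, Gen.map, hg.homog]
  · ext <;> simp [evenKill_D_fst, evenKill_D_snd, Gen.map, hg.sq he]
  · ext <;> simp [evenKill_pr_fst, evenKill_pr_snd, Gen.map, hg.homog_e he]

lemma evenKill_sq (h : T.KillData x k S') (hk : Odd k) {p : σ → ℂ}
    (hp : ∀ a, T.D p (T.D p a) = 0) (hx : T.D p (x p) = 0) (a) :
    (T.evenKill x k S' hS' h hk).D p ((T.evenKill x k S' hS' h hk).D p a) = 0 := by
  have he : T.ε (x p) = x p := by rw [h.parity p, hk.add_one.neg_one_zpow, one_smul]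
  ext <;> simp [evenKill_D_fst, evenKill_D_snd, hp, D_mul_even hx he]

lemma Sph.evenKill {g : Gen A} {L : List (Gen A)} (hS : T.Sph (g :: L))
    (h : T.KillData x k S') (hk : Odd k) (hx : x 0 = g.w) (hkd : k = g.deg - 1) :
    (T.evenKill x k S' hS' h hk).Sph
      (⟨⟨-g.e, g.w⟩, 0, 2 * g.deg - 1⟩ :: L.map (Gen.map (OddExt.incl T.ε))) := by
  have hg := hS.gen g (by simp)
  have hd : Even g.deg := by
    rw [show g.deg = k + 1 by omega]
    exact hk.add_one
  have he := hg.ε_even hd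
  have hee : ∀ a, T.D 0 a = 0 → T.D 0 (g.e * a) = g.w * (g.w * a) := fun a ha => by
    rw [T.D_mul, ha, mul_zero, add_zero, hg.sq hd, mul_assoc]
  have hwd : ∀ b, T.D 0 (g.w * b) = g.w * T.D 0 b := fun b => D_mul_even hg.closed he
  have hcl := closed_gen_mul hS
  refine Sph.cons_of_map _ L _ ⟨?_, ?_, ?_, fun h => ?_, fun h => ?_⟩
    (fun g' hg' => (hS.gen g' (by simp [hg'])).evenKill) (fun a ha => ?_) (fun c c' a hca => ?_)
  · ext <;> simp [evenKill_D_fst, evenKill_D_snd, hx, hg.sq hd, hg.closed]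
  · ext
    · simp [evenKill_pr_fst, hg.homog_e hd]
    · simp only [evenKill_pr_snd]
      rw [show 2 * g.deg - 1 - k = g.deg by omega, hg.homog]
  · have := hg.pos
    change 1 ≤ 2 * g.deg - 1
    omega
  · have h : Even (2 * g.deg - 1) := h
    rw [Int.even_iff] at h
    omega
  · have h : Even (2 * g.deg - 1) := h
    rw [Int.even_iff] at h
    omega
  · have h1 := congrArg OddExt.fst ha
    have h2 := congrArg OddExt.snd ha
    rw [evenKill_D_fst, hx, OddExt.fst_zero] at h1
    rw [evenKill_D_snd, OddExt.snd_zero, neg_eq_zero] at h2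
    obtain ⟨c', e, he'⟩ := hS.of_mul_exact (fun a ha => ⟨_, (hee a ha).symm⟩) h2 (b := -a.fst) (by
      rw [map_neg, eq_neg_of_add_eq_zero_right h1])
    obtain ⟨⟨c1, c2⟩, f, hf⟩ := hS.span (a.fst + g.e * evalC L c' + g.w * e) (by
      rw [map_add, map_add, hee _ (hcl _), hwd, add_assoc, ← mul_add, ← he', h1])
    rw [evalC_cons] at hf
    refine ⟨c1, c', ⟨f, evalC L c2 - e⟩, ?_⟩
    ext
    · simp only [OddExt.fst_add, OddExt.fst_mul, OddExt.incl_apply, evenKill_D_fst, hx]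
      have : a.fst = evalC L c1 + g.w * evalC L c2 + T.D 0 f - g.e * evalC L c' - g.w * e := by
        rw [← hf]; abel
      rw [this]
      noncomm_ring
    · simp [evenKill_D_snd, hcl, he']
  · have h1 := congrArg OddExt.fst hca
    have h2 := congrArg OddExt.snd hca
    simp only [OddExt.fst_add, OddExt.fst_mul, OddExt.incl_apply, evenKill_D_fst, hx,
      OddExt.snd_add, OddExt.snd_mul, evenKill_D_snd, mul_zero, zero_add] at h1 h2
    have h3 := hS.ind (0, c') (-a.snd) (by
      rw [evalC_cons, evalC_zero, zero_add, map_neg, h2])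
    obtain rfl : c' = 0 := congrArg Prod.snd h3
    rw [evalC_zero, mul_zero, eq_comm, neg_eq_zero] at h2
    rw [evalC_zero, mul_zero, add_zero] at h1
    obtain ⟨⟨c1, c2⟩, f, hf⟩ := hS.span _ h2
    rw [evalC_cons] at hf
    have h4 := hS.ind (c, -c1) (a.fst + g.e * evalC L c2 + g.w * f) (by
      rw [evalC_cons, h1, hf, evalC_neg, map_add, map_add, hee _ (hcl _), hwd]
      noncomm_ring)
    exact ⟨congrArg Prod.fst h4, rfl⟩

end

end Stage

end FreeToralRank

namespace FreeToralRank

open Polynomial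

namespace Stage

variable {σ : Type}

/-- For a family of differentials on an algebra with the cohomology of a product of spheres, at
most as many equations as there are spheres control exactness of `1`, even spheres contributing
a coordinate each. -/
lemma exists_equations (N : ℕ) : ∀ (A : Type) [Ring A] [Algebra ℂ A] (T : Stage σ A)
    (L : List (Gen A)), T.Sph L → ∀ J : List σ, J.length = L.countP (fun g => Even g.deg) →
    L.length + J.length = N → ∀ Z : Set (σ → ℂ), (∀ p ∈ Z, ∀ a, T.D p (T.D p a) = 0) →
    ∃ G : List (MvPolynomial σ ℂ), G.length ≤ L.length ∧ (∀ f ∈ G, MvPolynomial.eval 0 f = 0) ∧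
      ∀ p ∈ Z, (∀ f ∈ G, MvPolynomial.eval p f = 0) →
        (∀ b, T.D p b ≠ 1) ∧ ((∀ s ∈ T.S, p s = 0) → ∀ s ∈ J, p s = 0) := by
  induction N with
  | zero =>
    intro A _ _ T L hS J hJ hN Z hZ
    obtain rfl : L = [] := List.eq_nil_of_length_eq_zero (by omega)
    obtain rfl : J = [] := List.eq_nil_of_length_eq_zero (by omega)
    exact ⟨[], by simp, by simp, fun p hp _ => ⟨not_exact hS p (hZ p hp), by simp⟩⟩
  | succ N ih =>
    intro A _ _ T L hS J hJ hN Z hZ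
    rcases Nat.eq_zero_or_pos L.length with hL | hL
    · obtain rfl : L = [] := List.eq_nil_of_length_eq_zero hL
      obtain rfl : J = [] := List.eq_nil_of_length_eq_zero (by simpa using hJ)
      exact ⟨[], by simp, by simp, fun p hp _ => ⟨not_exact hS p (hZ p hp), by simp⟩⟩
    obtain ⟨g, L', hperm, hmin⟩ : ∃ g L', L.Perm (g :: L') ∧ ∀ g' ∈ L', g.deg ≤ g'.deg := by
      classical
      obtain ⟨g, hg, hmin⟩ := L.toFinset.exists_min_image (fun g => g.deg)
        (by simpa using List.ne_nil_of_length_pos hL)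
      exact ⟨g, L.erase g, List.perm_cons_erase (by simpa using hg), fun g' hg' =>
        hmin g' (by simpa using List.mem_of_mem_erase hg')⟩
    have hS' := hS.perm hperm
    rw [hperm.countP_eq] at hJ
    rw [hperm.length_eq] at hN ⊢
    clear hS hL
    obtain ⟨γ, hγ, f, h1, h2, h3, h4, h5⟩ := lift hS' hmin Z hZ
    have hg := hS'.gen g (by simp)
    have hpos := hg.pos
    have hγ0 : γ 0 = 0 := (h2 0 (by simp)).1
    rcases Int.even_or_odd g.deg with hpar | hpar
    · rw [List.countP_cons_of_pos (by simpa using hpar)] at hJ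
      obtain ⟨s, J, rfl⟩ := List.exists_cons_of_length_eq_add_one hJ
      simp only [List.length_cons] at hJ hN ⊢
      have hk : Odd (g.deg - 1) := hpar.sub_odd odd_one
      obtain ⟨k, hk1⟩ := id hk
      have hpr1 : ∀ j, g.deg - 1 ≤ j → T.pr j 1 = 0 := fun j hj => by
        rw [← T.pr_one, T.pr_pr_ne _ _ _ (by omega)]
      have hx : T.KillData (fun p => g.w - γ p - p s • (1 : A)) (g.deg - 1) (insert s T.S) :=
        { hk := by omega
          poly := (polyFam σ A).sub_mem ((polyFam σ A).sub_mem (polyFam_const _) hγ)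
            (by simpa using polyFam_smul_const (MvPolynomial.X s) (1 : A))
          closed := by simp [hγ0, hg.closed]
          homog := by simp [hγ0, hg.homog]
          filt := fun p j hj => by simp [hγ0, h1 p j hj, hpr1 j hj]
          parity := fun p => by
            rw [sub_add_cancel, hpar.neg_one_zpow, one_smul, map_sub, map_sub, h4, hg.ε_even hpar,
              hpar.neg_one_zpow, one_smul, map_smul, map_one]
          const := fun p hp => by
            have e1 := (h2 p fun s hs => hp s (by simp [hs])).1
            simp [hγ0, e1, hp s (by simp)] }
      have hDx : ∀ p ∈ Z, T.D p (g.w - γ p - p s • (1 : A)) = 0 := fun p hp => by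
        rw [map_sub, h3 p hp, h5 hpar, map_smul, D_one]
        simp
      obtain ⟨G, hG1, hG2, hG3⟩ := ih _ (T.evenKill _ _ _ (Set.subset_insert _ _) hx hk) _
        (hS'.evenKill hx hk (by simp [hγ0]) rfl) J (by
          rw [List.countP_cons_of_neg (by
            simp only [decide_eq_true_eq, Int.even_iff]
            omega), List.countP_map]
          exact Nat.succ_injective hJ) (by simp; omega) Z
          (fun p hp => evenKill_sq hx hk (hZ p hp) (hDx p hp))
      refine ⟨G, by simpa using hG1, hG2, fun p hp hf => ?_⟩
      obtain ⟨a1, a2⟩ := hG3 p hp hf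
      refine ⟨fun b hb => a1 ⟨b, 0⟩ ?_, fun hp0 => ?_⟩
      · ext <;> simp [evenKill_D_fst, evenKill_D_snd, hb]
      have e1 := (h2 p hp0).1
      have e2 := T.D_S p hp0
      have hps : p s = 0 := by
        by_contra hps
        refine a1 ((p s * p s)⁻¹ • ⟨g.e, -(g.w + p s • 1)⟩) ?_
        have hne : p s * p s ≠ 0 := mul_ne_zero hps hps
        have e3 : (g.w - p s • (1 : A)) * (g.w + p s • 1) = g.w * g.w - (p s * p s) • 1 := by
          simp only [sub_mul, mul_add, smul_mul_assoc, mul_smul_comm, one_mul, mul_one, smul_sub,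
            mul_smul]
          abel
        rw [map_smul]
        ext
        · rw [OddExt.fst_smul, evenKill_D_fst, e2, e1]
          dsimp only
          rw [hg.sq hpar, sub_zero, mul_neg, e3]
          rw [← sub_eq_add_neg, sub_sub_cancel, smul_smul, inv_mul_cancel₀ hne, one_smul]
          rfl
        · rw [OddExt.snd_smul, evenKill_D_snd, e2, map_neg, map_add, hg.closed, map_smul, D_one]
          simp
      intro t ht
      rcases List.mem_cons.1 ht with rfl | ht
      · exact hps
      · refine a2 (fun u hu => ?_) t ht
        rcases Set.mem_insert_iff.1 hu with rfl | hu
        · exact hps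
        · exact hp0 u hu
    · rw [List.countP_cons_of_neg (by simpa using hpar)] at hJ
      simp only [List.length_cons] at hJ hN ⊢
      have hk : Even (g.deg - 1) := hpar.sub_odd odd_one
      have hx : T.KillData (fun p => g.w - γ p) (g.deg - 1) T.S :=
        { hk := by omega
          poly := (polyFam σ A).sub_mem (polyFam_const _) hγ
          closed := by simp [hγ0, hg.closed]
          homog := by simp [hγ0, hg.homog]
          filt := fun p j hj => by simp [hγ0, h1 p j hj]
          parity := fun p => by
            rw [sub_add_cancel, map_sub, h4, hg.ε_w, smul_sub]
          const := fun p hp => by simp [hγ0, (h2 p hp).1] }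
      obtain ⟨G, hG1, hG2, hG3⟩ := ih _ (T.oddKill _ _ hx hk) _
        (hS'.oddKill hx hk (by simp [hγ0]) hpar) J (by
          rw [List.countP_map]
          exact hJ) (by simp; omega) {p ∈ Z | MvPolynomial.eval p f = 0} (fun p hp q => by
            have ho : T.ε (g.w - γ p) = -(g.w - γ p) := by
              rw [hx.parity p, sub_add_cancel, hpar.neg_one_zpow, neg_one_smul]
            exact polyD_sq (hZ p hp.1) (by rw [h3 p hp.1, hp.2, zero_smul]) ho q)
      refine ⟨f :: G, by simpa using hG1, fun f' hf' => ?_, fun p hp hf => ?_⟩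
      · rcases List.mem_cons.1 hf' with rfl | hf'
        · exact (h2 0 (by simp)).2
        · exact hG2 f' hf'
      · obtain ⟨a1, a2⟩ := hG3 p ⟨hp, hf f (by simp)⟩ fun f' hf' => hf f' (by simp [hf'])
        refine ⟨fun b hb => a1 (C b) ?_, a2⟩
        exact (polyD_C _ _ _).trans (by rw [hb, C_1])

/-- The algebraic core: if `1` becomes exact for all nonzero parameters supported on `S`, there are
at most as many parameters as generators of odd degree. -/
theorem card_le_of_exact {ι κ A : Type} [Finite ι] [Finite κ] [Ring A] [Algebra ℂ A]
    (T : Stage (ι ⊕ κ) A) (hTS : T.S = Set.range Sum.inl) (L : List (Gen A)) (hS : T.Sph L)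
    (hκ : Nat.card κ = L.countP (fun g => Even g.deg)) (hsq : ∀ p a, T.D p (T.D p a) = 0)
    (hex : ∀ p : ι ⊕ κ → ℂ, (∃ i, p (Sum.inl i) ≠ 0) → ∃ b, T.D p b = 1) :
    Nat.card ι ≤ L.countP (fun g => Odd g.deg) := by
  classical
  have := Fintype.ofFinite κ
  obtain ⟨G, h1, h2, h3⟩ := exists_equations _ A T L hS
    ((Finset.univ : Finset κ).toList.map Sum.inr) (by
      rw [List.length_map, Finset.length_toList, ← hκ, Nat.card_eq_fintype_card, Finset.card_univ])
    rfl Set.univ (fun p _ => hsq p)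
  have hlen : L.length = Nat.card κ + L.countP (fun g => Odd g.deg) := by
    rw [hκ, List.length_eq_countP_add_countP (fun g : Gen A => decide (Even g.deg)) (l := L)]
    congr 2
    ext g
    simp
  by_contra! hlt
  obtain ⟨p, hp0, hp⟩ := exists_common_zero G h2 (by
    rw [Nat.card_sum]
    omega)
  obtain ⟨a1, a2⟩ := h3 p trivial hp
  by_cases h : ∃ i, p (Sum.inl i) ≠ 0
  · obtain ⟨b, hb⟩ := hex p h
    exact a1 b hb
  · push Not at h
    refine hp0 (funext fun s => ?_)
    rcases s with i | j
    · exact h i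
    · exact a2 (fun s hs => by
        rw [hTS] at hs
        obtain ⟨i, rfl⟩ := hs
        exact h i) _ (by simp)

end Stage

end FreeToralRank

namespace FreeToralRank

open Polynomial

section Exterior

variable {M : Type} [AddCommGroup M] [Module ℂ M]

/-- The integer-indexed grading projections of an exterior algebra. -/
noncomputable def lpr (m : ℤ) : ExteriorAlgebra ℂ M →ₗ[ℂ] ExteriorAlgebra ℂ M :=
  if 0 ≤ m then GradedAlgebra.proj (fun i : ℕ => ⋀[ℂ]^i M) m.toNat else 0

lemma lpr_natCast (n : ℕ) (x : ExteriorAlgebra ℂ M) :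
    lpr n x = GradedAlgebra.proj (fun i : ℕ => ⋀[ℂ]^i M) n x := by
  simp [lpr]

lemma lpr_neg {m : ℤ} (hm : m < 0) : lpr (M := M) m = 0 := by
  simp [lpr, not_le.mpr hm]

lemma lpr_mem (n : ℕ) (x : ExteriorAlgebra ℂ M) : lpr n x ∈ ⋀[ℂ]^n M := by
  rw [lpr_natCast]
  exact SetLike.coe_mem _

lemma lpr_of_mem {n : ℕ} {x : ExteriorAlgebra ℂ M} (hx : x ∈ ⋀[ℂ]^n M) (m : ℤ) :
    lpr m x = if m = n then x else 0 := by
  rcases lt_or_ge m 0 with hm | hm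
  · rw [lpr_neg hm, if_neg (by omega)]
    rfl
  · obtain ⟨k, rfl⟩ := Int.eq_ofNat_of_zero_le hm
    rw [lpr_natCast, GradedAlgebra.proj_apply]
    split_ifs with h
    · rw [Nat.cast_inj] at h
      subst h
      exact DirectSum.decompose_of_mem_same _ hx
    · exact DirectSum.decompose_of_mem_ne _ hx (fun e => h (by simp [e]))

/-- Induction over homogeneous elements. -/
lemma ext_induction {P : ExteriorAlgebra ℂ M → Prop} (h0 : P 0)
    (hadd : ∀ x y, P x → P y → P (x + y)) (hh : ∀ n : ℕ, ∀ x ∈ ⋀[ℂ]^n M, P x) (x) : P x := by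
  refine DirectSum.Decomposition.inductionOn (fun i : ℕ => ⋀[ℂ]^i M) h0 ?_ hadd x
  intro n m
  exact hh n m m.2

lemma ext_linear_ext {N : Type} [AddCommGroup N] [Module ℂ N]
    {f g : ExteriorAlgebra ℂ M →ₗ[ℂ] N}
    (h : ∀ n : ℕ, ∀ x ∈ ⋀[ℂ]^n M, f x = g x) : f = g := by
  refine LinearMap.ext (ext_induction (by simp) ?_ h)
  intro x y hx hy
  rw [map_add, map_add, hx, hy]

lemma sum_lpr (x : ExteriorAlgebra ℂ M) :
    ∃ N : ℕ, ∀ n ≥ N, ∑ m ∈ Finset.range n, lpr (m : ℤ) x = x := by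
  refine ext_induction (P := fun x => ∃ N : ℕ, ∀ n ≥ N,
    ∑ m ∈ Finset.range n, lpr (m : ℤ) x = x) ⟨0, by simp⟩ ?_ ?_ x
  · rintro x y ⟨N, hN⟩ ⟨N', hN'⟩
    refine ⟨max N N', fun n hn => ?_⟩
    simp only [map_add, Finset.sum_add_distrib]
    rw [hN n (by omega), hN' n (by omega)]
  · intro k x hx
    refine ⟨k + 1, fun n hn => ?_⟩
    simp only [lpr_of_mem hx, Nat.cast_inj]
    rw [Finset.sum_ite_eq' (Finset.range n) k, if_pos (Finset.mem_range.mpr (by omega))]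

/-- A linear map shifting degrees commutes with the projections. -/
lemma lpr_shift {M' : Type} [AddCommGroup M'] [Module ℂ M']
    {T : ExteriorAlgebra ℂ M →ₗ[ℂ] ExteriorAlgebra ℂ M'} {k : ℤ}
    (h : ∀ n : ℕ, ∀ x ∈ ⋀[ℂ]^n M, (∃ m : ℕ, (m : ℤ) = n + k ∧ T x ∈ ⋀[ℂ]^m M') ∨ T x = 0)
    (m : ℤ) (x) : lpr (m + k) (T x) = T (lpr m x) := by
  refine LinearMap.congr_fun (f := lpr (m + k) ∘ₗ T) (g := T ∘ₗ lpr m) (ext_linear_ext ?_) x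
  intro n x hx
  simp only [LinearMap.comp_apply]
  rw [lpr_of_mem hx]
  rcases h n x hx with ⟨l, hl, hT⟩ | hT
  · rw [lpr_of_mem hT]
    by_cases hm : m = n
    · rw [if_pos hm, if_pos (by omega)]
    · rw [if_neg hm, if_neg (by omega), map_zero]
  · rw [hT, map_zero]
    split_ifs
    · exact hT.symm
    · simp

/-- The parity automorphism of an exterior algebra. -/
noncomputable def linv : ExteriorAlgebra ℂ M →ₐ[ℂ] ExteriorAlgebra ℂ M :=
  ExteriorAlgebra.map (-LinearMap.id)

@[simp] lemma linv_ι (m : M) : linv (ExteriorAlgebra.ι ℂ m) = -ExteriorAlgebra.ι ℂ m := by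
  simp [linv]

lemma linv_linv (x : ExteriorAlgebra ℂ M) : linv (linv x) = x := by
  refine AlgHom.congr_fun (φ₁ := linv.comp linv) (φ₂ := AlgHom.id ℂ _) ?_ x
  ext m
  simp

lemma linv_of_mem {n : ℕ} {x : ExteriorAlgebra ℂ M} (hx : x ∈ ⋀[ℂ]^n M) :
    linv x = ((-1 : ℂ) ^ (n : ℤ)) • x := by
  induction hx using Submodule.pow_induction_on_left' with
  | algebraMap r => simp
  | add x y i hx hy h1 h2 => rw [map_add, h1, h2, smul_add]
  | mem_mul m hm i x hx ih =>
    obtain ⟨v, rfl⟩ := hm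
    rw [map_mul, ih, linv_ι]
    push_cast
    rw [zpow_add₀ (by norm_num), zpow_one, mul_neg_one, neg_smul, mul_smul_comm, neg_mul, smul_neg]

lemma ι_mul_comm (v : M) (x : ExteriorAlgebra ℂ M) :
    ExteriorAlgebra.ι ℂ v * x = linv x * ExteriorAlgebra.ι ℂ v := by
  induction x using ExteriorAlgebra.induction with
  | algebraMap r => simp [Algebra.commutes]
  | ι m =>
    rw [linv_ι, neg_mul, eq_neg_iff_add_eq_zero]
    exact ExteriorAlgebra.ι_add_mul_swap v m
  | mul a b ha hb => rw [← mul_assoc, ha, mul_assoc, hb, map_mul, mul_assoc]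
  | add a b ha hb => rw [mul_add, ha, hb, map_add, add_mul]

lemma supercomm (x : ExteriorAlgebra ℂ M) :
    ∀ a, (x + linv x) * a = a * (x + linv x) ∧ (x - linv x) * a = linv a * (x - linv x) := by
  induction x using ExteriorAlgebra.induction with
  | algebraMap r =>
    intro a
    simp only [AlgHom.commutes, sub_self, zero_mul, mul_zero, and_true]
    rw [← map_add]
    exact Algebra.commutes _ _
  | ι m =>
    intro a
    rw [linv_ι, add_neg_cancel, sub_neg_eq_add, add_mul, mul_add, ι_mul_comm]
    simp
  | add x y hx hy =>
    intro a
    constructor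
    · have := (hx a).1
      have := (hy a).1
      rw [map_add, add_add_add_comm, add_mul, mul_add, (hx a).1, (hy a).1]
    · rw [map_add, add_sub_add_comm, add_mul, mul_add, (hx a).2, (hy a).2]
  | mul x y hx hy =>
    intro a
    have e1 : x * y + linv (x * y) = (2⁻¹ : ℂ) • ((x + linv x) * (y + linv y) +
        (x - linv x) * (y - linv y)) := by
      rw [map_mul, eq_inv_smul_iff₀ two_ne_zero, two_smul]
      noncomm_ring
    have e2 : x * y - linv (x * y) = (2⁻¹ : ℂ) • ((x + linv x) * (y - linv y) +
        (x - linv x) * (y + linv y)) := by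
      rw [map_mul, eq_inv_smul_iff₀ two_ne_zero, two_smul]
      noncomm_ring
    have c1 : ∀ b, (x + linv x) * b = b * (x + linv x) := fun b => (hx b).1
    have c2 : ∀ b, (x - linv x) * b = linv b * (x - linv x) := fun b => (hx b).2
    have c3 : ∀ b, (y + linv y) * b = b * (y + linv y) := fun b => (hy b).1
    have c4 : ∀ b, (y - linv y) * b = linv b * (y - linv y) := fun b => (hy b).2
    generalize x + linv x = X at *
    generalize x - linv x = X' at *
    generalize y + linv y = Y at *
    generalize y - linv y = Y' at *
    rw [e1, e2]
    simp only [smul_mul_assoc, mul_smul_comm, add_mul, mul_add]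
    constructor
    · congr 2
      · rw [mul_assoc, c3, ← mul_assoc, c1, mul_assoc]
      · rw [mul_assoc, c4, ← mul_assoc, c2, linv_linv, mul_assoc]
    · congr 2
      · rw [mul_assoc, c4, ← mul_assoc, c1, mul_assoc]
      · rw [mul_assoc, c3, ← mul_assoc, c2, mul_assoc]

lemma lpr_ι_mul (v : M) (m : ℤ) (x : ExteriorAlgebra ℂ M) :
    lpr (m + 1) (ExteriorAlgebra.ι ℂ v * x) = ExteriorAlgebra.ι ℂ v * lpr m x := by
  refine lpr_shift (T := LinearMap.mulLeft ℂ (ExteriorAlgebra.ι ℂ v)) ?_ m x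
  intro n x hx
  refine Or.inl ⟨n + 1, by simp, ?_⟩
  change _ ∈ LinearMap.range (ExteriorAlgebra.ι ℂ) ^ (n + 1)
  rw [pow_succ']
  exact Submodule.mul_mem_mul ⟨v, rfl⟩ hx

lemma linv_lpr (m : ℤ) (x : ExteriorAlgebra ℂ M) : linv (lpr m x) = ((-1 : ℂ) ^ m) • lpr m x := by
  rcases lt_or_ge m 0 with hm | hm
  · simp [lpr_neg hm]
  · obtain ⟨k, rfl⟩ := Int.eq_ofNat_of_zero_le hm
    exact linv_of_mem (lpr_mem k x)

lemma lpr_linv (m : ℤ) (x : ExteriorAlgebra ℂ M) : lpr m (linv x) = ((-1 : ℂ) ^ m) • lpr m x := by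
  refine LinearMap.congr_fun (f := lpr (M := M) m ∘ₗ linv.toLinearMap) (g := ((-1 : ℂ) ^ m) • lpr (M := M) m)
    (ext_linear_ext ?_) x
  intro n x hx
  simp only [LinearMap.comp_apply, AlgHom.toLinearMap_apply, LinearMap.smul_apply]
  rw [linv_of_mem hx, map_smul, lpr_of_mem hx]
  split_ifs with h
  · rw [h]
  · simp

lemma lpr_mul (i j : ℤ) (x y : ExteriorAlgebra ℂ M) :
    lpr j (lpr i x * y) = lpr i x * lpr (j - i) y := by
  rcases lt_or_ge i 0 with hm | hm
  · simp [lpr_neg hm]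
  · obtain ⟨k, rfl⟩ := Int.eq_ofNat_of_zero_le hm
    have := lpr_shift (T := LinearMap.mulLeft ℂ (lpr k x)) (k := k) (fun n z hz =>
      Or.inl ⟨k + n, by push_cast; ring, by
        change lpr k x * z ∈ _
        exact SetLike.mul_mem_graded (A := fun i : ℕ => ⋀[ℂ]^i M) (lpr_mem k x) hz⟩) (j - k) y
    rw [sub_add_cancel] at this
    exact this

/-- Contraction with a linear form. -/
noncomputable def lctr (l : M →ₗ[ℂ] ℂ) : ExteriorAlgebra ℂ M →ₗ[ℂ] ExteriorAlgebra ℂ M :=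
  CliffordAlgebra.contractLeft (Q := (0 : QuadraticForm ℂ M)) l

lemma lctr_ι_mul (l : M →ₗ[ℂ] ℂ) (v : M) (x : ExteriorAlgebra ℂ M) :
    lctr l (ExteriorAlgebra.ι ℂ v * x) = l v • x - ExteriorAlgebra.ι ℂ v * lctr l x :=
  CliffordAlgebra.contractLeft_ι_mul (Q := (0 : QuadraticForm ℂ M)) (d := l) v x

lemma lctr_algebraMap (l : M →ₗ[ℂ] ℂ) (c : ℂ) : lctr l (algebraMap ℂ _ c) = 0 :=
  CliffordAlgebra.contractLeft_algebraMap (Q := (0 : QuadraticForm ℂ M)) (d := l) c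

lemma lctr_one (l : M →ₗ[ℂ] ℂ) : lctr l 1 = 0 :=
  CliffordAlgebra.contractLeft_one (Q := (0 : QuadraticForm ℂ M)) (d := l)

lemma lctr_ι (l : M →ₗ[ℂ] ℂ) (v : M) :
    lctr l (ExteriorAlgebra.ι ℂ v) = algebraMap ℂ _ (l v) :=
  CliffordAlgebra.contractLeft_ι (Q := (0 : QuadraticForm ℂ M)) (d := l) v

lemma lctr_comm (l l' : M →ₗ[ℂ] ℂ) (x : ExteriorAlgebra ℂ M) :
    lctr l (lctr l' x) = -lctr l' (lctr l x) :=
  CliffordAlgebra.contractLeft_comm (Q := (0 : QuadraticForm ℂ M)) (d := l) (d' := l') x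

lemma lctr_mul (l : M →ₗ[ℂ] ℂ) (x y : ExteriorAlgebra ℂ M) :
    lctr l (x * y) = lctr l x * y + linv x * lctr l y := by
  induction x using CliffordAlgebra.left_induction generalizing y with
  | algebraMap r =>
    change lctr l (algebraMap ℂ (ExteriorAlgebra ℂ M) r * y) =
      lctr l (algebraMap ℂ (ExteriorAlgebra ℂ M) r) * y +
        linv (algebraMap ℂ (ExteriorAlgebra ℂ M) r) * lctr l y
    rw [lctr_algebraMap, AlgHom.commutes, ← Algebra.smul_def, ← Algebra.smul_def]
    simp
  | add x x' hx hx' =>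
    change lctr l (((x : ExteriorAlgebra ℂ M) + (x' : ExteriorAlgebra ℂ M)) * y) =
      lctr l ((x : ExteriorAlgebra ℂ M) + (x' : ExteriorAlgebra ℂ M)) * y +
        linv ((x : ExteriorAlgebra ℂ M) + (x' : ExteriorAlgebra ℂ M)) * lctr l y
    rw [add_mul, map_add, hx, hx', map_add, map_add]
    noncomm_ring
  | ι_mul x v hx =>
    change lctr l ((ExteriorAlgebra.ι ℂ v * x) * y) = lctr l (ExteriorAlgebra.ι ℂ v * x) * y +
      linv (ExteriorAlgebra.ι ℂ v * x) * lctr l y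
    rw [mul_assoc, lctr_ι_mul, hx, lctr_ι_mul, map_mul, linv_ι, sub_mul, smul_mul_assoc]
    noncomm_ring

lemma linv_lctr (l : M →ₗ[ℂ] ℂ) (x : ExteriorAlgebra ℂ M) :
    lctr l (linv x) = -linv (lctr l x) := by
  induction x using ExteriorAlgebra.induction with
  | algebraMap r => simp [lctr_algebraMap]
  | ι m => simp [lctr_ι]
  | add x y hx hy => rw [map_add, map_add, hx, hy, map_add, map_add, neg_add]
  | mul x y hx hy =>
    rw [map_mul, lctr_mul, lctr_mul, hx, hy, map_add, map_mul, map_mul]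
    noncomm_ring

lemma lctr_mem (l : M →ₗ[ℂ] ℂ) {n : ℕ} {x : ExteriorAlgebra ℂ M} (hx : x ∈ ⋀[ℂ]^n M) :
    (∃ m : ℕ, (m : ℤ) = n + (-1) ∧ lctr l x ∈ ⋀[ℂ]^m M) ∨ lctr l x = 0 := by
  suffices h : (n = 0 → lctr l x = 0) ∧ (∀ m, n = m + 1 → lctr l x ∈ ⋀[ℂ]^m M) by
    rcases n with _ | m
    · exact Or.inr (h.1 rfl)
    · exact Or.inl ⟨m, by simp, h.2 m rfl⟩
  induction hx using Submodule.pow_induction_on_left' with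
  | algebraMap r => exact ⟨fun _ => lctr_algebraMap l r, fun m h => by omega⟩
  | add x y i hx hy h1 h2 =>
    refine ⟨fun h => by rw [map_add, h1.1 h, h2.1 h, add_zero], fun m h => ?_⟩
    rw [map_add]
    exact add_mem (h1.2 m h) (h2.2 m h)
  | mem_mul v hv i x hx ih =>
    obtain ⟨v, rfl⟩ := hv
    refine ⟨fun h => by omega, fun m h => ?_⟩
    obtain rfl : m = i := by omega
    rw [lctr_ι_mul]
    refine sub_mem (Submodule.smul_mem _ _ hx) ?_
    rcases m with _ | k
    · rw [ih.1 rfl, mul_zero]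
      exact zero_mem _
    · change _ ∈ LinearMap.range (ExteriorAlgebra.ι ℂ) ^ (k + 1)
      rw [pow_succ']
      exact Submodule.mul_mem_mul ⟨v, rfl⟩ (ih.2 k rfl)

lemma lpr_lctr (l : M →ₗ[ℂ] ℂ) (m : ℤ) (x : ExteriorAlgebra ℂ M) :
    lpr m (lctr l x) = lctr l (lpr (m + 1) x) := by
  have := lpr_shift (T := lctr l) (k := -1) (fun n x hx => lctr_mem l hx) (m + 1) x
  rwa [add_neg_cancel_right] at this

end Exterior

end FreeToralRank

namespace FreeToralRank

open Polynomial

open scoped TensorProduct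

set_option linter.unusedSectionVars false

/-- A commutative algebra with commuting partial derivatives indexed by `ι`. -/
class DiffRing (ι : outParam Type) (F : Type) [CommRing F] [Algebra ℂ F] where
  pd : ι → Derivation ℂ F F
  pd_comm : ∀ i j f, pd i (pd j f) = pd j (pd i f)

/-- Differential forms with coefficients in `F`. -/
abbrev Om (ι F : Type) [CommRing F] [Algebra ℂ F] : Type :=
  F ⊗[ℂ] ExteriorAlgebra ℂ (ι → ℂ)

section

variable {ι F : Type} [Fintype ι] [DecidableEq ι] [CommRing F] [Algebra ℂ F]

/-- The constant coordinate form. -/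
noncomputable def ed (i : ι) : ExteriorAlgebra ℂ (ι → ℂ) := ExteriorAlgebra.ι ℂ (Pi.single i 1)

/-- A function as a form. -/
noncomputable def fn (f : F) : Om ι F := f ⊗ₜ 1

/-- A coordinate one-form. -/
noncomputable def dx (i : ι) : Om ι F := 1 ⊗ₜ ed i

lemma ι_eq_sum (m : ι → ℂ) : ExteriorAlgebra.ι ℂ m = ∑ i, m i • ed i := by
  conv_lhs => rw [pi_eq_sum_univ' m]
  simp only [map_sum, map_smul, ed]

/-- Linear maps of forms are determined on products `f ⊗ w`. -/
lemma om_ext {N : Type} [AddCommGroup N] [Module ℂ N] {S T : Om ι F →ₗ[ℂ] N}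
    (h : ∀ (f : F) w, S (f ⊗ₜ w) = T (f ⊗ₜ w)) : S = T :=
  TensorProduct.ext' h

/-- Bilinear maps of forms are determined on products `f ⊗ w`. -/
lemma om_ext₂ {N : Type} [AddCommGroup N] [Module ℂ N] {S T : Om ι F →ₗ[ℂ] Om ι F →ₗ[ℂ] N}
    (h : ∀ (f : F) w (g : F) w', S (f ⊗ₜ w) (g ⊗ₜ w') = T (f ⊗ₜ w) (g ⊗ₜ w')) (a b) :
    S a b = T a b := by
  have : S = T := om_ext fun f w => om_ext fun g w' => h f w g w'
  rw [this]

/-- The parity automorphism of forms. -/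
noncomputable def oinv : Om ι F →ₐ[ℂ] Om ι F :=
  Algebra.TensorProduct.map (AlgHom.id ℂ F) linv

@[simp] lemma oinv_tmul (f : F) (w : ExteriorAlgebra ℂ (ι → ℂ)) :
    oinv (f ⊗ₜ[ℂ] w) = f ⊗ₜ linv w := rfl

lemma oinv_oinv (a : Om ι F) : oinv (oinv a) = a := by
  refine LinearMap.congr_fun (f := oinv.toLinearMap ∘ₗ oinv.toLinearMap) (g := LinearMap.id)
    (om_ext fun f w => ?_) a
  simp [linv_linv]

/-- The degree projections of forms. -/
noncomputable def opr (m : ℤ) : Om ι F →ₗ[ℂ] Om ι F := TensorProduct.map LinearMap.id (lpr m)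

@[simp] lemma opr_tmul (m : ℤ) (f : F) (w : ExteriorAlgebra ℂ (ι → ℂ)) :
    opr m (f ⊗ₜ[ℂ] w) = f ⊗ₜ lpr m w := rfl

/-- Contraction with a vector field. -/
noncomputable def octr (v : ι → F) : Om ι F →ₗ[ℂ] Om ι F :=
  ∑ l, TensorProduct.map (LinearMap.mulLeft ℂ (v l)) (lctr (LinearMap.proj l))

lemma octr_tmul (v : ι → F) (f : F) (w : ExteriorAlgebra ℂ (ι → ℂ)) :
    octr v (f ⊗ₜ[ℂ] w) = ∑ l, (v l * f) ⊗ₜ lctr (LinearMap.proj l) w := by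
  simp [octr, LinearMap.sum_apply]

lemma supercomm_om (x a : Om ι F) :
    (x + oinv x) * a = a * (x + oinv x) ∧ (x - oinv x) * a = oinv a * (x - oinv x) := by
  induction x using TensorProduct.induction_on with
  | zero => simp
  | add x y hx hy =>
    constructor
    · rw [map_add, add_add_add_comm, add_mul, mul_add, hx.1, hy.1]
    · rw [map_add, add_sub_add_comm, add_mul, mul_add, hx.2, hy.2]
  | tmul f w =>
    induction a using TensorProduct.induction_on with
    | zero => simp
    | add x y hx hy =>
      constructor
      · rw [mul_add _ x, add_mul x, hx.1, hy.1]
      · rw [mul_add _ x, map_add _ x, add_mul (oinv x), hx.2, hy.2]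
    | tmul g w' =>
      rw [oinv_tmul, oinv_tmul, ← TensorProduct.tmul_add, ← TensorProduct.tmul_sub,
        Algebra.TensorProduct.tmul_mul_tmul, Algebra.TensorProduct.tmul_mul_tmul,
        Algebra.TensorProduct.tmul_mul_tmul, Algebra.TensorProduct.tmul_mul_tmul,
        (supercomm w w').1, (supercomm w w').2, mul_comm f g]
      exact ⟨rfl, rfl⟩

lemma oinv_opr (m : ℤ) (a : Om ι F) : oinv (opr m a) = ((-1 : ℂ) ^ m) • opr m a := by
  refine LinearMap.congr_fun (f := oinv.toLinearMap ∘ₗ opr m) (g := ((-1 : ℂ) ^ m) • opr m)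
    (om_ext fun f w => ?_) a
  simp [linv_lpr]

lemma opr_oinv (m : ℤ) (a : Om ι F) : opr m (oinv a) = ((-1 : ℂ) ^ m) • opr m a := by
  refine LinearMap.congr_fun (f := opr m ∘ₗ oinv.toLinearMap) (g := ((-1 : ℂ) ^ m) • opr m)
    (om_ext fun f w => ?_) a
  simp [lpr_linv]

lemma lpr_lpr {M : Type} [AddCommGroup M] [Module ℂ M] (i j : ℤ) (x : ExteriorAlgebra ℂ M) :
    lpr i (lpr j x) = if i = j then lpr j x else 0 := by
  rcases lt_or_ge j 0 with hm | hm
  · simp [lpr_neg hm]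
  · obtain ⟨k, rfl⟩ := Int.eq_ofNat_of_zero_le hm
    exact lpr_of_mem (lpr_mem k x) i

lemma opr_opr (i j : ℤ) (a : Om ι F) : opr i (opr j a) = if i = j then opr j a else 0 := by
  have : opr i ∘ₗ opr j = if i = j then opr (ι := ι) (F := F) j else 0 := by
    refine om_ext fun f w => ?_
    simp only [LinearMap.comp_apply, opr_tmul, lpr_lpr]
    split_ifs <;> simp
  have h2 := LinearMap.congr_fun this a
  simp only [LinearMap.comp_apply] at h2
  rw [h2]
  split_ifs <;> rfl

lemma opr_neg {m : ℤ} (hm : m < 0) (a : Om ι F) : opr m a = 0 := by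
  refine LinearMap.congr_fun (f := opr m) (g := 0) (om_ext fun f w => ?_) a
  simp [lpr_neg hm]

lemma lpr_zero_one {M : Type} [AddCommGroup M] [Module ℂ M] :
    lpr 0 (1 : ExteriorAlgebra ℂ M) = 1 := by
  have h : (1 : ExteriorAlgebra ℂ M) ∈ ⋀[ℂ]^0 M :=
    SetLike.one_mem_graded (A := fun i : ℕ => ⋀[ℂ]^i M)
  have := lpr_of_mem h 0
  simpa using this

lemma opr_one : opr 0 (1 : Om ι F) = 1 := by
  rw [Algebra.TensorProduct.one_def, opr_tmul, lpr_zero_one]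

lemma sum_opr (a : Om ι F) : ∃ N : ℕ, ∀ n ≥ N, ∑ m ∈ Finset.range n, opr (m : ℤ) a = a := by
  induction a using TensorProduct.induction_on with
  | zero => exact ⟨0, by simp⟩
  | add x y hx hy =>
    obtain ⟨N, hN⟩ := hx
    obtain ⟨N', hN'⟩ := hy
    refine ⟨max N N', fun n hn => ?_⟩
    simp only [map_add, Finset.sum_add_distrib]
    rw [hN n (by omega), hN' n (by omega)]
  | tmul f w =>
    obtain ⟨N, hN⟩ := sum_lpr w
    refine ⟨N, fun n hn => ?_⟩
    simp only [opr_tmul]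
    rw [← TensorProduct.tmul_sum, hN n hn]

lemma opr_bdd (a : Om ι F) : ∃ N : ℤ, ∀ m, N < m → opr m a = 0 := by
  obtain ⟨N, hN⟩ := sum_opr a
  refine ⟨N, fun m hm => ?_⟩
  obtain ⟨k, rfl⟩ := Int.eq_ofNat_of_zero_le (show 0 ≤ m by omega)
  have h1 := hN k (by omega)
  have h2 := hN (k + 1) (by omega)
  rw [Finset.sum_range_succ, h1] at h2
  simpa using h2

lemma opr_ext (a : Om ι F) (h : ∀ m, opr m a = 0) : a = 0 := by
  obtain ⟨N, hN⟩ := sum_opr a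
  rw [← hN N le_rfl]
  exact Finset.sum_eq_zero fun m _ => h m

lemma opr_mul (i j : ℤ) (a b : Om ι F) : opr j (opr i a * b) = opr i a * opr (j - i) b := by
  refine om_ext₂ (S := ((LinearMap.mul ℂ (Om ι F)).compr₂ (opr j)) ∘ₗ opr i)
    (T := (LinearMap.mul ℂ (Om ι F)).compl₁₂ (opr i) (opr (j - i))) ?_ a b
  intro f w g w'
  simp [lpr_mul]

lemma octr_mul (v : ι → F) (a b : Om ι F) :
    octr v (a * b) = octr v a * b + oinv a * octr v b := by
  refine om_ext₂ (S := (LinearMap.mul ℂ (Om ι F)).compr₂ (octr v))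
    (T := (LinearMap.mul ℂ (Om ι F)) ∘ₗ octr v +
      (LinearMap.mul ℂ (Om ι F)).compl₁₂ oinv.toLinearMap (octr v)) ?_ a b
  intro f w g w'
  simp only [LinearMap.compr₂_apply, LinearMap.mul_apply', Algebra.TensorProduct.tmul_mul_tmul,
    octr_tmul, LinearMap.add_apply, LinearMap.comp_apply, LinearMap.compl₁₂_apply,
    AlgHom.toLinearMap_apply, oinv_tmul, Finset.sum_mul, Finset.mul_sum]
  rw [← Finset.sum_add_distrib]
  refine Finset.sum_congr rfl fun l _ => ?_
  rw [lctr_mul, TensorProduct.tmul_add]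
  congr 2 <;> ring

lemma octr_oinv (v : ι → F) (a : Om ι F) : octr v (oinv a) = -oinv (octr v a) := by
  refine LinearMap.congr_fun (f := octr v ∘ₗ oinv.toLinearMap)
    (g := -(oinv.toLinearMap ∘ₗ octr v)) (om_ext fun f w => ?_) a
  simp only [LinearMap.comp_apply, AlgHom.toLinearMap_apply, oinv_tmul, LinearMap.neg_apply,
    octr_tmul, map_sum]
  rw [← Finset.sum_neg_distrib]
  refine Finset.sum_congr rfl fun l _ => ?_
  rw [linv_lctr, TensorProduct.tmul_neg]

lemma opr_octr (v : ι → F) (m : ℤ) (a : Om ι F) :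
    opr m (octr v a) = octr v (opr (m + 1) a) := by
  refine LinearMap.congr_fun (f := opr m ∘ₗ octr v)
    (g := octr v ∘ₗ opr (m + 1)) (om_ext fun f w => ?_) a
  simp only [LinearMap.comp_apply, opr_tmul, octr_tmul, map_sum, lpr_lctr]

lemma octr_octr (v v' : ι → F) (a : Om ι F) : octr v (octr v' a) = -octr v' (octr v a) := by
  refine LinearMap.congr_fun (f := octr v ∘ₗ octr v')
    (g := -(octr v' ∘ₗ octr v)) (om_ext fun f w => ?_) a
  simp only [LinearMap.comp_apply, LinearMap.neg_apply, octr_tmul, map_sum]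
  rw [← Finset.sum_neg_distrib, Finset.sum_comm]
  simp only [← Finset.sum_neg_distrib]
  refine Finset.sum_congr rfl fun l _ => Finset.sum_congr rfl fun l' _ => ?_
  rw [lctr_comm, TensorProduct.tmul_neg]
  congr 2
  ring

lemma octr_fn (v : ι → F) (f : F) : octr v (fn f) = 0 := by
  simp [fn, octr_tmul, lctr_one]

lemma octr_dx (v : ι → F) (i : ι) : octr v (dx i) = fn (v i) := by
  rw [dx, octr_tmul, Finset.sum_eq_single i]
  · simp [ed, lctr_ι, fn]
  · intro l _ hl
    simp [ed, lctr_ι, hl]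
  · simp

variable [DiffRing ι F]

/-- The exterior derivative. -/
noncomputable def od : Om ι F →ₗ[ℂ] Om ι F :=
  ∑ i, TensorProduct.map (DiffRing.pd i : Derivation ℂ F F).toLinearMap
    (LinearMap.mulLeft ℂ (ed i))

lemma od_tmul (f : F) (w : ExteriorAlgebra ℂ (ι → ℂ)) :
    od (f ⊗ₜ[ℂ] w) = ∑ i, (DiffRing.pd i f) ⊗ₜ (ed i * w) := by
  simp [od, LinearMap.sum_apply]

lemma od_mul (a b : Om ι F) : od (a * b) = od a * b + oinv a * od b := by
  refine om_ext₂ (S := (LinearMap.mul ℂ (Om ι F)).compr₂ od)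
    (T := (LinearMap.mul ℂ (Om ι F)) ∘ₗ od +
      (LinearMap.mul ℂ (Om ι F)).compl₁₂ oinv.toLinearMap od) ?_ a b
  intro f w g w'
  simp only [LinearMap.compr₂_apply, LinearMap.mul_apply', Algebra.TensorProduct.tmul_mul_tmul,
    od_tmul, LinearMap.add_apply, LinearMap.comp_apply, LinearMap.compl₁₂_apply,
    AlgHom.toLinearMap_apply, oinv_tmul, Finset.sum_mul, Finset.mul_sum]
  rw [← Finset.sum_add_distrib]
  refine Finset.sum_congr rfl fun l _ => ?_
  rw [← mul_assoc (linv w), ed, ← ι_mul_comm, Derivation.leibniz, TensorProduct.add_tmul, add_comm,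
    smul_eq_mul, smul_eq_mul, mul_assoc, mul_comm g]

lemma od_oinv (a : Om ι F) : od (oinv a) = -oinv (od a) := by
  refine LinearMap.congr_fun (f := od ∘ₗ oinv.toLinearMap)
    (g := -((oinv (ι := ι) (F := F)).toLinearMap ∘ₗ od)) (om_ext fun f w => ?_) a
  simp only [LinearMap.comp_apply, AlgHom.toLinearMap_apply, oinv_tmul, LinearMap.neg_apply,
    od_tmul, map_sum]
  rw [← Finset.sum_neg_distrib]
  refine Finset.sum_congr rfl fun l _ => ?_
  rw [map_mul, ed, linv_ι, neg_mul, TensorProduct.tmul_neg, neg_neg]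

lemma od_opr (m : ℤ) (a : Om ι F) : od (opr m a) = opr (m + 1) (od a) := by
  refine LinearMap.congr_fun (f := od ∘ₗ opr m)
    (g := opr (m + 1) ∘ₗ od) (om_ext fun f w => ?_) a
  simp only [LinearMap.comp_apply, opr_tmul, od_tmul, map_sum, ed, lpr_ι_mul]

lemma od_od (a : Om ι F) : od (od a) = 0 := by
  refine LinearMap.congr_fun (f := od ∘ₗ od) (g := 0) (om_ext fun f w => ?_) a
  have h : od (od (f ⊗ₜ[ℂ] w)) = -od (od (f ⊗ₜ[ℂ] w)) := by
    simp only [od_tmul, map_sum]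
    rw [← Finset.sum_neg_distrib, Finset.sum_comm]
    simp only [← Finset.sum_neg_distrib]
    refine Finset.sum_congr rfl fun l _ => Finset.sum_congr rfl fun l' _ => ?_
    rw [DiffRing.pd_comm, ← TensorProduct.tmul_neg, ← mul_assoc, ← mul_assoc, ← neg_mul]
    congr 2
    exact eq_neg_of_add_eq_zero_left (ExteriorAlgebra.ι_add_mul_swap _ _)
  simp only [LinearMap.comp_apply, LinearMap.zero_apply]
  have h2 : (2 : ℂ) • od (od (f ⊗ₜ[ℂ] w)) = 0 := by
    rw [two_smul]
    exact eq_neg_iff_add_eq_zero.mp h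
  exact (smul_eq_zero.mp h2).resolve_left two_ne_zero

lemma od_fn (f : F) : od (fn f) = ∑ i, fn (DiffRing.pd i f) * dx i := by
  simp [fn, dx, od_tmul]

lemma od_dx (i : ι) : od (dx (F := F) i) = 0 := by
  simp [dx, od_tmul]

/-- Cartan's formula for a constant vector field. -/
lemma cartan_const (l : ι) (a : Om ι F) :
    od (octr (Pi.single l 1) a) + octr (Pi.single l 1) (od a) =
      TensorProduct.map (DiffRing.pd l : Derivation ℂ F F).toLinearMap LinearMap.id a := by
  have h1 : octr (Pi.single l (1 : F)) = TensorProduct.map LinearMap.id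
      (lctr (LinearMap.proj l : (ι → ℂ) →ₗ[ℂ] ℂ)) := by
    refine om_ext fun f w => ?_
    rw [octr_tmul, Finset.sum_eq_single l]
    · simp
    · intro b _ hb
      simp [hb]
    · simp
  refine LinearMap.congr_fun (f := od ∘ₗ octr (Pi.single l 1) + octr (Pi.single l 1) ∘ₗ od)
    (om_ext fun f w => ?_) a
  rw [h1]
  simp only [LinearMap.add_apply, LinearMap.comp_apply, TensorProduct.map_tmul, od_tmul, map_sum,
    LinearMap.id_apply]
  rw [← Finset.sum_add_distrib, Finset.sum_eq_single l]
  · rw [ed, lctr_ι_mul, ← TensorProduct.tmul_add]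
    simp
  · intro b _ hb
    rw [ed, lctr_ι_mul, ← TensorProduct.tmul_add]
    simp [hb.symm]
  · simp

end

end FreeToralRank

namespace FreeToralRank

open Polynomial

open scoped TensorProduct

set_option linter.unusedSectionVars false

section

variable {ι F : Type} [Fintype ι] [DecidableEq ι] [CommRing F] [Algebra ℂ F]
variable {ι' F' : Type} [Fintype ι'] [DecidableEq ι'] [CommRing F'] [Algebra ℂ F']

lemma fn_mul (f g : F) : fn (ι := ι) (f * g) = fn f * fn g := by simp [fn]

lemma fn_add (f g : F) : fn (ι := ι) (f + g) = fn f + fn g := by simp [fn, TensorProduct.add_tmul]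

lemma fn_one : fn (ι := ι) (1 : F) = 1 := rfl

lemma fn_zero : fn (ι := ι) (0 : F) = 0 := by simp [fn]

lemma fn_sum {α : Type} (s : Finset α) (f : α → F) :
    fn (ι := ι) (∑ i ∈ s, f i) = ∑ i ∈ s, fn (f i) := by simp [fn, TensorProduct.sum_tmul]

lemma fn_smul (c : ℂ) (f : F) : fn (ι := ι) (c • f) = c • fn f := by
  simp [fn, TensorProduct.smul_tmul']

/-- Forms are generated by functions and coordinate forms. -/
lemma om_induction {P : Om ι F → Prop} (hfn : ∀ f, P (fn f)) (hdx : ∀ i, P (dx i))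
    (hmul : ∀ a b, P a → P b → P (a * b)) (hadd : ∀ a b, P a → P b → P (a + b)) (a : Om ι F) :
    P a := by
  have hsum : ∀ (s : Finset ι) (b : ι → Om ι F), (∀ i, P (b i)) → P (∑ i ∈ s, b i) := by
    intro s b hb
    induction s using Finset.induction_on with
    | empty => simpa [fn] using hfn 0
    | insert i s hi ih =>
      rw [Finset.sum_insert hi]
      exact hadd _ _ (hb i) ih
  have hw : ∀ w : ExteriorAlgebra ℂ (ι → ℂ), P ((1 : F) ⊗ₜ w) := by
    intro w
    induction w using ExteriorAlgebra.induction with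
    | algebraMap r =>
      have := hfn (algebraMap ℂ F r)
      rwa [fn, Algebra.algebraMap_eq_smul_one, TensorProduct.smul_tmul,
        ← Algebra.algebraMap_eq_smul_one] at this
    | ι m =>
      rw [ι_eq_sum, TensorProduct.tmul_sum]
      refine hsum _ _ fun i => ?_
      have := hmul _ _ (hfn (m i • 1)) (hdx i)
      rwa [fn, dx, Algebra.TensorProduct.tmul_mul_tmul, one_mul, mul_one,
        TensorProduct.smul_tmul] at this
    | mul w w' h h' =>
      have := hmul _ _ h h'
      rwa [Algebra.TensorProduct.tmul_mul_tmul, one_mul] at this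
    | add w w' h h' =>
      rw [TensorProduct.tmul_add]
      exact hadd _ _ h h'
  induction a using TensorProduct.induction_on with
  | zero => simpa [fn] using hfn 0
  | add x y hx hy => exact hadd x y hx hy
  | tmul f w =>
    have := hmul _ _ (hfn f) (hw w)
    rwa [fn, Algebra.TensorProduct.tmul_mul_tmul, one_mul, mul_one] at this

lemma om_algHom_ext {B : Type} [Ring B] [Algebra ℂ B] {φ ψ : Om ι F →ₐ[ℂ] B}
    (h1 : ∀ f, φ (fn f) = ψ (fn f)) (h2 : ∀ i, φ (dx i) = ψ (dx i)) : φ = ψ := by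
  refine AlgHom.ext (om_induction h1 h2 ?_ ?_)
  · intro a b ha hb
    rw [map_mul, map_mul, ha, hb]
  · intro a b ha hb
    rw [map_add, map_add, ha, hb]

lemma even_comm_om (x a : Om ι F) (h : oinv x = x) : x * a = a * x := by
  have := (supercomm_om x a).1
  rw [h, ← two_smul ℂ x, smul_mul_assoc, mul_smul_comm] at this
  exact smul_right_injective _ two_ne_zero this

lemma odd_comm_om (x a : Om ι F) (h : oinv x = -x) : x * a = oinv a * x := by
  have := (supercomm_om x a).2
  rw [h, sub_neg_eq_add, ← two_smul ℂ x, smul_mul_assoc, mul_smul_comm] at this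
  exact smul_right_injective _ two_ne_zero this

lemma odd_sq_om (x : Om ι F) (h : oinv x = -x) : x * x = 0 := by
  have := odd_comm_om x x h
  rw [h, neg_mul, eq_neg_iff_add_eq_zero, ← two_smul ℂ] at this
  exact (smul_eq_zero.mp this).resolve_left two_ne_zero

@[simp] lemma oinv_fn (f : F) : oinv (fn (ι := ι) f) = fn f := by simp [fn]

@[simp] lemma oinv_dx (i : ι) : oinv (dx (F := F) i) = -dx i := by
  simp [dx, ed, TensorProduct.tmul_neg]

lemma opr_fn (f : F) : opr 0 (fn (ι := ι) f) = fn f := by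
  rw [fn, opr_tmul, lpr_zero_one]

/-- Products of homogeneous forms are homogeneous. -/
lemma opr_homog_mul {i j : ℤ} {a b : Om ι F} (ha : opr i a = a) (hb : opr j b = b) :
    opr (i + j) (a * b) = a * b := by
  conv_lhs => rw [← ha]
  rw [opr_mul, ha, add_sub_cancel_left, hb]

lemma opr_homog {i : ℤ} {a : Om ι F} (ha : opr i a = a) (j : ℤ) :
    opr j a = if j = i then a else 0 := by
  rw [← ha, opr_opr]

lemma opr_gt {m : ℤ} (hm : (Fintype.card ι : ℤ) < m) (a : Om ι F) : opr m a = 0 := by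
  refine LinearMap.congr_fun (f := opr m) (g := 0) (om_ext fun f w => ?_) a
  obtain ⟨k, rfl⟩ := Int.eq_ofNat_of_zero_le (show 0 ≤ m by omega)
  have h1 : Module.finrank ℂ (⋀[ℂ]^k (ι → ℂ)) = 0 := by
    rw [exteriorPower.finrank_eq, Module.finrank_fintype_fun_eq_card]
    exact Nat.choose_eq_zero_of_lt (by exact_mod_cast hm)
  have h2 : lpr (k : ℤ) w = 0 := by
    have := Submodule.finrank_eq_zero.mp h1
    have h3 := lpr_mem k w
    rw [this] at h3
    exact (Submodule.mem_bot ℂ).mp h3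
  rw [opr_tmul]
  change f ⊗ₜ[ℂ] lpr (k : ℤ) w = 0
  rw [h2, TensorProduct.tmul_zero]

section Pull

variable [DiffRing ι F] [DiffRing ι' F']

lemma oinv_od_fn (f : F) : oinv (od (fn (ι := ι) f)) = -od (fn f) := by
  have := od_oinv (fn (ι := ι) f)
  rw [oinv_fn] at this
  exact (neg_eq_iff_eq_neg.mpr this).symm

lemma opr_od_fn (f : F) : opr 1 (od (fn (ι := ι) f)) = od (fn f) := by
  have := od_opr 0 (fn (ι := ι) f)
  rw [opr_fn] at this
  exact this.symm

/-- The images of coordinate one-forms under a pullback. -/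
noncomputable def pullOne (G : ι → F') : (ι → ℂ) →ₗ[ℂ] Om ι' F' :=
  ∑ i, (LinearMap.proj i : (ι → ℂ) →ₗ[ℂ] ℂ).smulRight (od (fn (G i)))

lemma pullOne_apply (G : ι → F') (m : ι → ℂ) : pullOne G m = od (fn (∑ i, m i • G i)) := by
  simp [pullOne, LinearMap.sum_apply, fn_sum, fn_smul]

/-- Pullback of forms along an algebra homomorphism, `G` being the images of the coordinates. -/
noncomputable def pull (g : F →ₐ[ℂ] F') (G : ι → F') : Om ι F →ₐ[ℂ] Om ι' F' :=
  Algebra.TensorProduct.lift ((Algebra.TensorProduct.includeLeft : F' →ₐ[ℂ] Om ι' F').comp g)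
    (ExteriorAlgebra.lift ℂ ⟨pullOne G, fun m => by
      rw [pullOne_apply]
      exact odd_sq_om _ (oinv_od_fn _)⟩)
    fun f w => even_comm_om (fn (g f)) _ (oinv_fn _)

lemma pull_tmul (g : F →ₐ[ℂ] F') (G : ι → F') (f : F) (w : ExteriorAlgebra ℂ (ι → ℂ)) :
    pull g G (f ⊗ₜ w) = fn (g f) * ExteriorAlgebra.lift ℂ ⟨pullOne G, fun m => by
      rw [pullOne_apply]
      exact odd_sq_om _ (oinv_od_fn _)⟩ w :=
  Algebra.TensorProduct.lift_tmul _ _ _ f w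

@[simp] lemma pull_fn (g : F →ₐ[ℂ] F') (G : ι → F') (f : F) : pull g G (fn f) = fn (g f) := by
  rw [fn, pull_tmul, map_one, mul_one]

lemma pull_ι (g : F →ₐ[ℂ] F') (G : ι → F') (v : ι → ℂ) :
    pull g G (1 ⊗ₜ ExteriorAlgebra.ι ℂ v) = od (fn (∑ i, v i • G i)) := by
  rw [pull_tmul, map_one, fn_one, one_mul, ExteriorAlgebra.lift_ι_apply, pullOne_apply]

@[simp] lemma pull_dx (g : F →ₐ[ℂ] F') (G : ι → F') (i : ι) :
    pull g G (dx i) = od (fn (G i)) := by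
  rw [dx, ed, pull_ι, Finset.sum_eq_single i] <;> simp +contextual

lemma pull_oinv (g : F →ₐ[ℂ] F') (G : ι → F') (a : Om ι F) :
    pull g G (oinv a) = oinv (pull g G a) := by
  refine AlgHom.congr_fun (φ₁ := (pull g G).comp oinv) (φ₂ := oinv.comp (pull g G))
    (om_algHom_ext ?_ ?_) a
  · intro f
    simp
  · intro i
    simp [oinv_od_fn]

lemma pull_opr (g : F →ₐ[ℂ] F') (G : ι → F') (m : ℤ) (a : Om ι F) :
    pull g G (opr m a) = opr m (pull g G a) := by
  refine LinearMap.congr_fun (f := (pull g G).toLinearMap ∘ₗ opr m)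
    (g := opr m ∘ₗ (pull g G).toLinearMap) (om_ext fun f w => ?_) a
  simp only [LinearMap.comp_apply, opr_tmul, AlgHom.toLinearMap_apply]
  refine ext_induction (P := fun w => pull g G (f ⊗ₜ[ℂ] lpr m w) = opr m (pull g G (f ⊗ₜ[ℂ] w)))
    ?_ ?_ ?_ w
  · simp
  · intro x y hx hy
    simp only [map_add, TensorProduct.tmul_add, hx, hy]
  · intro n x hx
    have key : opr n (pull g G (f ⊗ₜ[ℂ] x)) = pull g G (f ⊗ₜ[ℂ] x) := by
      have h1 : opr n (pull g G ((1 : F) ⊗ₜ[ℂ] x)) = pull g G ((1 : F) ⊗ₜ[ℂ] x) := by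
        induction hx using Submodule.pow_induction_on_left' with
        | algebraMap r =>
          have e : ((1 : F) ⊗ₜ[ℂ] algebraMap ℂ (ExteriorAlgebra ℂ (ι → ℂ)) r) =
              algebraMap ℂ (Om ι F) r := by
            rw [Algebra.algebraMap_eq_smul_one, ← TensorProduct.smul_tmul,
              ← TensorProduct.smul_tmul', ← Algebra.TensorProduct.one_def,
              Algebra.algebraMap_eq_smul_one]
          rw [e, AlgHom.commutes, Algebra.algebraMap_eq_smul_one, map_smul]
          rw [Nat.cast_zero, opr_one]
        | add x y i hx hy h1 h2 => rw [TensorProduct.tmul_add, map_add, map_add, h1, h2]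
        | mem_mul v hv i x hx ih =>
          obtain ⟨v, rfl⟩ := hv
          have e : ((1 : F) ⊗ₜ[ℂ] (ExteriorAlgebra.ι ℂ v * x)) =
              (1 ⊗ₜ ExteriorAlgebra.ι ℂ v) * (1 ⊗ₜ x) := by
            rw [Algebra.TensorProduct.tmul_mul_tmul, one_mul]
          have e2 : pull g G (1 ⊗ₜ ExteriorAlgebra.ι ℂ v) = od (fn (∑ i, v i • G i)) :=
            pull_ι g G v
          rw [e, map_mul]
          push_cast
          rw [add_comm]
          exact opr_homog_mul (by rw [e2, opr_od_fn]) ih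
      have e : (f ⊗ₜ[ℂ] x) = fn f * ((1 : F) ⊗ₜ[ℂ] x) := by
        rw [fn, Algebra.TensorProduct.tmul_mul_tmul, one_mul, mul_one]
      rw [e, map_mul, pull_fn]
      have := opr_homog_mul (opr_fn (ι := ι') (g f)) h1
      rwa [zero_add] at this
    rw [lpr_of_mem hx, opr_homog key]
    split_ifs <;> simp

/-- The chain rule for an algebra homomorphism. -/
def IsPull (g : F →ₐ[ℂ] F') (G : ι → F') : Prop :=
  ∀ f j, DiffRing.pd j (g f) = ∑ i, g (DiffRing.pd i f) * DiffRing.pd j (G i)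

lemma pull_od {g : F →ₐ[ℂ] F'} {G : ι → F'} (h : IsPull g G) (a : Om ι F) :
    pull g G (od a) = od (pull g G a) := by
  induction a using om_induction with
  | hfn f =>
    rw [od_fn, map_sum, pull_fn, od_fn]
    simp only [map_mul, pull_fn, pull_dx, od_fn, h f, fn_sum, fn_mul, Finset.sum_mul,
      Finset.mul_sum]
    rw [Finset.sum_comm]
    simp only [mul_assoc]
  | hdx i => rw [od_dx, map_zero, pull_dx, od_od]
  | hmul a b ha hb =>
    rw [od_mul, map_add, map_mul, map_mul, map_mul, od_mul, ha, hb, pull_oinv]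
  | hadd a b ha hb => rw [map_add, map_add, map_add, map_add, ha, hb]

lemma octr_od_fn (v : ι → F) (f : F) :
    octr v (od (fn (ι := ι) f)) = fn (∑ l, v l * DiffRing.pd l f) := by
  rw [od_fn, map_sum, fn_sum]
  refine Finset.sum_congr rfl fun l _ => ?_
  rw [octr_mul, octr_fn, octr_dx, zero_mul, zero_add, oinv_fn, fn_mul,
    even_comm_om _ _ (oinv_fn _)]

lemma pull_octr {g : F →ₐ[ℂ] F'} {G : ι → F'} {v : ι → F} {v' : ι' → F'}
    (h : ∀ i, g (v i) = ∑ l, v' l * DiffRing.pd l (G i)) (a : Om ι F) :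
    pull g G (octr v a) = octr v' (pull g G a) := by
  induction a using om_induction with
  | hfn f => rw [octr_fn, map_zero, pull_fn, octr_fn]
  | hdx i => rw [octr_dx, pull_fn, pull_dx, octr_od_fn, h]
  | hmul a b ha hb =>
    rw [octr_mul, map_add, map_mul, map_mul, map_mul, octr_mul, ha, hb, pull_oinv]
  | hadd a b ha hb => rw [map_add, map_add, map_add, map_add, ha, hb]

lemma pull_id {X : ι → F} (hX : ∀ i j, DiffRing.pd j (X i) = if j = i then 1 else 0) :
    pull (AlgHom.id ℂ F) X = AlgHom.id ℂ (Om ι F) := by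
  refine om_algHom_ext (fun f => by simp) fun i => ?_
  rw [pull_dx, od_fn, Finset.sum_eq_single i]
  · simp [hX, fn_one]
  · intro j _ hj
    simp [hX, hj, fn_zero]
  · simp

/-- The Lie derivative along a vector field. -/
noncomputable def olie (v : ι → F) : Om ι F →ₗ[ℂ] Om ι F := od ∘ₗ octr v + octr v ∘ₗ od

lemma olie_apply (v : ι → F) (a : Om ι F) : olie v a = od (octr v a) + octr v (od a) := rfl

lemma olie_mul (v : ι → F) (a b : Om ι F) : olie v (a * b) = olie v a * b + a * olie v b := by
  simp only [olie_apply, octr_mul, od_mul, map_add, od_oinv, octr_oinv, oinv_oinv]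
  noncomm_ring

lemma olie_oinv (v : ι → F) (a : Om ι F) : olie v (oinv a) = oinv (olie v a) := by
  simp only [olie_apply, map_add, od_oinv, octr_oinv, map_neg, neg_neg]

lemma olie_opr (v : ι → F) (m : ℤ) (a : Om ι F) : olie v (opr m a) = opr m (olie v a) := by
  simp only [olie_apply, map_add, od_opr, opr_octr]
  congr 1
  have := opr_octr v (m - 1) a
  rw [sub_add_cancel] at this
  rw [← this, od_opr, sub_add_cancel]

lemma olie_od (v : ι → F) (a : Om ι F) : olie v (od a) = od (olie v a) := by
  simp only [olie_apply, map_add, od_od, map_zero, add_zero, zero_add]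

lemma olie_octr {v v' : ι → F}
    (h : ∀ k, ∑ l, v l * DiffRing.pd l (v' k) = ∑ l, v' l * DiffRing.pd l (v k)) (a : Om ι F) :
    olie v (octr v' a) = octr v' (olie v a) := by
  induction a using om_induction with
  | hfn f =>
    rw [octr_fn, map_zero, olie_apply, octr_fn, map_zero, zero_add, octr_od_fn, octr_fn]
  | hdx i =>
    rw [octr_dx, olie_apply, olie_apply, octr_dx, octr_fn, od_dx, map_zero, map_zero, zero_add,
      add_zero, octr_od_fn, octr_od_fn, h]
  | hmul a b ha hb =>
    rw [octr_mul, map_add, olie_mul, olie_mul, olie_mul, map_add, octr_mul, octr_mul, ha, hb,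
      olie_oinv]
    abel
  | hadd a b ha hb => rw [map_add, map_add, map_add, map_add, ha, hb]

end Pull

end

end FreeToralRank

namespace FreeToralRank

open Polynomial

open scoped TensorProduct

set_option linter.unusedSectionVars false

section

variable {ι F : Type} [Fintype ι] [DecidableEq ι] [CommRing F] [Algebra ℂ F] [DiffRing ι F]

/-- The Cartan differential on forms. -/
noncomputable def cartanD {σ : Type} [Fintype σ] (v : σ → ι → F) (p : σ → ℂ) :
    Om ι F →ₗ[ℂ] Om ι F := od + ∑ s, p s • octr (v s)

lemma cartanD_apply {σ : Type} [Fintype σ] (v : σ → ι → F) (p : σ → ℂ) (a : Om ι F) :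
    cartanD v p a = od a + ∑ s, p s • octr (v s) a := by
  simp [cartanD, LinearMap.sum_apply]

lemma cartanD_zero {σ : Type} [Fintype σ] (v : σ → ι → F) : cartanD v 0 = od := by
  ext
  simp [cartanD]

lemma octr_zero_field : octr (0 : ι → F) = 0 := by
  refine om_ext fun f w => ?_
  simp [octr_tmul]

/-- The stage of differential forms with the Cartan differentials of a family of vector fields. -/
noncomputable def cartanStage {σ : Type} [Fintype σ] (v : σ → ι → F) (S : Set σ)
    (hS : ∀ s, s ∉ S → v s = 0) : Stage σ (Om ι F) where
  ε := oinv
  pr := opr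
  D := cartanD v
  S := S
  εε := oinv_oinv
  even_comm := even_comm_om
  odd_comm := odd_comm_om
  pr_pr i a := by rw [opr_opr, if_pos rfl]
  pr_pr_ne i j a h := by rw [opr_opr, if_neg h]
  pr_neg i a h := opr_neg h a
  pr_one := opr_one
  pr_bdd := opr_bdd
  pr_ext := opr_ext
  pr_mul i j a b h := by
    conv_lhs => rw [← h]
    rw [opr_mul, h]
  ε_pr := oinv_opr
  pr_ε := opr_oinv
  D_mul p a b := by
    simp only [cartanD_apply, od_mul, octr_mul, add_mul, mul_add, Finset.sum_mul, Finset.mul_sum,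
      smul_add, Finset.sum_add_distrib, smul_mul_assoc, mul_smul_comm]
    abel
  D_ε p a := by
    simp only [cartanD_apply, od_oinv, octr_oinv, map_add, map_sum, map_smul, smul_neg,
      Finset.sum_neg_distrib, neg_add]
  D_poly a := by
    simp only [cartanD_apply]
    have h := Submodule.add_mem (polyFam σ (Om ι F)) (polyFam_const (od a))
      (Submodule.sum_mem _ (t := Finset.univ) fun s _ =>
        polyFam_smul_const (MvPolynomial.X s) (octr (v s) a))
    convert h using 1
    funext p
    simp
  d_pr m a := by
    rw [cartanD_zero, od_opr]
  d_d a := by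
    rw [cartanD_zero, od_od]
  D_filt p m a h j hj := by
    simp only [cartanD_zero, cartanD_apply, map_add, map_sum, map_smul, opr_octr]
    rw [h (j + 1) (by omega)]
    simp
  D_S p hp := by
    rw [cartanD_zero]
    unfold cartanD
    rw [Finset.sum_eq_zero, add_zero]
    intro s _
    by_cases hs : s ∈ S
    · rw [hp s hs, zero_smul]
    · rw [hS s hs, octr_zero_field, smul_zero]

/-- The stage of differential forms with only the exterior derivative. -/
noncomputable def deRham : Stage Empty (Om ι F) :=
  cartanStage (σ := Empty) (fun s => s.elim) ∅ fun s => s.elim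

lemma deRham_D (p) (a : Om ι F) : deRham.D p a = od a := by
  change cartanD _ p a = _
  rw [cartanD_apply]
  simp

/-- The square of the Cartan differential. -/
lemma cartanD_sq {σ : Type} [Fintype σ] (v : σ → ι → F) (p : σ → ℂ) (a : Om ι F) :
    cartanD v p (cartanD v p a) = ∑ s, p s • olie (v s) a := by
  have key : ∑ s, ∑ t, p s • p t • octr (v t) (octr (v s) a) = 0 := by
    have h : ∑ s, ∑ t, p s • p t • octr (v t) (octr (v s) a) =
        -∑ s, ∑ t, p s • p t • octr (v t) (octr (v s) a) := by
      conv_lhs => rw [Finset.sum_comm]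
      simp only [← Finset.sum_neg_distrib]
      refine Finset.sum_congr rfl fun s _ => Finset.sum_congr rfl fun t _ => ?_
      rw [octr_octr, smul_neg, smul_neg, smul_comm]
    rw [eq_neg_iff_add_eq_zero, ← two_smul ℂ] at h
    exact (smul_eq_zero.mp h).resolve_left two_ne_zero
  simp only [cartanD_apply, map_add, map_sum, map_smul, od_od, smul_add, Finset.sum_add_distrib,
    zero_add, olie_apply, Finset.smul_sum]
  rw [key, add_zero, add_comm]

end

/-- A stage restricts to a subalgebra that is stable under the structure. -/
noncomputable def Stage.restrict {σ A : Type} [Ring A] [Algebra ℂ A] (T : Stage σ A)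
    (B : Subalgebra ℂ A) (hε : ∀ a ∈ B, T.ε a ∈ B) (hpr : ∀ m, ∀ a ∈ B, T.pr m a ∈ B)
    (hD : ∀ p, ∀ a ∈ B, T.D p a ∈ B) : Stage σ B where
  ε := (T.ε.comp B.val).codRestrict B fun a => hε a a.2
  pr m := ((T.pr m).comp B.val.toLinearMap).codRestrict (Subalgebra.toSubmodule B)
    fun a => hpr m a a.2
  D p := ((T.D p).comp B.val.toLinearMap).codRestrict (Subalgebra.toSubmodule B)
    fun a => hD p a a.2
  S := T.S
  εε a := Subtype.ext (T.εε a)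
  even_comm x a h := Subtype.ext (T.even_comm x a (congrArg Subtype.val h))
  odd_comm x a h := Subtype.ext (T.odd_comm x a (congrArg Subtype.val h))
  pr_pr i a := Subtype.ext (T.pr_pr i a)
  pr_pr_ne i j a h := Subtype.ext (T.pr_pr_ne i j a h)
  pr_neg i a h := Subtype.ext (T.pr_neg i a h)
  pr_one := Subtype.ext T.pr_one
  pr_bdd a := by
    obtain ⟨N, hN⟩ := T.pr_bdd a
    exact ⟨N, fun m hm => Subtype.ext (hN m hm)⟩
  pr_ext a h := Subtype.ext (T.pr_ext a fun m => congrArg Subtype.val (h m))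
  pr_mul i j a b h := Subtype.ext (T.pr_mul i j a b (congrArg Subtype.val h))
  ε_pr m a := Subtype.ext (T.ε_pr m a)
  pr_ε m a := Subtype.ext (T.pr_ε m a)
  D_mul p a b := Subtype.ext (T.D_mul p a b)
  D_ε p a := Subtype.ext (T.D_ε p a)
  D_poly a := by
    obtain ⟨u, hu⟩ := LinearMap.exists_leftInverse_of_injective B.val.toLinearMap
      (LinearMap.ker_eq_bot.mpr Subtype.val_injective)
    have := polyFam_map u (T.D_poly a)
    convert this using 1
    funext p
    exact (LinearMap.congr_fun hu ⟨T.D p a, hD p a a.2⟩).symm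
  d_pr m a := Subtype.ext (T.d_pr m a)
  d_d a := Subtype.ext (T.d_d a)
  D_filt p m a h j hj := Subtype.ext
    (T.D_filt p m a (fun j hj => congrArg Subtype.val (h j hj)) j hj)
  D_S p h := by
    refine LinearMap.ext fun a => Subtype.ext ?_
    exact LinearMap.congr_fun (T.D_S p h) a

section Homotopy

variable {ι F F' : Type} [Fintype ι] [DecidableEq ι] [CommRing F] [Algebra ℂ F]
  [CommRing F'] [Algebra ℂ F'] [DiffRing ι F'] [DiffRing (Option ι) F]

/-- The restriction of constant forms killing the extra coordinate. -/
noncomputable def lrest : ExteriorAlgebra ℂ (Option ι → ℂ) →ₐ[ℂ] ExteriorAlgebra ℂ (ι → ℂ) :=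
  ExteriorAlgebra.map (LinearMap.funLeft ℂ ℂ some)

lemma lrest_ι (m : Option ι → ℂ) :
    lrest (ExteriorAlgebra.ι ℂ m) = ExteriorAlgebra.ι ℂ (fun i => m (some i)) := by
  simp only [lrest, ExteriorAlgebra.map_apply_ι]
  rfl

lemma lrest_ed_none : lrest (ed (none : Option ι)) = 0 := by
  rw [ed, lrest_ι]
  have : (fun i : ι => (Pi.single none 1 : Option ι → ℂ) (some i)) = 0 := by
    funext i
    simp
  rw [this, map_zero]

lemma lrest_ed_some (i : ι) : lrest (ed (some i)) = ed i := by
  rw [ed, lrest_ι, ed]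
  congr 1
  funext j
  simp [Pi.single_apply]

lemma lrest_mem {n : ℕ} {x : ExteriorAlgebra ℂ (Option ι → ℂ)} (hx : x ∈ ⋀[ℂ]^n (Option ι → ℂ)) :
    lrest x ∈ ⋀[ℂ]^n (ι → ℂ) := by
  induction hx using Submodule.pow_induction_on_left' with
  | algebraMap r =>
    rw [AlgHom.commutes]
    exact SetLike.algebraMap_mem_graded (fun i : ℕ => ⋀[ℂ]^i (ι → ℂ)) r
  | add x y i hx hy h1 h2 =>
    rw [map_add]
    exact add_mem h1 h2
  | mem_mul m hm i x hx ih =>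
    obtain ⟨v, rfl⟩ := hm
    rw [map_mul, lrest_ι]
    change _ ∈ LinearMap.range (ExteriorAlgebra.ι ℂ) ^ (i + 1)
    rw [pow_succ']
    exact Submodule.mul_mem_mul ⟨_, rfl⟩ ih

lemma lpr_lrest (m : ℤ) (x : ExteriorAlgebra ℂ (Option ι → ℂ)) :
    lpr m (lrest x) = lrest (lpr m x) := by
  have := lpr_shift (T := lrest.toLinearMap) (k := 0)
    (fun n x hx => Or.inl ⟨n, by simp, lrest_mem hx⟩) m x
  rwa [add_zero] at this

lemma lrest_lctr (l : ι) (w : ExteriorAlgebra ℂ (Option ι → ℂ)) :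
    lrest (lctr (LinearMap.proj (some l)) w) = lctr (LinearMap.proj l) (lrest w) := by
  induction w using ExteriorAlgebra.induction with
  | algebraMap r => simp [lctr_algebraMap]
  | ι m => simp [lctr_ι, lrest_ι]
  | add x y hx hy => simp only [map_add, hx, hy]
  | mul x y hx hy =>
    rw [lctr_mul, map_add, map_mul, map_mul, map_mul, lctr_mul, hx, hy]
    congr 2
    refine AlgHom.congr_fun (φ₁ := lrest.comp linv) (φ₂ := linv.comp lrest) ?_ x
    refine ExteriorAlgebra.hom_ext (LinearMap.ext fun m => ?_)
    simp [lrest_ι]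

/-- Fibre operators on forms on a product with an interval. -/
noncomputable def fib (u : F →ₗ[ℂ] F') : Om (Option ι) F →ₗ[ℂ] Om ι F' :=
  TensorProduct.map u lrest.toLinearMap

@[simp] lemma fib_tmul (u : F →ₗ[ℂ] F') (f : F) (w : ExteriorAlgebra ℂ (Option ι → ℂ)) :
    fib u (f ⊗ₜ[ℂ] w) = u f ⊗ₜ lrest w := rfl

lemma fib_od {u : F →ₗ[ℂ] F'}
    (hu : ∀ (i : ι) f, DiffRing.pd i (u f) = u (DiffRing.pd (some i) f)) (a) :
    fib u (od a) = od (fib u a) := by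
  refine LinearMap.congr_fun (f := fib u ∘ₗ od) (g := od ∘ₗ fib u) (om_ext fun f w => ?_) a
  simp only [LinearMap.comp_apply, od_tmul, fib_tmul, map_sum, map_add, map_mul,
    Fintype.sum_option, lrest_ed_none, lrest_ed_some, zero_mul, TensorProduct.tmul_zero, zero_add, hu]

lemma fib_opr (u : F →ₗ[ℂ] F') (m : ℤ) (a : Om (Option ι) F) :
    fib u (opr m a) = opr m (fib u a) := by
  refine LinearMap.congr_fun (f := fib u ∘ₗ opr m) (g := opr m ∘ₗ fib u)
    (om_ext fun f w => ?_) a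
  simp [lpr_lrest]

lemma fib_octr {u : F →ₗ[ℂ] F'} {v : Option ι → F} {v' : ι → F'} (hv : v none = 0)
    (h : ∀ (i : ι) f, u (v (some i) * f) = v' i * u f) (a) :
    fib u (octr v a) = octr v' (fib u a) := by
  refine LinearMap.congr_fun (f := fib u ∘ₗ octr v) (g := octr v' ∘ₗ fib u)
    (om_ext fun f w => ?_) a
  simp only [LinearMap.comp_apply, octr_tmul, fib_tmul, map_sum, Fintype.sum_option, hv, h,
    lrest_lctr, zero_mul, TensorProduct.zero_tmul, zero_add]

/-- Restriction to a slice, as an algebra homomorphism. -/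
noncomputable def slice (e : F →ₐ[ℂ] F') : Om (Option ι) F →ₐ[ℂ] Om ι F' :=
  Algebra.TensorProduct.map e lrest

lemma slice_eq_fib (e : F →ₐ[ℂ] F') (a : Om (Option ι) F) :
    slice e a = fib e.toLinearMap a := rfl

lemma slice_fn (e : F →ₐ[ℂ] F') (f : F) : slice (ι := ι) e (fn f) = fn (e f) := by
  rw [slice_eq_fib, fn, fib_tmul, map_one]
  rfl

lemma slice_dx_none (e : F →ₐ[ℂ] F') : slice e (dx (none : Option ι)) = 0 := by
  rw [slice_eq_fib, dx, fib_tmul, AlgHom.toLinearMap_apply, lrest_ed_none]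
  simp

lemma slice_dx_some (e : F →ₐ[ℂ] F') (i : ι) : slice e (dx (some i)) = dx i := by
  rw [slice_eq_fib, dx, fib_tmul, AlgHom.toLinearMap_apply, lrest_ed_some, map_one]
  rfl

/-- Integration of the derivative in the fibre direction. -/
lemma fib_olie (u w : F →ₗ[ℂ] F') (hw : ∀ f, u (DiffRing.pd none f) = w f) (a) :
    fib (ι := ι) u (olie (Pi.single none 1) a) = fib w a := by
  rw [olie_apply, cartan_const]
  refine LinearMap.congr_fun (f := fib u ∘ₗ
    TensorProduct.map (DiffRing.pd none : Derivation ℂ F F).toLinearMap LinearMap.id) (g := fib w)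
    (om_ext fun f w' => ?_) a
  simp [hw]

end Homotopy

end FreeToralRank

namespace FreeToralRank

open Polynomial

open scoped TensorProduct Topology ContDiff
open Filter

set_option linter.unusedSectionVars false

section

variable {ι ι' ι'' : Type} [Fintype ι'] [Fintype ι''] [Fintype ι]

/-- Complex functions that are smooth near a set. -/
def SmoothNear (K : Set (ι → ℝ)) (f : (ι → ℝ) → ℂ) : Prop :=
  ∀ᶠ x in 𝓝ˢ K, ContDiffAt ℝ ∞ f x

/-- The algebra of functions that are smooth near a set. -/
def smoothAlg (K : Set (ι → ℝ)) : Subalgebra ℂ ((ι → ℝ) → ℂ) where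
  carrier := {f | SmoothNear K f}
  mul_mem' {a b} ha hb := by
    have ha' : ∀ᶠ x in 𝓝ˢ K, ContDiffAt ℝ ∞ a x := ha
    have hb' : ∀ᶠ x in 𝓝ˢ K, ContDiffAt ℝ ∞ b x := hb
    change ∀ᶠ x in 𝓝ˢ K, ContDiffAt ℝ ∞ (a * b) x
    filter_upwards [ha', hb'] with x h1 h2 using h1.mul h2
  add_mem' {a b} ha hb := by
    have ha' : ∀ᶠ x in 𝓝ˢ K, ContDiffAt ℝ ∞ a x := ha
    have hb' : ∀ᶠ x in 𝓝ˢ K, ContDiffAt ℝ ∞ b x := hb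
    change ∀ᶠ x in 𝓝ˢ K, ContDiffAt ℝ ∞ (a + b) x
    filter_upwards [ha', hb'] with x h1 h2 using h1.add h2
  algebraMap_mem' r := by
    change ∀ᶠ x in 𝓝ˢ K, ContDiffAt ℝ ∞ (fun _ => r) x
    exact Eventually.of_forall fun x => contDiffAt_const

/-- The ideal of functions vanishing near a set. -/
def smoothZero (K : Set (ι → ℝ)) : Ideal (smoothAlg K) where
  carrier := {f | ∀ᶠ x in 𝓝ˢ K, f.1 x = 0}
  add_mem' {a b} ha hb := by
    have ha' : ∀ᶠ x in 𝓝ˢ K, a.1 x = 0 := ha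
    have hb' : ∀ᶠ x in 𝓝ˢ K, b.1 x = 0 := hb
    change ∀ᶠ x in 𝓝ˢ K, a.1 x + b.1 x = 0
    filter_upwards [ha', hb'] with x h1 h2
    rw [h1, h2, add_zero]
  zero_mem' := by
    change ∀ᶠ x in 𝓝ˢ K, (0 : ℂ) = 0
    exact Eventually.of_forall fun x => rfl
  smul_mem' c f hf := by
    have hf' : ∀ᶠ x in 𝓝ˢ K, f.1 x = 0 := hf
    change ∀ᶠ x in 𝓝ˢ K, c.1 x * f.1 x = 0
    filter_upwards [hf'] with x h1
    rw [h1, mul_zero]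

/-- Germs of smooth functions near a set. -/
def SGerm (K : Set (ι → ℝ)) : Type := smoothAlg K ⧸ smoothZero K

noncomputable instance (K : Set (ι → ℝ)) : CommRing (SGerm K) :=
  inferInstanceAs (CommRing (smoothAlg K ⧸ smoothZero K))

noncomputable instance (K : Set (ι → ℝ)) : Algebra ℂ (SGerm K) :=
  inferInstanceAs (Algebra ℂ (smoothAlg K ⧸ smoothZero K))

variable {K : Set (ι → ℝ)} {K' : Set (ι' → ℝ)} {K'' : Set (ι'' → ℝ)}

/-- The germ of a smooth function. -/
noncomputable def germ (f : (ι → ℝ) → ℂ) (hf : SmoothNear K f) : SGerm K :=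
  Ideal.Quotient.mk (smoothZero K) ⟨f, hf⟩

lemma germ_eq {f g : (ι → ℝ) → ℂ} {hf : SmoothNear K f} {hg : SmoothNear K g} :
    germ f hf = germ g hg ↔ f =ᶠ[𝓝ˢ K] g := by
  change Ideal.Quotient.mk (smoothZero K) ⟨f, hf⟩ = Ideal.Quotient.mk (smoothZero K) ⟨g, hg⟩ ↔ _
  rw [Ideal.Quotient.eq]
  change (∀ᶠ x in 𝓝ˢ K, f x - g x = 0) ↔ _
  simp only [sub_eq_zero]
  rfl

lemma germ_surj (a : SGerm K) : ∃ f hf, a = germ f hf := by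
  obtain ⟨⟨f, hf⟩, rfl⟩ := Ideal.Quotient.mk_surjective a
  exact ⟨f, hf, rfl⟩

/-- A representative of a germ. -/
noncomputable def SGerm.rep (a : SGerm K) : (ι → ℝ) → ℂ := (germ_surj a).choose

lemma SGerm.smooth_rep (a : SGerm K) : SmoothNear K a.rep := (germ_surj a).choose_spec.choose

lemma SGerm.germ_rep (a : SGerm K) : germ a.rep a.smooth_rep = a :=
  (germ_surj a).choose_spec.choose_spec.symm

lemma rep_germ {f : (ι → ℝ) → ℂ} (hf : SmoothNear K f) : (germ f hf).rep =ᶠ[𝓝ˢ K] f :=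
  germ_eq.mp (SGerm.germ_rep _)

lemma SmoothNear.add {f g : (ι → ℝ) → ℂ} (hf : SmoothNear K f) (hg : SmoothNear K g) :
    SmoothNear K (f + g) := (smoothAlg K).add_mem hf hg

lemma SmoothNear.mul {f g : (ι → ℝ) → ℂ} (hf : SmoothNear K f) (hg : SmoothNear K g) :
    SmoothNear K (f * g) := (smoothAlg K).mul_mem hf hg

lemma SmoothNear.smul {f : (ι → ℝ) → ℂ} (hf : SmoothNear K f) (c : ℂ) :
    SmoothNear K (c • f) := (smoothAlg K).smul_mem hf c

lemma smoothNear_one : SmoothNear K 1 := (smoothAlg K).one_mem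

lemma germ_add {f g : (ι → ℝ) → ℂ} (hf : SmoothNear K f) (hg : SmoothNear K g) :
    germ f hf + germ g hg = germ (f + g) (hf.add hg) := rfl

lemma germ_mul {f g : (ι → ℝ) → ℂ} (hf : SmoothNear K f) (hg : SmoothNear K g) :
    germ f hf * germ g hg = germ (f * g) (hf.mul hg) := rfl

lemma germ_smul {f : (ι → ℝ) → ℂ} (hf : SmoothNear K f) (c : ℂ) :
    c • germ f hf = germ (c • f) (hf.smul c) := rfl

lemma germ_one : germ 1 smoothNear_one = (1 : SGerm K) := rfl

lemma smoothNear_zero : SmoothNear K 0 := (smoothAlg K).zero_mem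

lemma germ_zero : germ 0 smoothNear_zero = (0 : SGerm K) := rfl

/-- A linear map of germs induced by an operator on functions. -/
noncomputable def germMap (T : ((ι → ℝ) → ℂ) → (ι' → ℝ) → ℂ)
    (hs : ∀ f, SmoothNear K f → SmoothNear K' (T f))
    (hc : ∀ f g, SmoothNear K f → SmoothNear K g → f =ᶠ[𝓝ˢ K] g → T f =ᶠ[𝓝ˢ K'] T g)
    (ha : ∀ f g, SmoothNear K f → SmoothNear K g → T (f + g) =ᶠ[𝓝ˢ K'] T f + T g)
    (hm : ∀ (c : ℂ) f, SmoothNear K f → T (c • f) =ᶠ[𝓝ˢ K'] c • T f) : SGerm K →ₗ[ℂ] SGerm K' where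
  toFun a := germ (T a.rep) (hs _ a.smooth_rep)
  map_add' a b := by
    rw [germ_add, germ_eq]
    refine EventuallyEq.trans ?_ (ha a.rep b.rep a.smooth_rep b.smooth_rep)
    refine hc _ _ (a + b).smooth_rep (a.smooth_rep.add b.smooth_rep) ?_
    rw [← germ_eq (hf := (a + b).smooth_rep) (hg := a.smooth_rep.add b.smooth_rep), SGerm.germ_rep,
      ← germ_add a.smooth_rep b.smooth_rep, SGerm.germ_rep, SGerm.germ_rep]
  map_smul' c a := by
    rw [RingHom.id_apply, germ_smul, germ_eq]
    refine EventuallyEq.trans ?_ (hm c a.rep a.smooth_rep)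
    refine hc _ _ (c • a).smooth_rep (a.smooth_rep.smul c) ?_
    rw [← germ_eq (hf := (c • a).smooth_rep) (hg := a.smooth_rep.smul c), SGerm.germ_rep,
      ← germ_smul a.smooth_rep c, SGerm.germ_rep]

lemma germMap_germ {T : ((ι → ℝ) → ℂ) → (ι' → ℝ) → ℂ}
    (hs : ∀ f, SmoothNear K f → SmoothNear K' (T f))
    (hc : ∀ f g, SmoothNear K f → SmoothNear K g → f =ᶠ[𝓝ˢ K] g → T f =ᶠ[𝓝ˢ K'] T g) (ha) (hm)
    (f) (hf : SmoothNear K f) : germMap T hs hc ha hm (germ f hf) = germ (T f) (hs f hf) := by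
  refine germ_eq.mpr (hc _ _ (SGerm.smooth_rep _) hf (rep_germ hf))

/-- A map that is smooth near `K'` and maps `K'` to `K`. -/
structure SMap (K' : Set (ι' → ℝ)) (K : Set (ι → ℝ)) where
  toFun : (ι' → ℝ) → ι → ℝ
  smooth : ∀ᶠ x in 𝓝ˢ K', ContDiffAt ℝ ∞ toFun x
  maps : Set.MapsTo toFun K' K

lemma SMap.tendsto (h : SMap K' K) : Tendsto h.toFun (𝓝ˢ K') (𝓝ˢ K) := by
  intro V hV
  rw [Filter.mem_map, mem_nhdsSet_iff_forall]
  intro x hx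
  have h1 : ContinuousAt h.toFun x :=
    ((eventually_nhdsSet_iff_forall.mp h.smooth x hx).self_of_nhds).continuousAt
  exact h1 (mem_nhdsSet_iff_forall.mp hV _ (h.maps hx))

/-- Composition of smooth maps. -/
def SMap.comp (h : SMap K' K) (k : SMap K'' K') : SMap K'' K where
  toFun := h.toFun ∘ k.toFun
  smooth := by
    filter_upwards [k.smooth, k.tendsto.eventually h.smooth] with x h1 h2
    exact h2.comp x h1
  maps := h.maps.comp k.maps

/-- The identity as a map between nested sets. -/
def SMap.incl {K L : Set (ι → ℝ)} (h : K ⊆ L) : SMap K L where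
  toFun := id
  smooth := Eventually.of_forall fun _ => contDiffAt_id
  maps := h

lemma SMap.smooth_comp (h : SMap K' K) {f : (ι → ℝ) → ℂ} (hf : SmoothNear K f) :
    SmoothNear K' (f ∘ h.toFun) := by
  filter_upwards [h.smooth, h.tendsto.eventually hf] with x h1 h2
  exact h2.comp x h1

/-- Pullback of germs, as a linear map. -/
noncomputable def SMap.germLin (h : SMap K' K) : SGerm K →ₗ[ℂ] SGerm K' :=
  germMap (fun f => f ∘ h.toFun) (fun _ hf => h.smooth_comp hf)
    (fun _ _ _ _ e => e.comp_tendsto h.tendsto)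
    (fun _ _ _ _ => EventuallyEq.rfl) (fun _ _ _ => EventuallyEq.rfl)

lemma SMap.germLin_germ (h : SMap K' K) {f : (ι → ℝ) → ℂ} (hf : SmoothNear K f) :
    h.germLin (FreeToralRank.germ f hf) = FreeToralRank.germ (f ∘ h.toFun) (h.smooth_comp hf) :=
  germMap_germ _ _ _ _ f hf

/-- Pullback of germs. -/
noncomputable def SMap.germ (h : SMap K' K) : SGerm K →ₐ[ℂ] SGerm K' :=
  AlgHom.ofLinearMap h.germLin (h.germLin_germ smoothNear_one)
    (by
      intro a b
      obtain ⟨f, hf, rfl⟩ := germ_surj a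
      obtain ⟨g, hg, rfl⟩ := germ_surj b
      rw [germ_mul, SMap.germLin_germ, SMap.germLin_germ, SMap.germLin_germ]
      rfl)

lemma SMap.germ_germ (h : SMap K' K) {f : (ι → ℝ) → ℂ} (hf : SmoothNear K f) :
    h.germ (FreeToralRank.germ f hf) = FreeToralRank.germ (f ∘ h.toFun) (h.smooth_comp hf) :=
  h.germLin_germ hf

lemma SMap.smooth_coord (h : SMap K' K) (i : ι) : SmoothNear K' fun x => (h.toFun x i : ℂ) := by
  filter_upwards [h.smooth] with x hx
  exact Complex.ofRealCLM.contDiff.contDiffAt.comp x (contDiffAt_pi.mp hx i)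

/-- The coordinates of a smooth map as germs. -/
noncomputable def SMap.coord (h : SMap K' K) (i : ι) : SGerm K' :=
  FreeToralRank.germ (fun x => (h.toFun x i : ℂ)) (h.smooth_coord i)

variable [DecidableEq ι'] [DecidableEq ι''] [DecidableEq ι]

/-- Partial derivatives of complex functions. -/
noncomputable def pderivFun (i : ι) (f : (ι → ℝ) → ℂ) (x : ι → ℝ) : ℂ :=
  fderiv ℝ f x (Pi.single i 1)

lemma SmoothNear.pderiv {f : (ι → ℝ) → ℂ} (hf : SmoothNear K f) (i : ι) :
    SmoothNear K (pderivFun i f) := by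
  filter_upwards [hf] with x hx
  exact (hx.fderiv_right (m := ∞) (by simp)).clm_apply contDiffAt_const

lemma pderivFun_congr {f g : (ι → ℝ) → ℂ} (h : f =ᶠ[𝓝ˢ K] g) (i : ι) :
    pderivFun i f =ᶠ[𝓝ˢ K] pderivFun i g := by
  rw [EventuallyEq, eventually_nhdsSet_iff_exists] at *
  obtain ⟨U, hU, hKU, h1⟩ := h
  refine ⟨U, hU, hKU, fun x hx => ?_⟩
  have : f =ᶠ[𝓝 x] g := by
    filter_upwards [hU.mem_nhds hx] with y hy using h1 y hy
  rw [pderivFun, pderivFun, this.fderiv_eq]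

lemma diff_of_smooth {E : Type} [NormedAddCommGroup E] [NormedSpace ℝ E] {f : (ι → ℝ) → E}
    {x : ι → ℝ} (h : ContDiffAt ℝ ∞ f x) : DifferentiableAt ℝ f x :=
  h.differentiableAt (by simp)

/-- Partial derivatives of germs, as linear maps. -/
noncomputable def pderivLin (i : ι) : SGerm K →ₗ[ℂ] SGerm K :=
  germMap (pderivFun i) (fun _ hf => hf.pderiv i) (fun _ _ _ _ e => pderivFun_congr e i)
    (fun f g hf hg => by
      filter_upwards [hf, hg] with x h1 h2
      change fderiv ℝ (f + g) x _ = fderiv ℝ f x _ + fderiv ℝ g x _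
      rw [fderiv_add (diff_of_smooth h1) (diff_of_smooth h2)]
      rfl)
    (fun c f hf => by
      filter_upwards [hf] with x h1
      change fderiv ℝ (c • f) x _ = c • fderiv ℝ f x _
      rw [fderiv_const_smul (diff_of_smooth h1)]
      rfl)

lemma pderivLin_germ (i : ι) {f : (ι → ℝ) → ℂ} (hf : SmoothNear K f) :
    (pderivLin i : SGerm K →ₗ[ℂ] SGerm K) (germ f hf) = germ (pderivFun i f) (hf.pderiv i) := germMap_germ _ _ _ _ f hf

noncomputable instance : DiffRing ι (SGerm K) where
  pd i := Derivation.mk' (pderivLin (K := K) i) (by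
    intro a b
    obtain ⟨f, hf, rfl⟩ := germ_surj a
    obtain ⟨g, hg, rfl⟩ := germ_surj b
    rw [germ_mul, pderivLin_germ, pderivLin_germ, pderivLin_germ, smul_eq_mul, smul_eq_mul,
      germ_mul, germ_mul, germ_add, germ_eq]
    filter_upwards [hf, hg] with x h1 h2
    change fderiv ℝ (f * g) x _ = f x * fderiv ℝ g x _ + g x * fderiv ℝ f x _
    rw [fderiv_mul (diff_of_smooth h1) (diff_of_smooth h2)]
    rfl)
  pd_comm i j a := by
    obtain ⟨f, hf, rfl⟩ := germ_surj a
    change pderivLin (K := K) i (pderivLin (K := K) j _) =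
      pderivLin (K := K) j (pderivLin (K := K) i _)
    rw [pderivLin_germ, pderivLin_germ, pderivLin_germ, pderivLin_germ, germ_eq]
    filter_upwards [hf] with x hx
    have hd : DifferentiableAt ℝ (fderiv ℝ f) x :=
      diff_of_smooth (hx.fderiv_right (m := ∞) (by simp))
    have key : ∀ i j : ι, pderivFun i (pderivFun j f) x =
        fderiv ℝ (fderiv ℝ f) x (Pi.single i 1) (Pi.single j 1) := by
      intro i j
      change fderiv ℝ (fun y => fderiv ℝ f y (Pi.single j 1)) x _ = _
      rw [fderiv_clm_apply hd (differentiableAt_const _)]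
      simp
    rw [key, key]
    exact (hx.isSymmSndFDerivAt (by simp; exact WithTop.coe_le_coe.mpr le_top)).eq _ _

lemma pd_germ (i : ι) {f : (ι → ℝ) → ℂ} (hf : SmoothNear K f) :
    (DiffRing.pd i : Derivation ℂ (SGerm K) (SGerm K)) (germ f hf) = germ (pderivFun i f) (hf.pderiv i) := pderivLin_germ i hf

lemma SmoothNear.sum {α : Type} (s : Finset α) {f : α → (ι → ℝ) → ℂ}
    (hf : ∀ i, SmoothNear K (f i)) : SmoothNear K (∑ i ∈ s, f i) :=
  (smoothAlg K).sum_mem fun i _ => hf i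

lemma germ_sum {α : Type} (s : Finset α) {f : α → (ι → ℝ) → ℂ} (hf : ∀ i, SmoothNear K (f i)) :
    ∑ i ∈ s, germ (f i) (hf i) = germ (∑ i ∈ s, f i) (SmoothNear.sum s hf) := by
  classical
  induction s using Finset.induction_on with
  | empty => simp [germ_zero]
  | insert i s hi ih =>
    rw [Finset.sum_insert hi, ih, germ_add (hf i) (SmoothNear.sum s hf), germ_eq,
      Finset.sum_insert hi]

lemma SMap.isPull (h : SMap K' K) : IsPull h.germ h.coord := by
  intro a j
  obtain ⟨f, hf, rfl⟩ := germ_surj a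
  simp only [pd_germ, SMap.germ_germ, SMap.coord, germ_mul]
  rw [germ_sum, germ_eq]
  filter_upwards [h.smooth, h.tendsto.eventually hf] with x h1 h2
  have e : pderivFun j (f ∘ h.toFun) x =
      fderiv ℝ f (h.toFun x) (fderiv ℝ h.toFun x (Pi.single j 1)) := by
    rw [pderivFun, fderiv_comp x (diff_of_smooth h2) (diff_of_smooth h1)]
    rfl
  rw [e, Finset.sum_apply]
  conv_lhs => rw [pi_eq_sum_univ' (fderiv ℝ h.toFun x (Pi.single j 1))]
  rw [map_sum]
  refine Finset.sum_congr rfl fun i _ => ?_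
  rw [map_smul]
  have e2 : pderivFun j (fun x => (h.toFun x i : ℂ)) x =
      ((fderiv ℝ h.toFun x (Pi.single j 1)) i : ℂ) := by
    have h3 : HasFDerivAt (fun x => (h.toFun x i : ℂ))
        (Complex.ofRealCLM.comp ((ContinuousLinearMap.proj (R := ℝ) (φ := fun _ : ι => ℝ) i).comp (fderiv ℝ h.toFun x))) x :=
      Complex.ofRealCLM.hasFDerivAt.comp x
        (((ContinuousLinearMap.proj (R := ℝ) (φ := fun _ : ι => ℝ) i).hasFDerivAt).comp x
          (diff_of_smooth h1).hasFDerivAt)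
    rw [pderivFun, h3.fderiv]
    rfl
  rw [Pi.mul_apply, e2, Function.comp_apply, pderivFun, mul_comm]
  simp

/-- Differential forms near a set. -/
abbrev Forms (K : Set (ι → ℝ)) : Type := Om ι (SGerm K)

/-- Pullback of forms. -/
noncomputable def SMap.pb (h : SMap K' K) : Forms K →ₐ[ℂ] Forms K' := pull h.germ h.coord

lemma SMap.pb_od (h : SMap K' K) (a : Forms K) : h.pb (od a) = od (h.pb a) := pull_od h.isPull a

lemma SMap.pb_opr (h : SMap K' K) (m : ℤ) (a : Forms K) : h.pb (opr m a) = opr m (h.pb a) :=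
  pull_opr _ _ m a

lemma SMap.pb_fn (h : SMap K' K) (a : SGerm K) : h.pb (fn a) = fn (h.germ a) := pull_fn _ _ a

lemma SMap.pb_dx (h : SMap K' K) (i : ι) : h.pb (dx i) = od (fn (h.coord i)) := pull_dx _ _ i

lemma SMap.pb_comp (h : SMap K' K) (k : SMap K'' K') (a : Forms K) :
    (h.comp k).pb a = k.pb (h.pb a) := by
  refine AlgHom.congr_fun (φ₁ := (h.comp k).pb) (φ₂ := k.pb.comp h.pb)
    (om_algHom_ext ?_ ?_) a
  · intro a
    obtain ⟨f, hf, rfl⟩ := germ_surj a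
    rw [AlgHom.comp_apply]
    simp only [SMap.pb_fn, SMap.germ_germ]
    rfl
  · intro i
    rw [AlgHom.comp_apply]
    simp only [SMap.pb_dx, SMap.pb_od, SMap.pb_fn]
    simp only [SMap.coord, SMap.germ_germ]
    rfl

lemma SMap.pb_congr {h k : SMap K' K} (e : h.toFun =ᶠ[𝓝ˢ K'] k.toFun) : h.pb = k.pb := by
  refine om_algHom_ext ?_ ?_
  · intro a
    obtain ⟨f, hf, rfl⟩ := germ_surj a
    simp only [SMap.pb_fn, SMap.germ_germ]
    congr 1
    rw [germ_eq]
    filter_upwards [e] with x hx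
    simp [hx]
  · intro i
    simp only [SMap.pb_dx, SMap.coord]
    congr 2
    rw [germ_eq]
    filter_upwards [e] with x hx
    simp [hx]

lemma pderivFun_coord (i j : ι) (x : ι → ℝ) :
    pderivFun j (fun x : ι → ℝ => (x i : ℂ)) x = if j = i then 1 else 0 := by
  have h3 : HasFDerivAt (fun x : ι → ℝ => (x i : ℂ))
      (Complex.ofRealCLM.comp (ContinuousLinearMap.proj (R := ℝ) (φ := fun _ : ι => ℝ) i)) x :=
    Complex.ofRealCLM.hasFDerivAt.comp x (ContinuousLinearMap.proj (R := ℝ) (φ := fun _ : ι => ℝ) i).hasFDerivAt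
  rw [pderivFun, h3.fderiv]
  by_cases h : j = i
  · subst h
    simp
  · simp [h, Ne.symm h]

lemma SMap.pb_of_eq_id (h : SMap K K) (e : h.toFun =ᶠ[𝓝ˢ K] id) (a : Forms K) : h.pb a = a := by
  have h1 : h.pb = (SMap.incl (le_refl K)).pb := SMap.pb_congr e
  have h2 : (SMap.incl (le_refl K)).germ = AlgHom.id ℂ (SGerm K) := by
    refine AlgHom.ext fun a => ?_
    obtain ⟨f, hf, rfl⟩ := germ_surj a
    rw [SMap.germ_germ]
    rfl
  rw [h1, SMap.pb, h2, pull_id]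
  · rfl
  · intro i j
    rw [SMap.coord, pd_germ]
    have : pderivFun j (fun x => (((SMap.incl (le_refl K)).toFun x i : ℝ) : ℂ)) =
        fun _ => if j = i then 1 else 0 := by
      funext x
      exact pderivFun_coord i j x
    simp only [this]
    split_ifs <;> rfl

end

end FreeToralRank

namespace FreeToralRank

open Polynomial

open scoped TensorProduct Topology ContDiff
open Filter

set_option linter.unusedSectionVars false

section

variable {ι ι' : Type} [Fintype ι'] [Fintype ι]

/-- The point of a product with the line. -/
def join (s : ℝ) (x : ι → ℝ) : Option ι → ℝ := fun o => o.elim s x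

@[simp] lemma join_none (s : ℝ) (x : ι → ℝ) : join s x none = s := rfl

@[simp] lemma join_some (s : ℝ) (x : ι → ℝ) (i : ι) : join s x (some i) = x i := rfl

/-- The cylinder over a set. -/
def cyl (K : Set (ι → ℝ)) : Set (Option ι → ℝ) :=
  {z | (fun i => z (some i)) ∈ K ∧ z none ∈ Set.Icc (0 : ℝ) 1}

lemma join_mem_cyl {K : Set (ι → ℝ)} {x : ι → ℝ} (hx : x ∈ K) {s : ℝ} (hs : s ∈ Set.Icc (0 : ℝ) 1) :
    join s x ∈ cyl K := ⟨hx, hs⟩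

lemma contDiff_join : ContDiff ℝ ∞ fun q : (ι → ℝ) × ℝ => join q.2 q.1 := by
  refine contDiff_pi.mpr fun o => ?_
  cases o with
  | none => exact contDiff_snd
  | some i => exact (contDiff_apply ℝ ℝ i).comp contDiff_fst

lemma contDiff_join_left (s : ℝ) : ContDiff ℝ ∞ fun x : ι → ℝ => join s x :=
  contDiff_join.comp (contDiff_id.prodMk contDiff_const)

lemma tube {K : Set (ι → ℝ)} {P : (Option ι → ℝ) → Prop} (h : ∀ᶠ z in 𝓝ˢ (cyl K), P z)
    {x : ι → ℝ} (hx : x ∈ K) : ∃ (W : Set (ι → ℝ)) (I : Set ℝ), IsOpen W ∧ x ∈ W ∧ IsOpen I ∧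
      Set.Icc 0 1 ⊆ I ∧ ∀ y ∈ W, ∀ s ∈ I, P (join s y) := by
  obtain ⟨V, hV, hKV, hP⟩ := eventually_nhdsSet_iff_exists.mp h
  have hn : IsOpen ((fun q : (ι → ℝ) × ℝ => join q.2 q.1) ⁻¹' V) :=
    hV.preimage contDiff_join.continuous
  obtain ⟨W, I, hW, hI, hxW, hII, hsub⟩ := generalized_tube_lemma (isCompact_singleton (x := x))
    (isCompact_Icc (a := (0 : ℝ)) (b := 1)) hn (by
      rintro ⟨y, s⟩ ⟨hy, hs⟩
      have hy' : y = x := hy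
      exact hKV (by subst hy'; exact join_mem_cyl hx hs))
  exact ⟨W, I, hW, hxW rfl, hI, hII, fun y hy s hs => hP _ (hsub (Set.mk_mem_prod hy hs))⟩

lemma tube_eventually {K : Set (ι → ℝ)} {P : (Option ι → ℝ) → Prop}
    (h : ∀ᶠ z in 𝓝ˢ (cyl K), P z) :
    ∀ᶠ x in 𝓝ˢ K, ∀ s ∈ Set.Icc (0 : ℝ) 1, P (join s x) := by
  rw [eventually_nhdsSet_iff_forall]
  intro x hx
  obtain ⟨W, I, hW, hxW, -, hI, hP⟩ := tube h hx
  filter_upwards [hW.mem_nhds hxW] with y hy s hs using hP y hy s (hI hs)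

/-- Weighted integration over the fibres of the cylinder. -/
noncomputable def intOp (φ : ℝ → ℂ) (f : (Option ι → ℝ) → ℂ) (x : ι → ℝ) : ℂ :=
  ∫ s in (0 : ℝ)..1, φ s * f (join s x)

variable {K : Set (ι → ℝ)}

lemma intOp_congr {φ : ℝ → ℂ} {f g : (Option ι → ℝ) → ℂ} (h : f =ᶠ[𝓝ˢ (cyl K)] g) :
    intOp φ f =ᶠ[𝓝ˢ K] intOp φ g := by
  filter_upwards [tube_eventually h] with x hx
  refine intervalIntegral.integral_congr fun s hs => ?_
  rw [Set.uIcc_of_le zero_le_one] at hs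
  simp only [hx s hs]

lemma continuousOn_line {φ : ℝ → ℂ} (hφ : Continuous φ) {f : (Option ι → ℝ) → ℂ} {x : ι → ℝ}
    (hx : ∀ s ∈ Set.Icc (0 : ℝ) 1, ContDiffAt ℝ ∞ f (join s x)) :
    ContinuousOn (fun s => φ s * f (join s x)) (Set.Icc 0 1) := by
  intro s hs
  refine (hφ.continuousAt.mul ?_).continuousWithinAt
  exact ContinuousAt.comp (f := fun s => join s x) (hx s hs).continuousAt
    (contDiff_join.continuous.comp (Continuous.prodMk_right x)).continuousAt

lemma intervalIntegrable_line {φ : ℝ → ℂ} (hφ : Continuous φ) {f : (Option ι → ℝ) → ℂ} {x : ι → ℝ}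
    (hx : ∀ s ∈ Set.Icc (0 : ℝ) 1, ContDiffAt ℝ ∞ f (join s x)) :
    IntervalIntegrable (fun s => φ s * f (join s x)) MeasureTheory.volume 0 1 := by
  refine ContinuousOn.intervalIntegrable ?_
  rw [Set.uIcc_of_le zero_le_one]
  exact continuousOn_line hφ hx

lemma SmoothNear.intOp {φ : ℝ → ℂ} (hφ : Continuous φ) {f : (Option ι → ℝ) → ℂ}
    (hf : SmoothNear (cyl K) f) : SmoothNear K (intOp φ f) := by
  rw [SmoothNear, eventually_nhdsSet_iff_forall]
  intro x hx
  obtain ⟨W, I, hW, hxW, hI, hII, hP⟩ := tube hf hx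
  obtain ⟨C, hC, hIC, hCI⟩ := exists_compact_between (isCompact_Icc (a := (0 : ℝ)) (b := 1)) hI hII
  obtain ⟨χ, hχ1, hχ0, -⟩ := exists_contMDiffMap_one_nhds_of_subset_interior (n := ⊤)
    (modelWithCornersSelf ℝ ℝ) (isClosed_Icc (a := (0 : ℝ)) (b := 1)) hIC
  have hχ : ContDiff ℝ ∞ χ := χ.contMDiff.contDiff
  set g : (ι → ℝ) → ℝ → ℂ := fun y t => (χ (-t) : ℂ) * f (join (-t) y) with hg
  have hgs : ContDiffOn ℝ ∞ (Function.uncurry g) (W ×ˢ Set.univ) := by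
    rintro ⟨y, t⟩ ⟨hy, -⟩
    refine ContDiffAt.contDiffWithinAt ?_
    by_cases ht : -t ∈ I
    · refine ContDiffAt.mul ?_ ?_
      · exact (Complex.ofRealCLM.contDiff.comp (hχ.comp contDiff_snd.neg)).contDiffAt
      · exact ContDiffAt.comp (f := fun q : (ι → ℝ) × ℝ => join (-q.2) q.1) _ (hP y hy _ ht)
          (contDiff_join.comp (contDiff_fst.prodMk contDiff_snd.neg)).contDiffAt
    · have : ∀ᶠ q : (ι → ℝ) × ℝ in 𝓝 (y, t), -q.2 ∈ Cᶜ :=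
        ContinuousAt.eventually_mem (f := fun q : (ι → ℝ) × ℝ => -q.2)
          continuous_snd.neg.continuousAt
          (hC.isClosed.isOpen_compl.mem_nhds fun h => ht (hCI h))
      refine ContDiffAt.congr_of_eventuallyEq (contDiffAt_const (c := (0 : ℂ))) ?_
      filter_upwards [this] with q hq
      simp [Function.uncurry, hg, hχ0 _ hq]
  have hk : IsCompact (Neg.neg '' C) := hC.image continuous_neg
  have hφi : MeasureTheory.LocallyIntegrable ((Set.Icc (0 : ℝ) 1).indicator φ)
      MeasureTheory.volume :=
    (hφ.continuousOn.integrableOn_Icc.integrable_indicator measurableSet_Icc).locallyIntegrable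
  have key := MeasureTheory.contDiffOn_convolution_right_with_param (n := ⊤) (g := g) (ContinuousLinearMap.mul ℝ ℂ)
    hW hk (fun p t _ ht => by
      have : -t ∉ C := fun h => ht ⟨-t, h, neg_neg t⟩
      simp only [hg]
      rw [hχ0 _ this, Complex.ofReal_zero, zero_mul]) hφi hgs
  have h2 : ContDiffOn ℝ ∞ (FreeToralRank.intOp φ f) W := by
    refine (key.comp (contDiff_id.prodMk (contDiff_const (c := (0 : ℝ)))).contDiffOn
      fun y hy => ⟨hy, trivial⟩).congr ?_
    intro y hy
    rw [Function.comp_apply, MeasureTheory.convolution_def]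
    change _ = ∫ t, (Set.Icc (0 : ℝ) 1).indicator φ t * g y (0 - t)
    rw [FreeToralRank.intOp, intervalIntegral.integral_of_le zero_le_one,
      ← MeasureTheory.integral_Icc_eq_integral_Ioc,
      ← MeasureTheory.integral_indicator measurableSet_Icc]
    congr 1
    funext t
    by_cases ht : t ∈ Set.Icc (0 : ℝ) 1
    · rw [Set.indicator_of_mem ht, Set.indicator_of_mem ht]
      simp [hg, hχ1.self_of_nhdsSet t ht]
    · rw [Set.indicator_of_notMem ht, Set.indicator_of_notMem ht, zero_mul]
  filter_upwards [hW.mem_nhds hxW] with y hy using h2.contDiffAt (hW.mem_nhds hy)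

lemma intOp_add {φ : ℝ → ℂ} (hφ : Continuous φ) {f g : (Option ι → ℝ) → ℂ}
    (hf : SmoothNear (cyl K) f) (hg : SmoothNear (cyl K) g) :
    intOp φ (f + g) =ᶠ[𝓝ˢ K] intOp φ f + intOp φ g := by
  filter_upwards [tube_eventually hf, tube_eventually hg] with x h1 h2
  simp only [intOp, Pi.add_apply, mul_add]
  exact intervalIntegral.integral_add (intervalIntegrable_line hφ h1) (intervalIntegrable_line hφ h2)

lemma intOp_smul {φ : ℝ → ℂ} (c : ℂ) (f : (Option ι → ℝ) → ℂ) :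
    intOp φ (c • f) = c • intOp φ f := by
  funext x
  simp only [intOp, Pi.smul_apply, smul_eq_mul, ← intervalIntegral.integral_const_mul]
  congr 1
  funext s
  ring

variable [DecidableEq ι]

lemma pderivFun_intOp {φ : ℝ → ℂ} (hφ : Continuous φ) {f : (Option ι → ℝ) → ℂ}
    (hf : SmoothNear (cyl K) f) (i : ι) :
    pderivFun i (intOp φ f) =ᶠ[𝓝ˢ K] intOp φ (pderivFun (some i) f) := by
  have hev : ∀ᶠ x in 𝓝ˢ K, ∀ᶠ y in 𝓝 x, ∀ s ∈ Set.Icc (0 : ℝ) 1, ContDiffAt ℝ ∞ f (join s y) := by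
    obtain ⟨V, hV, hKV, hP⟩ := eventually_nhdsSet_iff_exists.mp (tube_eventually hf)
    exact eventually_nhdsSet_iff_exists.mpr ⟨V, hV, hKV, fun x hx => by
      filter_upwards [hV.mem_nhds hx] with y hy using hP y hy⟩
  filter_upwards [SmoothNear.intOp hφ hf, hev] with x h1 h2
  have hline : ∀ s : ℝ, ∀ t : ℝ, HasDerivAt (fun t : ℝ => join s (x + t • Pi.single i 1))
      (Pi.single (some i) 1) t := by
    intro s t
    rw [hasDerivAt_pi]
    intro o
    cases o with
    | none => exact hasDerivAt_const t s
    | some j =>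
      have : HasDerivAt (fun t : ℝ => x j + t * (Pi.single i 1 : ι → ℝ) j)
          (1 * (Pi.single i 1 : ι → ℝ) j) t := ((hasDerivAt_id t).mul_const _).const_add _
      rw [one_mul] at this
      have e : (Pi.single (some i) 1 : Option ι → ℝ) (some j) = (Pi.single i 1 : ι → ℝ) j := by
        simp [Pi.single_apply]
      rw [e]
      exact this
  have hc : Continuous fun t : ℝ => x + t • (Pi.single i 1 : ι → ℝ) := by fun_prop
  have h3 : ∀ᶠ t in 𝓝 (0 : ℝ), ∀ s ∈ Set.Icc (0 : ℝ) 1,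
      ContDiffAt ℝ ∞ f (join s (x + t • Pi.single i 1)) := by
    have h2' : ∀ᶠ y in 𝓝 (x + (0 : ℝ) • (Pi.single i 1 : ι → ℝ)), ∀ s ∈ Set.Icc (0 : ℝ) 1,
        ContDiffAt ℝ ∞ f (join s y) := by simpa using h2
    exact (hc.continuousAt (x := 0)).eventually h2'
  obtain ⟨δ, hδ, hball⟩ := Metric.eventually_nhds_iff_ball.mp h3
  have hI : ∀ t ∈ Set.Icc (-(δ / 2)) (δ / 2), ∀ s ∈ Set.Icc (0 : ℝ) 1,
      ContDiffAt ℝ ∞ f (join s (x + t • Pi.single i 1)) := by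
    intro t ht
    refine hball t ?_
    rw [mem_ball_zero_iff, Real.norm_eq_abs]
    exact lt_of_le_of_lt (abs_le.mpr ht) (by linarith)
  have hcont : ContinuousOn (fun q : ℝ × ℝ => φ q.2 *
      pderivFun (some i) f (join q.2 (x + q.1 • Pi.single i 1)))
      (Set.Icc (-(δ / 2)) (δ / 2) ×ˢ Set.Icc (0 : ℝ) 1) := by
    rintro ⟨t, s⟩ ⟨ht, hs⟩
    refine ContinuousAt.continuousWithinAt
      (ContinuousAt.mul (hφ.comp continuous_snd).continuousAt ?_)
    have hd : ContDiffAt ℝ ∞ (pderivFun (some i) f) (join s (x + t • Pi.single i 1)) :=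
      ((hI t ht s hs).fderiv_right (m := ∞) (by simp)).clm_apply contDiffAt_const
    exact ContinuousAt.comp (f := fun q : ℝ × ℝ => join q.2 (x + q.1 • Pi.single i 1))
      (x := (t, s)) hd.continuousAt ((contDiff_join.continuous.comp
        ((hc.comp continuous_fst).prodMk continuous_snd)).continuousAt)
  obtain ⟨C, hC⟩ := (isCompact_Icc.prod isCompact_Icc).exists_bound_of_continuousOn hcont
  have hder := intervalIntegral.hasDerivAt_integral_of_dominated_loc_of_deriv_le
    (F := fun (t s : ℝ) => φ s * f (join s (x + t • Pi.single i 1)))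
    (F' := fun (t s : ℝ) => φ s * pderivFun (some i) f (join s (x + t • Pi.single i 1)))
    (x₀ := (0 : ℝ)) (a := 0) (b := 1) (s := Set.Icc (-(δ / 2)) (δ / 2)) (bound := fun _ => C)
    (μ := MeasureTheory.volume)
    (Icc_mem_nhds (by linarith) (by linarith)) ?_ ?_ ?_ ?_ ?_ ?_
  · have h5 := hder.2
    simp only [zero_smul, add_zero] at h5
    have h6 : HasDerivAt (fun t : ℝ => intOp φ f (x + t • Pi.single i 1))
        (fderiv ℝ (intOp φ f) x (Pi.single i 1)) 0 := by
      have hx : HasFDerivAt (intOp φ f) (fderiv ℝ (intOp φ f) x) (x + (0 : ℝ) • Pi.single i 1) := by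
        simpa using (diff_of_smooth h1).hasFDerivAt
      have hl : HasDerivAt (fun t : ℝ => x + t • (Pi.single i 1 : ι → ℝ)) (Pi.single i 1) 0 := by
        simpa using ((hasDerivAt_id (0 : ℝ)).smul_const (Pi.single i 1 : ι → ℝ)).const_add x
      exact hx.comp_hasDerivAt (0 : ℝ) hl
    exact h6.unique h5
  · filter_upwards [h3] with t ht
    exact (intervalIntegrable_iff.mp (intervalIntegrable_line hφ ht)).aestronglyMeasurable
  · refine intervalIntegrable_line hφ ?_
    simpa using h2.self_of_nhds
  · have : IntervalIntegrable (fun s => φ s *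
        pderivFun (some i) f (join s (x + (0 : ℝ) • Pi.single i 1))) MeasureTheory.volume 0 1 := by
      refine intervalIntegrable_line hφ fun s hs => ?_
      exact ((hI 0 ⟨by linarith, by linarith⟩ s hs).fderiv_right (m := ∞) (by simp)).clm_apply
        contDiffAt_const
    exact (intervalIntegrable_iff.mp this).aestronglyMeasurable
  · refine Eventually.of_forall fun s hs t ht => hC (t, s) ⟨ht, ?_⟩
    rw [Set.uIoc_of_le zero_le_one] at hs
    exact Set.Ioc_subset_Icc_self hs
  · exact intervalIntegrable_const
  · refine Eventually.of_forall fun s hs t ht => ?_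
    rw [Set.uIoc_of_le zero_le_one] at hs
    exact (HasFDerivAt.comp_hasDerivAt t
      (diff_of_smooth (hI t ht s (Set.Ioc_subset_Icc_self hs))).hasFDerivAt (hline s t)).const_mul _

lemma hasDerivAt_line {f : (Option ι → ℝ) → ℂ} {x : ι → ℝ} {s : ℝ}
    (h : ContDiffAt ℝ ∞ f (join s x)) :
    HasDerivAt (fun s => f (join s x)) (pderivFun none f (join s x)) s := by
  have hline : HasDerivAt (fun s : ℝ => join s x) (Pi.single none 1) s := by
    rw [hasDerivAt_pi]
    intro o
    cases o with
    | none => exact hasDerivAt_id s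
    | some j => simpa using hasDerivAt_const s (x j)
  exact (diff_of_smooth h).hasFDerivAt.comp_hasDerivAt s hline

lemma intOp_ftc {φ φ' : ℝ → ℂ} (hφ' : Continuous φ') (hφ : ∀ s, HasDerivAt φ (φ' s) s)
    {f : (Option ι → ℝ) → ℂ} (hf : SmoothNear (cyl K) f) :
    ∀ᶠ x in 𝓝ˢ K, intOp φ (pderivFun none f) x =
      φ 1 * f (join 1 x) - φ 0 * f (join 0 x) - intOp φ' f x := by
  have hc : Continuous φ := continuous_iff_continuousAt.mpr fun s => (hφ s).continuousAt
  filter_upwards [tube_eventually hf] with x hx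
  have hd : ∀ s ∈ Set.Icc (0 : ℝ) 1, ContDiffAt ℝ ∞ (pderivFun none f) (join s x) := fun s hs =>
    ((hx s hs).fderiv_right (m := ∞) (by simp)).clm_apply contDiffAt_const
  have h1 := intervalIntegrable_line hc hd
  have h2 := intervalIntegrable_line hφ' hx
  have h3 : ∫ s in (0 : ℝ)..1, (φ' s * f (join s x) + φ s * pderivFun none f (join s x)) =
      φ 1 * f (join 1 x) - φ 0 * f (join 0 x) := by
    refine intervalIntegral.integral_eq_sub_of_hasDerivAt (f := fun s => φ s * f (join s x))
      (fun s hs => ?_) (h2.add h1)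
    rw [Set.uIcc_of_le zero_le_one] at hs
    exact (hφ s).mul (hasDerivAt_line (hx s hs))
  rw [intervalIntegral.integral_add h2 h1] at h3
  rw [← h3, intOp, intOp]
  ring

end

end FreeToralRank

namespace FreeToralRank

open Polynomial

open scoped TensorProduct Topology ContDiff
open Filter

set_option linter.unusedSectionVars false

section

variable {ι ι' : Type} [Fintype ι] [Fintype ι'] {K : Set (ι → ℝ)} {K' : Set (ι' → ℝ)}

lemma zero_mem_unit : (0 : ℝ) ∈ Set.Icc (0 : ℝ) 1 := Set.left_mem_Icc.mpr zero_le_one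

lemma one_mem_unit : (1 : ℝ) ∈ Set.Icc (0 : ℝ) 1 := Set.right_mem_Icc.mpr zero_le_one

/-- Weighted fibre integration of germs. -/
noncomputable def intGerm (φ : ℝ → ℂ) (hφ : Continuous φ) : SGerm (cyl K) →ₗ[ℂ] SGerm K :=
  germMap (intOp φ) (fun _ hf => hf.intOp hφ) (fun _ _ _ _ e => intOp_congr e)
    (fun _ _ hf hg => intOp_add hφ hf hg)
    (fun c f _ => by rw [intOp_smul])

lemma intGerm_germ {φ : ℝ → ℂ} (hφ : Continuous φ) {f : (Option ι → ℝ) → ℂ}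
    (hf : SmoothNear (cyl K) f) :
    intGerm φ hφ (germ f hf) = germ (intOp φ f) (hf.intOp hφ) := germMap_germ _ _ _ _ f hf

/-- The inclusion of a slice into the cylinder. -/
def sliceMap (K : Set (ι → ℝ)) (s : ℝ) (hs : s ∈ Set.Icc (0 : ℝ) 1) : SMap K (cyl K) where
  toFun := join s
  smooth := Eventually.of_forall fun _ => (contDiff_join_left s).contDiffAt
  maps _ hx := join_mem_cyl hx hs

/-- The projection of the cylinder to the base. -/
def cylProj (K : Set (ι → ℝ)) : SMap (cyl K) K where
  toFun z i := z (some i)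
  smooth := Eventually.of_forall fun _ =>
    (contDiff_pi.mpr fun i => contDiff_apply ℝ ℝ (some i)).contDiffAt
  maps _ hz := hz.1

lemma intGerm_proj_mul {φ : ℝ → ℂ} (hφ : Continuous φ) (g : SGerm K) (f : SGerm (cyl K)) :
    intGerm φ hφ ((cylProj K).germ g * f) = g * intGerm φ hφ f := by
  obtain ⟨f, hf, rfl⟩ := germ_surj f
  obtain ⟨g, hg, rfl⟩ := germ_surj g
  rw [SMap.germ_germ, germ_mul, intGerm_germ, intGerm_germ, germ_mul, germ_eq]
  refine Eventually.of_forall fun x => ?_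
  change (∫ s in (0 : ℝ)..1, φ s * (g x * f (join s x))) = g x * ∫ s in (0 : ℝ)..1, φ s * f (join s x)
  rw [← intervalIntegral.integral_const_mul]
  congr 1
  funext s
  ring

variable [DecidableEq ι] [DecidableEq ι']

lemma pd_intGerm {φ : ℝ → ℂ} (hφ : Continuous φ) (i : ι) (f : SGerm (cyl K)) :
    DiffRing.pd i (intGerm φ hφ f) = intGerm φ hφ (DiffRing.pd (some i) f) := by
  obtain ⟨f, hf, rfl⟩ := germ_surj f
  rw [pd_germ, intGerm_germ, intGerm_germ, pd_germ, germ_eq]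
  exact pderivFun_intOp hφ hf i

/-- The difference of the restrictions to the ends of the cylinder. -/
lemma intGerm_none (f : SGerm (cyl K)) :
    intGerm (fun _ => 1) continuous_const (DiffRing.pd none f) =
      (sliceMap K 1 one_mem_unit).germ f - (sliceMap K 0 zero_mem_unit).germ f := by
  obtain ⟨f, hf, rfl⟩ := germ_surj f
  rw [pd_germ, intGerm_germ, SMap.germ_germ, SMap.germ_germ, eq_sub_iff_add_eq, germ_add, germ_eq]
  filter_upwards [intOp_ftc (φ := fun _ => 1) (φ' := fun _ => 0) continuous_const
    (fun s => hasDerivAt_const s _) hf] with x hx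
  change intOp _ _ x + f (join 0 x) = f (join 1 x)
  rw [hx]
  simp [intOp]

lemma intGerm_none' (f : SGerm (cyl K)) :
    intGerm (fun s => 1 - s) (by fun_prop) (DiffRing.pd none f) =
      intGerm (fun _ => 1) continuous_const f - (sliceMap K 0 zero_mem_unit).germ f := by
  obtain ⟨f, hf, rfl⟩ := germ_surj f
  rw [pd_germ, intGerm_germ, intGerm_germ, SMap.germ_germ, eq_sub_iff_add_eq, germ_add, germ_eq]
  filter_upwards [intOp_ftc (φ := fun s => 1 - s) (φ' := fun _ => -1) continuous_const
    (fun s => (hasDerivAt_id s).ofReal_comp.const_sub 1 |>.congr_deriv (by simp)) hf] with x hx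
  change intOp _ _ x + f (join 0 x) = intOp _ f x
  rw [hx]
  simp [intOp]

lemma slice_eq_pb (s : ℝ) (hs : s ∈ Set.Icc (0 : ℝ) 1) (a : Forms (cyl K)) :
    slice (sliceMap K s hs).germ a = (sliceMap K s hs).pb a := by
  refine AlgHom.congr_fun (om_algHom_ext ?_ ?_) a
  · intro f
    rw [slice_fn, SMap.pb_fn]
  · intro o
    rw [SMap.pb_dx, SMap.coord, od_fn]
    cases o with
    | none =>
      rw [slice_dx_none]
      symm
      refine Finset.sum_eq_zero fun j _ => ?_
      rw [pd_germ]
      have : pderivFun j (fun x : ι → ℝ => (((sliceMap K s hs).toFun x none : ℝ) : ℂ)) = 0 := by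
        funext x
        change fderiv ℝ (fun _ => (s : ℂ)) x _ = 0
        simp
      simp only [this, germ_zero, fn_zero, zero_mul]
    | some i =>
      rw [slice_dx_some, Finset.sum_eq_single i]
      · rw [pd_germ]
        have : pderivFun i (fun x : ι → ℝ => (((sliceMap K s hs).toFun x (some i) : ℝ) : ℂ)) = 1 := by
          funext x
          exact (pderivFun_coord i i x).trans (if_pos rfl)
        simp only [this, germ_one, fn_one, one_mul]
      · intro j _ hj
        rw [pd_germ]
        have : pderivFun j (fun x : ι → ℝ => (((sliceMap K s hs).toFun x (some i) : ℝ) : ℂ)) = 0 := by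
          funext x
          exact (pderivFun_coord i j x).trans (if_neg hj)
        simp only [this, germ_zero, fn_zero, zero_mul]
      · simp

/-- Two smooth maps that induce chain homotopic maps on forms. -/
def Htpy (f g : SMap K' K) : Prop :=
  ∃ J : Forms K →ₗ[ℂ] Forms K', ∀ a, g.pb a - f.pb a = od (J a) + J (od a)

lemma Htpy.of_cyl (H : SMap (cyl K') K) :
    Htpy (H.comp (sliceMap K' 0 zero_mem_unit))
      (H.comp (sliceMap K' 1 one_mem_unit)) := by
  refine ⟨fib (intGerm (fun _ => 1) continuous_const) ∘ₗ octr (Pi.single none 1) ∘ₗ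
    H.pb.toLinearMap, fun a => ?_⟩
  have h := fib_olie (ι := ι') (intGerm (K := K') (fun _ => 1) continuous_const)
    ((sliceMap K' 1 one_mem_unit).germ.toLinearMap -
      (sliceMap K' 0 zero_mem_unit).germ.toLinearMap) (fun f => intGerm_none f) (H.pb a)
  have h2 : ∀ b : Forms (cyl K'), fib (ι := ι')
      ((sliceMap K' 1 one_mem_unit).germ.toLinearMap -
      (sliceMap K' 0 zero_mem_unit).germ.toLinearMap) b =
      (sliceMap K' 1 one_mem_unit).pb b - (sliceMap K' 0 zero_mem_unit).pb b := by
    intro b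
    rw [← slice_eq_pb, ← slice_eq_pb, slice_eq_fib, slice_eq_fib, ← LinearMap.sub_apply]
    refine LinearMap.congr_fun (om_ext fun f w => ?_) b
    simp [TensorProduct.sub_tmul]
  rw [h2, olie_apply, map_add, fib_od (fun i f => pd_intGerm _ i f), ← SMap.pb_comp,
    ← SMap.pb_comp] at h
  rw [← h]
  simp only [LinearMap.comp_apply, AlgHom.toLinearMap_apply, SMap.pb_od]

lemma Htpy.exact {f g : SMap K' K} (h : Htpy f g) {a : Forms K} (ha : od a = 0) :
    ∃ b, g.pb a = f.pb a + od b := by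
  obtain ⟨J, hJ⟩ := h
  exact ⟨J a, by rw [← sub_eq_iff_eq_add', hJ, ha, map_zero, add_zero]⟩

lemma Htpy.symm {f g : SMap K' K} (h : Htpy f g) : Htpy g f := by
  obtain ⟨J, hJ⟩ := h
  refine ⟨-J, fun a => ?_⟩
  rw [LinearMap.neg_apply, LinearMap.neg_apply, map_neg, ← neg_add, ← hJ, neg_sub]

lemma Htpy.of_segment {f g : SMap K' K}
    (h : ∀ x ∈ K', ∀ s ∈ Set.Icc (0 : ℝ) 1, (1 - s) • f.toFun x + s • g.toFun x ∈ K) :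
    Htpy f g := by
  let H : SMap (cyl K') K :=
    { toFun z := (1 - z none) • f.toFun (fun i => z (some i)) + z none • g.toFun fun i => z (some i)
      smooth := by
        have hp := (cylProj K').smooth
        filter_upwards [(cylProj K').tendsto.eventually f.smooth,
          (cylProj K').tendsto.eventually g.smooth, hp] with z h1 h2 h3
        have h4 : ContDiffAt ℝ ∞ (fun z : Option ι' → ℝ => z none) z :=
          (contDiff_apply ℝ ℝ none).contDiffAt
        exact ((contDiffAt_const.sub h4).smul (h1.comp z h3)).add (h4.smul (h2.comp z h3))
      maps := fun z hz => h _ hz.1 _ hz.2 }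
  have := Htpy.of_cyl H
  have e0 : (H.comp (sliceMap K' 0 zero_mem_unit)).pb = f.pb := by
    refine SMap.pb_congr (Eventually.of_forall fun x => ?_)
    change (1 - (0 : ℝ)) • f.toFun x + (0 : ℝ) • g.toFun x = f.toFun x
    simp
  have e1 : (H.comp (sliceMap K' 1 one_mem_unit)).pb = g.pb := by
    refine SMap.pb_congr (Eventually.of_forall fun x => ?_)
    change (1 - (1 : ℝ)) • f.toFun x + (1 : ℝ) • g.toFun x = g.toFun x
    simp
  unfold Htpy at this
  rw [e0, e1] at this
  exact this

end

end FreeToralRank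

namespace FreeToralRank

open Polynomial

open scoped TensorProduct Topology ContDiff
open Filter

set_option linter.unusedSectionVars false

section

variable {ι : Type} [Fintype ι] [DecidableEq ι]

/-- Restriction of forms. -/
noncomputable def res {K L : Set (ι → ℝ)} (h : K ⊆ L) : Forms L →ₐ[ℂ] Forms K := (SMap.incl h).pb

lemma res_od {K L : Set (ι → ℝ)} (h : K ⊆ L) (a : Forms L) : res h (od a) = od (res h a) :=
  SMap.pb_od _ a

lemma res_opr {K L : Set (ι → ℝ)} (h : K ⊆ L) (m : ℤ) (a : Forms L) :
    res h (opr m a) = opr m (res h a) :=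
  SMap.pb_opr _ m a

lemma res_fn {K L : Set (ι → ℝ)} (h : K ⊆ L) (f : SGerm L) :
    res h (fn f) = fn ((SMap.incl h).germ f) := SMap.pb_fn _ f

lemma res_res {K L M : Set (ι → ℝ)} (h : K ⊆ L) (h' : L ⊆ M) (a : Forms M) :
    res h (res h' a) = res (h.trans h') a := (SMap.pb_comp (SMap.incl h') (SMap.incl h) a).symm

lemma res_self {K : Set (ι → ℝ)} (h : K ⊆ K) (a : Forms K) : res h a = a :=
  SMap.pb_of_eq_id _ EventuallyEq.rfl a

/-- Application of a linear map to the coefficients of a form. -/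
noncomputable def coefMap {F F' : Type} [CommRing F] [Algebra ℂ F] [CommRing F'] [Algebra ℂ F']
    (u : F →ₗ[ℂ] F') : Om ι F →ₗ[ℂ] Om ι F' := TensorProduct.map u LinearMap.id

lemma coefMap_cmap {F F' F'' : Type} [CommRing F] [Algebra ℂ F] [CommRing F'] [Algebra ℂ F']
    [CommRing F''] [Algebra ℂ F''] (u : F →ₗ[ℂ] F') (v : F' →ₗ[ℂ] F'') (a : Om ι F) :
    coefMap v (coefMap u a) = coefMap (v ∘ₗ u) a := by
  refine LinearMap.congr_fun (f := coefMap v ∘ₗ coefMap u) (om_ext fun f w => ?_) a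
  simp [coefMap]

lemma coefMap_mul_left {F : Type} [CommRing F] [Algebra ℂ F] (f : F) (a : Om ι F) :
    coefMap (LinearMap.mulLeft ℂ f) a = fn f * a := by
  refine LinearMap.congr_fun (g := LinearMap.mulLeft ℂ (fn f)) (om_ext fun g w => ?_) a
  simp [coefMap, fn]

lemma coord_incl {K L : Set (ι → ℝ)} (h : K ⊆ L) (i : ι) :
    od (fn ((SMap.incl h).coord i)) = dx i := by
  rw [od_fn, Finset.sum_eq_single i]
  · rw [SMap.coord, pd_germ]
    have : pderivFun i (fun x => (((SMap.incl h).toFun x i : ℝ) : ℂ)) = 1 := by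
      funext x
      exact (pderivFun_coord i i x).trans (if_pos rfl)
    simp only [this, germ_one, fn_one, one_mul]
  · intro j _ hj
    rw [SMap.coord, pd_germ]
    have : pderivFun j (fun x => (((SMap.incl h).toFun x i : ℝ) : ℂ)) = 0 := by
      funext x
      exact (pderivFun_coord i j x).trans (if_neg hj)
    simp only [this, germ_zero, fn_zero, zero_mul]
  · simp

lemma res_eq_coefMap {K L : Set (ι → ℝ)} (h : K ⊆ L) (a : Forms L) :
    res h a = coefMap (SMap.incl h).germ.toLinearMap a := by
  refine AlgHom.congr_fun (φ₁ := res h)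
    (φ₂ := Algebra.TensorProduct.map (SMap.incl h).germ (AlgHom.id ℂ _)) (om_algHom_ext ?_ ?_) a
  · intro f
    rw [res_fn]
    simp [fn]
  · intro i
    rw [res, SMap.pb_dx, coord_incl]
    simp [dx]

/-- Extension by zero of the product with a cutoff function. -/
noncomputable def extz {V V' : Set (ι → ℝ)} (hV : IsOpen V) (hV' : IsOpen V')
    (ρ : (ι → ℝ) → ℂ) (hρ : SmoothNear V' ρ) (h0 : ∀ x ∈ V', x ∉ V → ρ =ᶠ[𝓝 x] 0) :
    SGerm V →ₗ[ℂ] SGerm V' :=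
  germMap (fun f => V.indicator (ρ * f))
    (fun f hf => by
      rw [SmoothNear, hV.nhdsSet_eq, eventually_principal] at hf
      rw [SmoothNear, hV'.nhdsSet_eq, eventually_principal] at hρ ⊢
      intro x hx
      by_cases hxV : x ∈ V
      · refine ((hρ x hx).mul (hf x hxV)).congr_of_eventuallyEq ?_
        filter_upwards [hV.mem_nhds hxV] with y hy
        rw [Set.indicator_of_mem hy]
        rfl
      · refine (contDiffAt_const (c := (0 : ℂ))).congr_of_eventuallyEq ?_
        filter_upwards [h0 x hx hxV] with y hy
        by_cases hyV : y ∈ V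
        · rw [Set.indicator_of_mem hyV, Pi.mul_apply, hy, Pi.zero_apply, zero_mul]
        · rw [Set.indicator_of_notMem hyV])
    (fun f g _ _ e => by
      rw [EventuallyEq, hV.nhdsSet_eq, eventually_principal] at e
      refine Eventually.of_forall fun x => ?_
      by_cases hxV : x ∈ V
      · simp [Set.indicator_of_mem hxV, e x hxV]
      · simp [Set.indicator_of_notMem hxV])
    (fun f g _ _ => by
      rw [mul_add, Set.indicator_add'])
    (fun c f _ => by
      refine Eventually.of_forall fun x => ?_
      by_cases hxV : x ∈ V
      · simp [Set.indicator_of_mem hxV]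
      · simp [Set.indicator_of_notMem hxV])

lemma extz_germ {V V' : Set (ι → ℝ)} (hV : IsOpen V) (hV' : IsOpen V')
    (ρ : (ι → ℝ) → ℂ) (hρ : SmoothNear V' ρ) (h0 : ∀ x ∈ V', x ∉ V → ρ =ᶠ[𝓝 x] 0)
    {f : (ι → ℝ) → ℂ} (hf : SmoothNear V f) : ∃ hs,
    extz hV hV' ρ hρ h0 (germ f hf) = germ (V.indicator (ρ * f)) hs := ⟨_, germMap_germ _ _ _ _ f hf⟩

lemma germ_eq_of_isOpen {V : Set (ι → ℝ)} (hV : IsOpen V) {f g : (ι → ℝ) → ℂ}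
    {hf : SmoothNear V f} {hg : SmoothNear V g} (h : ∀ x ∈ V, f x = g x) : germ f hf = germ g hg := by
  rw [germ_eq, EventuallyEq, hV.nhdsSet_eq, eventually_principal]
  exact h

/-- The Mayer–Vietoris property of forms. -/
structure MV {A B I T : Set (ι → ℝ)} (hA : A ⊆ T) (hB : B ⊆ T) (hIA : I ⊆ A) (hIB : I ⊆ B) :
    Prop where
  inj : ∀ a : Forms T, res hA a = 0 → res hB a = 0 → a = 0
  glue : ∀ a b, res hIA a = res hIB b → ∃ c, res hA c = a ∧ res hB c = b
  surj : ∀ c, ∃ a b, res hIA a - res hIB b = c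

lemma MV.of_cutoff {A B I T : Set (ι → ℝ)} (hA : A ⊆ T) (hB : B ⊆ T) (hIA : I ⊆ A) (hIB : I ⊆ B)
    (oA : IsOpen A) (oB : IsOpen B) (hI : A ∩ B ⊆ I) (hT : T ⊆ A ∪ B) (ρ : (ι → ℝ) → ℂ)
    (hρ : SmoothNear T ρ) (h0 : ∀ x ∈ T, x ∉ A → ρ =ᶠ[𝓝 x] 0)
    (h1 : ∀ x ∈ T, x ∉ B → 1 - ρ =ᶠ[𝓝 x] 0) : MV hA hB hIA hIB := by
  have eT : T = A ∪ B := hT.antisymm (Set.union_subset hA hB)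
  have eI : I = A ∩ B := (Set.subset_inter hIA hIB).antisymm hI
  have oT : IsOpen T := eT ▸ oA.union oB
  have oI : IsOpen I := eI ▸ oA.inter oB
  have hρ' : SmoothNear T (1 - ρ) := (smoothAlg T).sub_mem (smoothAlg T).one_mem hρ
  have mono : ∀ {V : Set (ι → ℝ)} {f}, V ⊆ T → SmoothNear T f → SmoothNear V f :=
    fun h hf => (SMap.incl h).tendsto.eventually hf
  let XA := extz oA oT ρ hρ h0
  let XB := extz oB oT (1 - ρ) hρ' h1
  let YA := extz (V := I) oI oB ρ (mono hB hρ) fun x hx hxI => h0 x (hB hx) fun h => hxI (hI ⟨h, hx⟩)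
  let YB := extz (V := I) oI oA (1 - ρ) (mono hA hρ') fun x hx hxI =>
    h1 x (hA hx) fun h => hxI (hI ⟨hx, h⟩)
  let ρA := germ ρ (mono hA hρ)
  let ρB := germ ρ (mono hB hρ)
  let ρI := germ ρ (mono (hIA.trans hA) hρ)
  have e1 : XA ∘ₗ (SMap.incl hA).germ.toLinearMap + XB ∘ₗ (SMap.incl hB).germ.toLinearMap =
      LinearMap.id := by
    refine LinearMap.ext fun f => ?_
    obtain ⟨f, hf, rfl⟩ := germ_surj f
    simp only [LinearMap.add_apply, LinearMap.comp_apply, AlgHom.toLinearMap_apply, SMap.germ_germ]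
    obtain ⟨s1, q1⟩ := extz_germ oA oT ρ hρ h0 ((SMap.incl hA).smooth_comp hf)
    obtain ⟨s2, q2⟩ := extz_germ oB oT (1 - ρ) hρ' h1 ((SMap.incl hB).smooth_comp hf)
    simp only [XA, XB]
    rw [q1, q2, germ_add, LinearMap.id_apply]
    refine germ_eq_of_isOpen oT fun x hx => ?_
    change A.indicator (ρ * f) x + B.indicator ((1 - ρ) * f) x = f x
    have zA : x ∉ A → ρ x = 0 := fun h => (h0 x hx h).self_of_nhds
    have zB : x ∉ B → (1 - ρ) x = 0 := fun h => (h1 x hx h).self_of_nhds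
    by_cases a1 : x ∈ A <;> by_cases b1 : x ∈ B <;> simp [a1, b1] <;> 
      simp [a1, b1, sub_eq_zero] at zA zB
    · ring
    · simp [← zB]
    · simp [zA]
    · exact absurd (hT hx) (by simp [a1, b1])
  have e2 : (SMap.incl hA).germ.toLinearMap ∘ₗ XA = LinearMap.mulLeft ℂ ρA := by
    refine LinearMap.ext fun f => ?_
    obtain ⟨f, hf, rfl⟩ := germ_surj f
    simp only [LinearMap.comp_apply, AlgHom.toLinearMap_apply, LinearMap.mulLeft_apply]
    obtain ⟨s1, q1⟩ := extz_germ oA oT ρ hρ h0 hf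
    simp only [XA, ρA]
    rw [q1, SMap.germ_germ, germ_mul]
    refine germ_eq_of_isOpen oA fun x hx => ?_
    exact Set.indicator_of_mem hx _
  have e3 : (SMap.incl hB).germ.toLinearMap ∘ₗ XB = LinearMap.mulLeft ℂ (1 - ρB) := by
    refine LinearMap.ext fun f => ?_
    obtain ⟨f, hf, rfl⟩ := germ_surj f
    simp only [LinearMap.comp_apply, AlgHom.toLinearMap_apply, LinearMap.mulLeft_apply]
    obtain ⟨s1, q1⟩ := extz_germ oB oT (1 - ρ) hρ' h1 hf
    simp only [XB, ρB]
    rw [q1, SMap.germ_germ]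
    change _ = germ (1 - ρ) (mono hB hρ') * germ f hf
    rw [germ_mul]
    refine germ_eq_of_isOpen oB fun x hx => ?_
    exact Set.indicator_of_mem hx _
  have e4 : (SMap.incl hA).germ.toLinearMap ∘ₗ XB = YB ∘ₗ (SMap.incl hIB).germ.toLinearMap := by
    refine LinearMap.ext fun f => ?_
    obtain ⟨f, hf, rfl⟩ := germ_surj f
    simp only [LinearMap.comp_apply, AlgHom.toLinearMap_apply, SMap.germ_germ]
    obtain ⟨s1, q1⟩ := extz_germ oB oT (1 - ρ) hρ' h1 hf
    obtain ⟨s2, q2⟩ := extz_germ (V := I) oI oA (1 - ρ) (mono hA hρ') (fun x hx hxI =>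
      h1 x (hA hx) fun h => hxI (hI ⟨hx, h⟩)) ((SMap.incl hIB).smooth_comp hf)
    simp only [XB, YB]
    rw [q1, q2, SMap.germ_germ]
    refine germ_eq_of_isOpen oA fun x hx => ?_
    change B.indicator ((1 - ρ) * f) x = I.indicator ((1 - ρ) * f) x
    by_cases b1 : x ∈ B
    · rw [Set.indicator_of_mem b1, Set.indicator_of_mem (hI ⟨hx, b1⟩)]
    · rw [Set.indicator_of_notMem b1, Set.indicator_of_notMem fun h => b1 (hIB h)]
  have e5 : (SMap.incl hB).germ.toLinearMap ∘ₗ XA = YA ∘ₗ (SMap.incl hIA).germ.toLinearMap := by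
    refine LinearMap.ext fun f => ?_
    obtain ⟨f, hf, rfl⟩ := germ_surj f
    simp only [LinearMap.comp_apply, AlgHom.toLinearMap_apply, SMap.germ_germ]
    obtain ⟨s1, q1⟩ := extz_germ oA oT ρ hρ h0 hf
    obtain ⟨s2, q2⟩ := extz_germ (V := I) oI oB ρ (mono hB hρ) (fun x hx hxI =>
      h0 x (hB hx) fun h => hxI (hI ⟨h, hx⟩)) ((SMap.incl hIA).smooth_comp hf)
    simp only [XA, YA]
    rw [q1, q2, SMap.germ_germ]
    refine germ_eq_of_isOpen oB fun x hx => ?_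
    change A.indicator (ρ * f) x = I.indicator (ρ * f) x
    by_cases b1 : x ∈ A
    · rw [Set.indicator_of_mem b1, Set.indicator_of_mem (hI ⟨b1, hx⟩)]
    · rw [Set.indicator_of_notMem b1, Set.indicator_of_notMem fun h => b1 (hIA h)]
  have e6 : YB ∘ₗ (SMap.incl hIA).germ.toLinearMap = LinearMap.mulLeft ℂ (1 - ρA) := by
    refine LinearMap.ext fun f => ?_
    obtain ⟨f, hf, rfl⟩ := germ_surj f
    simp only [LinearMap.comp_apply, AlgHom.toLinearMap_apply, SMap.germ_germ,
      LinearMap.mulLeft_apply]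
    obtain ⟨s2, q2⟩ := extz_germ (V := I) oI oA (1 - ρ) (mono hA hρ') (fun x hx hxI =>
      h1 x (hA hx) fun h => hxI (hI ⟨hx, h⟩)) ((SMap.incl hIA).smooth_comp hf)
    simp only [YB, ρA]
    rw [q2]
    change _ = germ (1 - ρ) (mono hA hρ') * germ f hf
    rw [germ_mul]
    refine germ_eq_of_isOpen oA fun x hx => ?_
    change I.indicator ((1 - ρ) * f) x = ((1 - ρ) * f) x
    by_cases b1 : x ∈ B
    · rw [Set.indicator_of_mem (hI ⟨hx, b1⟩)]
    · rw [Set.indicator_of_notMem fun h => b1 (hIB h), Pi.mul_apply,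
        (h1 x (hA hx) b1).self_of_nhds, Pi.zero_apply, zero_mul]
  have e7 : YA ∘ₗ (SMap.incl hIB).germ.toLinearMap = LinearMap.mulLeft ℂ ρB := by
    refine LinearMap.ext fun f => ?_
    obtain ⟨f, hf, rfl⟩ := germ_surj f
    simp only [LinearMap.comp_apply, AlgHom.toLinearMap_apply, SMap.germ_germ,
      LinearMap.mulLeft_apply]
    obtain ⟨s2, q2⟩ := extz_germ (V := I) oI oB ρ (mono hB hρ) (fun x hx hxI =>
      h0 x (hB hx) fun h => hxI (hI ⟨h, hx⟩)) ((SMap.incl hIB).smooth_comp hf)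
    simp only [YA, ρB]
    rw [q2, germ_mul]
    refine germ_eq_of_isOpen oB fun x hx => ?_
    change I.indicator (ρ * f) x = (ρ * f) x
    by_cases b1 : x ∈ A
    · rw [Set.indicator_of_mem (hI ⟨b1, hx⟩)]
    · rw [Set.indicator_of_notMem fun h => b1 (hIA h), Pi.mul_apply,
        (h0 x (hB hx) b1).self_of_nhds, Pi.zero_apply, zero_mul]
  have e8 : (SMap.incl hIA).germ.toLinearMap ∘ₗ YB + (SMap.incl hIB).germ.toLinearMap ∘ₗ YA =
      LinearMap.id := by
    refine LinearMap.ext fun f => ?_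
    obtain ⟨f, hf, rfl⟩ := germ_surj f
    simp only [LinearMap.add_apply, LinearMap.comp_apply, AlgHom.toLinearMap_apply]
    obtain ⟨s1, q1⟩ := extz_germ (V := I) oI oB ρ (mono hB hρ) (fun x hx hxI =>
      h0 x (hB hx) fun h => hxI (hI ⟨h, hx⟩)) hf
    obtain ⟨s2, q2⟩ := extz_germ (V := I) oI oA (1 - ρ) (mono hA hρ') (fun x hx hxI =>
      h1 x (hA hx) fun h => hxI (hI ⟨hx, h⟩)) hf
    simp only [YA, YB]
    rw [q1, q2, SMap.germ_germ, SMap.germ_germ, germ_add, LinearMap.id_apply]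
    refine germ_eq_of_isOpen oI fun x hx => ?_
    change I.indicator ((1 - ρ) * f) x + I.indicator (ρ * f) x = f x
    rw [Set.indicator_of_mem hx, Set.indicator_of_mem hx]
    simp only [Pi.mul_apply, Pi.sub_apply, Pi.one_apply]
    ring
  have cadd : ∀ {F F' : Type} [CommRing F] [Algebra ℂ F] [CommRing F'] [Algebra ℂ F']
      (u v : F →ₗ[ℂ] F') (a : Om ι F), coefMap (u + v) a = coefMap u a + coefMap v a := by
    intro F F' _ _ _ _ u v a
    simp [coefMap, TensorProduct.map_add_left]
  have cid : ∀ {F : Type} [CommRing F] [Algebra ℂ F] (a : Om ι F),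
      coefMap (LinearMap.id : F →ₗ[ℂ] F) a = a := by
    intro F _ _ a
    simp [coefMap]
  refine ⟨fun a ha hb => ?_, fun a b h => ⟨coefMap XA a + coefMap XB b, ?_, ?_⟩,
    fun c => ⟨coefMap YB c, -coefMap YA c, ?_⟩⟩
  · rw [res_eq_coefMap] at ha hb
    have := cid a
    rw [← e1, cadd, ← coefMap_cmap, ← coefMap_cmap, ha, hb, map_zero, map_zero, add_zero] at this
    exact this.symm
  · rw [res_eq_coefMap, res_eq_coefMap] at h
    rw [map_add, res_eq_coefMap, res_eq_coefMap, coefMap_cmap, coefMap_cmap, e2, e4, ← coefMap_cmap, ← h, coefMap_cmap,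
      e6, coefMap_mul_left, coefMap_mul_left, ← add_mul, ← fn_add, add_sub_cancel, fn_one, one_mul]
  · rw [res_eq_coefMap, res_eq_coefMap] at h
    rw [map_add, res_eq_coefMap, res_eq_coefMap, coefMap_cmap, coefMap_cmap, e3, e5, ← coefMap_cmap, h, coefMap_cmap,
      e7, coefMap_mul_left, coefMap_mul_left, ← add_mul, ← fn_add, add_sub_cancel, fn_one, one_mul]
  · rw [map_neg, sub_neg_eq_add, res_eq_coefMap, res_eq_coefMap, coefMap_cmap, coefMap_cmap, ← cadd, e8, cid]

end

end FreeToralRank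

namespace FreeToralRank

open Polynomial

open scoped TensorProduct Topology ContDiff
open Filter

set_option linter.unusedSectionVars false

section

variable {ι : Type} [Fintype ι] [DecidableEq ι]

/-- The points with a nonzero coordinate among the first `m` coordinates of a block. -/
def blockSet (c : ℕ → ι) (m : ℕ) (U : Set (ι → ℝ)) : Set (ι → ℝ) :=
  {x | x ∈ U ∧ ∃ j, j < m ∧ x (c j) ≠ 0}

/-- The points of `blockSet` together with a half space of the next coordinate. -/
def halfSet (c : ℕ → ι) (ε : ℝ) (m : ℕ) (U : Set (ι → ℝ)) : Set (ι → ℝ) :=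
  {x | x ∈ U ∧ ((∃ j, j < m ∧ x (c j) ≠ 0) ∨ 0 < ε * x (c m))}

/-- Open sets that are invariant under changes of some coordinates. -/
structure BlockInv (c : ℕ → ι) (n : ℕ) (U : Set (ι → ℝ)) : Prop where
  isOpen : IsOpen U
  update : ∀ x ∈ U, ∀ j, j ≤ n → ∀ t, Function.update x (c j) t ∈ U

variable {c : ℕ → ι} {n m : ℕ} {U : Set (ι → ℝ)} {ε : ℝ}

lemma BlockInv.univ (c : ℕ → ι) (n : ℕ) : BlockInv c n Set.univ :=
  ⟨isOpen_univ, fun _ _ _ _ _ => trivial⟩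

lemma blockSet_subset : blockSet c m U ⊆ U := fun _ h => h.1

lemma halfSet_subset : halfSet c ε m U ⊆ U := fun _ h => h.1

lemma blockSet_subset_half : blockSet c m U ⊆ halfSet c ε m U := fun _ h => ⟨h.1, Or.inl h.2⟩

lemma halfSet_subset_succ : halfSet c ε m U ⊆ blockSet c (m + 1) U := by
  rintro x ⟨hx, ⟨j, hj, h⟩ | h⟩
  · exact ⟨hx, j, hj.trans (Nat.lt_succ_self m), h⟩
  · exact ⟨hx, m, Nat.lt_succ_self m, fun e => by simp [e] at h⟩

lemma blockSet_mono {V : Set (ι → ℝ)} (h : U ⊆ V) : blockSet c m U ⊆ blockSet c m V :=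
  fun _ hx => ⟨h hx.1, hx.2⟩

lemma halfSet_mono {V : Set (ι → ℝ)} (h : U ⊆ V) : halfSet c ε m U ⊆ halfSet c ε m V :=
  fun _ hx => ⟨h hx.1, hx.2⟩

lemma isOpen_block (c : ℕ → ι) (m : ℕ) : IsOpen {x : ι → ℝ | ∃ j, j < m ∧ x (c j) ≠ 0} := by
  have : {x : ι → ℝ | ∃ j, j < m ∧ x (c j) ≠ 0} = ⋃ j, ⋃ (_ : j < m), {x | x (c j) ≠ 0} := by
    ext x
    simp
  rw [this]
  exact isOpen_iUnion fun j => isOpen_iUnion fun _ =>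
    isOpen_ne_fun (continuous_apply _) continuous_const

lemma blockSet_open (hU : IsOpen U) : IsOpen (blockSet c m U) := hU.inter (isOpen_block c m)

lemma halfSet_open (hU : IsOpen U) : IsOpen (halfSet c ε m U) :=
  hU.inter ((isOpen_block c m).union
    (isOpen_lt continuous_const (continuous_const.mul (continuous_apply _))))

/-- The cutoff function separating the two half sets. -/
noncomputable def halfCut (c : ℕ → ι) (m : ℕ) (x : ι → ℝ) : ℂ :=
  (Real.smoothTransition (x (c m) / √(∑ j ∈ Finset.range (m + 1), x (c j) ^ 2) + 1 / 2) : ℝ)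

lemma block_sum_pos {x : ι → ℝ} (h : ∃ j, j < m + 1 ∧ x (c j) ≠ 0) :
    0 < ∑ j ∈ Finset.range (m + 1), x (c j) ^ 2 := by
  obtain ⟨j, hj, h⟩ := h
  exact Finset.sum_pos' (fun _ _ => sq_nonneg _) ⟨j, Finset.mem_range.2 hj, by positivity⟩

lemma halfCut_smooth {x : ι → ℝ} (h : ∃ j, j < m + 1 ∧ x (c j) ≠ 0) :
    ContDiffAt ℝ ∞ (halfCut c m) x := by
  have h1 : ContDiffAt ℝ ∞ (fun x : ι → ℝ => ∑ j ∈ Finset.range (m + 1), x (c j) ^ 2) x :=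
    ContDiffAt.sum fun j _ => (contDiff_apply ℝ ℝ (c j)).contDiffAt.pow 2
  have h2 := (h1.sqrt (block_sum_pos h).ne')
  have h3 : ContDiffAt ℝ ∞ (fun x : ι → ℝ => x (c m) / √(∑ j ∈ Finset.range (m + 1), x (c j) ^ 2)) x :=
    (contDiff_apply ℝ ℝ (c m)).contDiffAt.div h2 (Real.sqrt_pos.2 (block_sum_pos h)).ne'
  have h4 : ContDiffAt ℝ ∞ (fun x : ι → ℝ => x (c m) / √(∑ j ∈ Finset.range (m + 1), x (c j) ^ 2)
      + 1 / 2) x := h3.add contDiffAt_const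
  exact Complex.ofRealCLM.contDiff.contDiffAt.comp x
    ((Real.smoothTransition.contDiff (n := ⊤)).contDiffAt.comp x h4)

lemma halfCut_arg {x : ι → ℝ} (h : ∀ j, j < m → x (c j) = 0) :
    x (c m) / √(∑ j ∈ Finset.range (m + 1), x (c j) ^ 2) = x (c m) / |x (c m)| := by
  rw [Finset.sum_range_succ, Finset.sum_eq_zero, zero_add, Real.sqrt_sq_eq_abs]
  intro j hj
  rw [h j (Finset.mem_range.1 hj)]
  simp

lemma halfCut_cont {x : ι → ℝ} (h : ∃ j, j < m + 1 ∧ x (c j) ≠ 0) :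
    ContinuousAt (fun x : ι → ℝ => x (c m) / √(∑ j ∈ Finset.range (m + 1), x (c j) ^ 2)) x := by
  refine ContinuousAt.div (continuous_apply (c m)).continuousAt
    (Continuous.continuousAt (Real.continuous_sqrt.comp (continuous_finsetSum _ fun j _ =>
      (continuous_apply (c j)).pow 2))) (Real.sqrt_pos.2 (block_sum_pos h)).ne'

lemma mv_half (hU : IsOpen U) :
    MV (halfSet_subset_succ (c := c) (ε := 1) (m := m) (U := U))
      (halfSet_subset_succ (c := c) (ε := -1) (m := m) (U := U))
      blockSet_subset_half blockSet_subset_half := by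
  refine MV.of_cutoff _ _ _ _ (halfSet_open hU) (halfSet_open hU) ?_ ?_ (halfCut c m) ?_ ?_ ?_
  · rintro x ⟨⟨hx, h1 | h1⟩, ⟨-, h2 | h2⟩⟩
    · exact ⟨hx, h1⟩
    · exact ⟨hx, h1⟩
    · exact ⟨hx, h2⟩
    · linarith
  · rintro x ⟨hx, j, hj, h⟩
    rcases Nat.lt_succ_iff_lt_or_eq.1 hj with hj | rfl
    · exact Or.inl ⟨hx, Or.inl ⟨j, hj, h⟩⟩
    · rcases lt_or_gt_of_ne h with h | h
      · exact Or.inr ⟨hx, Or.inr (by linarith)⟩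
      · exact Or.inl ⟨hx, Or.inr (by linarith)⟩
  · rw [SmoothNear, (blockSet_open hU).nhdsSet_eq, eventually_principal]
    exact fun x hx => halfCut_smooth hx.2
  · rintro x ⟨hx, h⟩ hn
    have hz : ∀ j, j < m → x (c j) = 0 := fun j hj => by
      by_contra h0
      exact hn ⟨hx, Or.inl ⟨j, hj, h0⟩⟩
    have hneg : x (c m) < 0 := by
      obtain ⟨j, hj, h0⟩ := h
      rcases Nat.lt_succ_iff_lt_or_eq.1 hj with hj | rfl
      · exact absurd (hz j hj) h0
      · exact lt_of_le_of_ne (not_lt.1 fun h => hn ⟨hx, Or.inr (by linarith)⟩) h0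
    have hc := (halfCut_cont h).tendsto
    rw [halfCut_arg hz, abs_of_neg hneg, div_neg, div_self hneg.ne] at hc
    filter_upwards [hc.eventually (gt_mem_nhds (show (-1 : ℝ) < -(1 / 2) by norm_num))] with y hy
    rw [halfCut, Real.smoothTransition.zero_of_nonpos (by linarith)]
    simp
  · rintro x ⟨hx, h⟩ hn
    have hz : ∀ j, j < m → x (c j) = 0 := fun j hj => by
      by_contra h0
      exact hn ⟨hx, Or.inl ⟨j, hj, h0⟩⟩
    have hpos : 0 < x (c m) := by
      obtain ⟨j, hj, h0⟩ := h
      rcases Nat.lt_succ_iff_lt_or_eq.1 hj with hj | rfl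
      · exact absurd (hz j hj) h0
      · exact lt_of_le_of_ne (not_lt.1 fun h => hn ⟨hx, Or.inr (by linarith)⟩) h0.symm
    have hc := (halfCut_cont h).tendsto
    rw [halfCut_arg hz, abs_of_pos hpos, div_self hpos.ne'] at hc
    filter_upwards [hc.eventually (lt_mem_nhds (show (1 / 2 : ℝ) < 1 by norm_num))] with y hy
    rw [Pi.sub_apply, halfCut, Real.smoothTransition.one_of_one_le (by linarith)]
    simp

/-- The retraction of `U` to a half set up to homotopy. -/
def pushMap (hU : BlockInv c n U) (hm : m ≤ n)
    (ε : ℝ) (hε : 0 < ε * ε) : SMap U (halfSet c ε m U) where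
  toFun x := Function.update x (c m) ε
  smooth := Eventually.of_forall fun x => by
    refine contDiffAt_pi.2 fun i => ?_
    by_cases h : i = c m
    · subst h
      simp only [Function.update_self]
      exact contDiffAt_const
    · simp only [Function.update_of_ne h]
      exact (contDiff_apply ℝ ℝ i).contDiffAt
  maps x hx := ⟨hU.update x hx m hm ε, Or.inr (by simpa using hε)⟩

lemma update_segment (x : ι → ℝ) (i : ι) (t s : ℝ) :
    (1 - s) • x + s • Function.update x i t = Function.update x i ((1 - s) * x i + s * t) := by
  funext j
  by_cases h : j = i
  · subst h
    simp
  · simp [h]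
    ring

lemma half_span (hc : ∀ i ≤ n, ∀ j ≤ n, c i = c j → i = j) (hU : BlockInv c n U) (hm : m ≤ n)
    (hε : 0 < ε * ε) (a : Forms (halfSet c ε m U)) (ha : od a = 0) :
    ∃ o b, od o = 0 ∧ a = res halfSet_subset o + od b := by
  have h : Htpy (SMap.incl subset_rfl)
      ((pushMap hU hm ε hε).comp (SMap.incl (halfSet_subset (c := c) (ε := ε) (m := m)))) := by
    refine Htpy.of_segment fun x hx s hs => ?_
    change (1 - s) • x + s • Function.update x (c m) ε ∈ _
    rw [update_segment]
    refine ⟨hU.update _ hx.1 m hm _, ?_⟩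
    rcases hx.2 with ⟨j, hj, h⟩ | h
    · refine Or.inl ⟨j, hj, ?_⟩
      rwa [Function.update_of_ne fun e => hj.ne (hc _ (hj.le.trans hm) _ hm e)]
    · refine Or.inr ?_
      rw [Function.update_self]
      rcases hs.1.eq_or_lt with rfl | h0
      · simpa using h
      · nlinarith [mul_nonneg (sub_nonneg.2 hs.2) h.le, mul_pos h0 hε]
  obtain ⟨b, hb⟩ := h.symm.exact ha
  refine ⟨(pushMap hU hm ε hε).pb a, b, ?_, ?_⟩
  · rw [← SMap.pb_od, ha, map_zero]
  · rw [SMap.pb_comp] at hb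
    exact (res_self subset_rfl a).symm.trans hb

lemma half_ind (hU : BlockInv c n U) (hm : m ≤ n)
    (hε : 0 < ε * ε) (o : Forms U) (ho : od o = 0) (b : Forms (halfSet c ε m U))
    (h : res halfSet_subset o = od b) : ∃ b', o = od b' := by
  have h1 : Htpy (SMap.incl subset_rfl)
      ((SMap.incl (halfSet_subset (c := c) (ε := ε) (m := m))).comp (pushMap hU hm ε hε)) := by
    refine Htpy.of_segment fun x hx s hs => ?_
    change (1 - s) • x + s • Function.update x (c m) ε ∈ _
    rw [update_segment]
    exact hU.update _ hx m hm _
  obtain ⟨b', hb⟩ := h1.symm.exact ho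
  refine ⟨(pushMap hU hm ε hε).pb b + b', ?_⟩
  rw [SMap.pb_comp] at hb
  change (res _ o) = SMap.pb _ (res _ o) + _ at hb
  rw [h, res_self, SMap.pb_od] at hb
  rw [map_add, hb]

/-- `w` generates the cohomology of `blockSet c m U` over the cohomology of `U`. -/
structure BlockGen (c : ℕ → ι) (m n : ℕ) (w : Forms (blockSet c m Set.univ)) : Prop where
  homog : opr ((m : ℤ) - 1) w = w
  closed : od w = 0
  span : ∀ U (_ : BlockInv c n U) (a : Forms (blockSet c m U)), od a = 0 → ∃ (o1 o2 : Forms U), ∃ b,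
    od o1 = 0 ∧ od o2 = 0 ∧ a = res blockSet_subset o1 +
      res (blockSet_mono (Set.subset_univ U)) w * res blockSet_subset o2 + od b
  ind : ∀ U (_ : BlockInv c n U) (o1 o2 : Forms U) b, od o1 = 0 → od o2 = 0 →
    res blockSet_subset o1 +
      res (blockSet_mono (Set.subset_univ U)) w * res blockSet_subset o2 = od b →
    (∃ b', o1 = od b') ∧ ∃ b', o2 = od b'

lemma MV.glue_ext {A B I T : Set (ι → ℝ)} {hA : A ⊆ T} {hB : B ⊆ T} {hIA : I ⊆ A} {hIB : I ⊆ B}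
    (h : MV hA hB hIA hIB) {a b : Forms T} (h1 : res hA a = res hA b) (h2 : res hB a = res hB b) :
    a = b :=
  sub_eq_zero.1 (h.inj _ (by rw [map_sub, h1, sub_self]) (by rw [map_sub, h2, sub_self]))

lemma forms_empty (a : Forms (∅ : Set (ι → ℝ))) : a = 0 := by
  have h : (1 : SGerm (∅ : Set (ι → ℝ))) = 0 := by
    rw [← germ_one, ← germ_zero, germ_eq, EventuallyEq, nhdsSet_empty]
    exact eventually_bot
  rw [← one_mul a, ← fn_one, h, fn_zero, zero_mul]

lemma blockSet_zero : blockSet c 0 U = ∅ := by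
  ext x
  simp [blockSet]

lemma forms_blockSet_zero (a : Forms (blockSet c 0 U)) : a = 0 := by
  rw [← res_self subset_rfl a, ← res_res (K := blockSet c 0 U) (L := ∅) blockSet_zero.subset
    blockSet_zero.superset, forms_empty (res _ a), map_zero]

lemma od_one {F : Type} [CommRing F] [Algebra ℂ F] [DiffRing ι F] : od (1 : Om ι F) = 0 :=
  (deRham_D 0 1).symm.trans (deRham.D_one 0)

lemma blockGen_one (hc : ∀ i ≤ n, ∀ j ≤ n, c i = c j → i = j) : ∃ w, BlockGen c 1 n w := by
  obtain ⟨w, w1, w2⟩ := (mv_half (c := c) (m := 0) (isOpen_univ)).glue 1 0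
    ((forms_blockSet_zero _).trans (forms_blockSet_zero _).symm)
  have hw1 : ∀ U, res (halfSet_subset_succ (ε := 1) (U := U)) (res (blockSet_mono (Set.subset_univ U)) w) = 1 := by
    intro U
    rw [res_res, ← res_res (halfSet_mono (Set.subset_univ U)) halfSet_subset_succ, w1, map_one]
  have hw2 : ∀ U, res (halfSet_subset_succ (ε := -1) (U := U)) (res (blockSet_mono (Set.subset_univ U)) w) = 0 := by
    intro U
    rw [res_res, ← res_res (halfSet_mono (Set.subset_univ U)) halfSet_subset_succ, w2, map_zero]
  have mv0 := mv_half (c := c) (m := 0) isOpen_univ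
  refine ⟨w, mv0.glue_ext ?_ ?_, mv0.glue_ext ?_ ?_, ?_, ?_⟩
  · rw [res_opr, w1, Nat.cast_one, sub_self, opr_one]
  · rw [res_opr, w2, map_zero]
  · rw [res_od, w1, od_one, map_zero]
  · rw [res_od, w2, map_zero, map_zero]
  · intro U hU a ha
    have mv := mv_half (c := c) (m := 0) hU.isOpen
    obtain ⟨op, bp, hop, ep⟩ := half_span hc hU (Nat.zero_le n) (ε := 1) (by norm_num)
      (res halfSet_subset_succ a) (by rw [← res_od, ha, map_zero])
    obtain ⟨om, bm, hom, em⟩ := half_span hc hU (Nat.zero_le n) (ε := -1) (by norm_num)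
      (res halfSet_subset_succ a) (by rw [← res_od, ha, map_zero])
    obtain ⟨b, b1, b2⟩ := mv.glue bp bm ((forms_blockSet_zero _).trans (forms_blockSet_zero _).symm)
    refine ⟨om, op - om, b, hom, by rw [map_sub, hop, hom, sub_zero], mv.glue_ext ?_ ?_⟩
    · rw [ep, map_add, map_add, map_mul, hw1, res_res, res_res, res_od, b1, one_mul, map_sub]
      abel
    · rw [em, map_add, map_add, map_mul, hw2, res_res, res_res, res_od, b2, zero_mul, add_zero]
  · intro U hU o1 o2 b h1 h2 h
    have ep := congrArg (res (halfSet_subset_succ (ε := 1))) h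
    have em := congrArg (res (halfSet_subset_succ (ε := -1))) h
    rw [map_add, map_mul, hw1, res_res, res_res, res_od, one_mul, ← map_add] at ep
    rw [map_add, map_mul, hw2, res_res, res_res, res_od, zero_mul, add_zero] at em
    obtain ⟨q1, e1⟩ := half_ind hU (Nat.zero_le n) (by norm_num) _
      (by rw [map_add, h1, h2, add_zero]) _ ep
    obtain ⟨q2, e2⟩ := half_ind hU (Nat.zero_le n) (by norm_num) _ h1 _ em
    exact ⟨⟨q2, e2⟩, q1 - q2, by rw [map_sub, ← e1, ← e2, add_sub_cancel_left]⟩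

lemma blockGen_succ (hc : ∀ i ≤ n, ∀ j ≤ n, c i = c j → i = j) (hm : m ≤ n)
    (h : ∃ w, BlockGen c m n w) : ∃ w, BlockGen c (m + 1) n w := by
  obtain ⟨w, hw⟩ := h
  have mv0 := mv_half (c := c) (m := m) isOpen_univ
  obtain ⟨α, β, hαβ⟩ : ∃ α β, opr ((m : ℤ) - 1) α = α ∧ opr ((m : ℤ) - 1) β = β ∧
      res (blockSet_subset_half (ε := 1)) α - res (blockSet_subset_half (ε := -1)) β = w := by
    obtain ⟨α, β, e⟩ := mv0.surj w
    refine ⟨opr ((m : ℤ) - 1) α, opr ((m : ℤ) - 1) β, (opr_opr _ _ _).trans (if_pos rfl),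
      (opr_opr _ _ _).trans (if_pos rfl), ?_⟩
    rw [res_opr, res_opr, ← map_sub, e, hw.homog]
  obtain ⟨hα, hβ, e⟩ := hαβ
  obtain ⟨w', w1, w2⟩ := mv0.glue (od α) (od β) (by
    rw [res_od, res_od, ← sub_eq_zero, ← map_sub, e, hw.closed])
  have hw1 : ∀ U, res (halfSet_subset_succ (ε := 1) (U := U)) (res (blockSet_mono (Set.subset_univ U)) w') =
      od (res (halfSet_mono (Set.subset_univ U)) α) := by
    intro U
    rw [res_res, ← res_res (halfSet_mono (Set.subset_univ U)) halfSet_subset_succ, w1, res_od]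
  have hw2 : ∀ U, res (halfSet_subset_succ (ε := -1) (U := U)) (res (blockSet_mono (Set.subset_univ U)) w') =
      od (res (halfSet_mono (Set.subset_univ U)) β) := by
    intro U
    rw [res_res, ← res_res (halfSet_mono (Set.subset_univ U)) halfSet_subset_succ, w2, res_od]
  have e' : ∀ U, res (blockSet_subset_half (U := U)) (res (halfSet_mono (Set.subset_univ U)) α) =
      res blockSet_subset_half (res (halfSet_mono (Set.subset_univ U)) β) +
      res (blockSet_mono (Set.subset_univ U)) w := by
    intro U
    rw [res_res, res_res, ← e, map_sub, res_res, res_res, add_sub_cancel]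
  refine ⟨w', mv0.glue_ext ?_ ?_, mv0.glue_ext ?_ ?_, ?_, ?_⟩
  · rw [res_opr, w1, Nat.cast_succ, add_sub_cancel_right, ← hα, od_opr, sub_add_cancel, opr_opr,
      if_pos rfl]
  · rw [res_opr, w2, Nat.cast_succ, add_sub_cancel_right, ← hβ, od_opr, sub_add_cancel, opr_opr,
      if_pos rfl]
  · rw [res_od, w1, od_od, map_zero]
  · rw [res_od, w2, od_od, map_zero]
  · intro U hU a ha
    have mv := mv_half (c := c) (m := m) hU.isOpen
    obtain ⟨op, bp, hop, ep⟩ := half_span hc hU hm (ε := 1) (by norm_num)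
      (res halfSet_subset_succ a) (by rw [← res_od, ha, map_zero])
    obtain ⟨om, bm, hom, em⟩ := half_span hc hU hm (ε := -1) (by norm_num)
      (res halfSet_subset_succ a) (by rw [← res_od, ha, map_zero])
    have hs : res (blockSet_subset_half (ε := 1)) (res halfSet_subset_succ a) =
        res (blockSet_subset_half (ε := -1)) (res halfSet_subset_succ a) := by
      rw [res_res, res_res]
    have hd : res blockSet_subset (op - om) = od (res blockSet_subset_half bm -
        res blockSet_subset_half bp) := by
      rw [ep, em, map_add, map_add, res_res, res_res, res_od, res_od] at hs
      rw [map_sub, map_sub, sub_eq_sub_iff_add_eq_add, hs, add_comm]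
    obtain ⟨⟨q, hq⟩, -⟩ := hw.ind U hU (op - om) 0 _ (by rw [map_sub, hop, hom, sub_zero])
      (map_zero _) (by rw [map_zero, mul_zero, add_zero, hd])
    set bm' := bm - res halfSet_subset q with hbm
    have em' : res halfSet_subset_succ a = res halfSet_subset op + od bm' := by
      rw [em, hbm, map_sub, ← res_od, ← hq, map_sub]
      abel
    rw [ep, em', map_add, map_add, res_res, res_res, add_right_inj, res_od, res_od] at hs
    obtain ⟨o1, o2, z, h1, h2, hz⟩ := hw.span U hU (res blockSet_subset_half bp -
      res blockSet_subset_half bm') (by rw [map_sub, hs, sub_self])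
    obtain ⟨zp, zm, hz'⟩ := mv.surj z
    obtain ⟨B, B1, B2⟩ := mv.glue
      (bp - res halfSet_subset o1 - res (halfSet_mono (Set.subset_univ U)) α *
        res halfSet_subset o2 - od zp)
      (bm' - res (halfSet_mono (Set.subset_univ U)) β * res halfSet_subset o2 - od zm) (by
        rw [sub_eq_iff_eq_add] at hz hz'
        simp only [map_sub, map_mul, res_res, res_od]
        simp only [hz, hz', map_add]
        have := e' U
        rw [res_res, res_res] at this
        rw [this]
        noncomm_ring)
    refine ⟨op, o2, B, hop, h2, mv.glue_ext ?_ ?_⟩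
    · rw [ep, map_add, map_add, map_mul, hw1, res_res, res_res, res_od, B1]
      simp only [map_sub, od_mul, od_od, ← res_od, h1, h2, map_zero]
      noncomm_ring
    · rw [em', map_add, map_add, map_mul, hw2, res_res, res_res, res_od, B2]
      simp only [map_sub, od_mul, od_od, ← res_od, h2, map_zero]
      noncomm_ring
  · intro U hU o1 o2 b h1 h2 h
    have mv := mv_half (c := c) (m := m) hU.isOpen
    have ep := congrArg (res (halfSet_subset_succ (ε := 1))) h
    rw [map_add, map_mul, hw1, res_res, res_res, res_od] at ep
    obtain ⟨q, hq⟩ := half_ind hU hm (by norm_num) o1 h1 (res halfSet_subset_succ b -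
      res (halfSet_mono (Set.subset_univ U)) α * res halfSet_subset o2) (by
        rw [map_sub, od_mul, ← ep, ← res_od _ o2, h2, map_zero, mul_zero, add_zero,
          add_sub_cancel_right])
    refine ⟨⟨q, hq⟩, ?_⟩
    set b' := b - res blockSet_subset q with hb'
    have h' : res (blockSet_mono (Set.subset_univ U)) w' * res blockSet_subset o2 = od b' := by
      rw [hb', map_sub, ← res_od, ← hq, ← h, add_sub_cancel_left]
    have ep' := congrArg (res (halfSet_subset_succ (ε := 1))) h'
    have em' := congrArg (res (halfSet_subset_succ (ε := -1))) h'
    rw [map_mul, hw1, res_res, res_od] at ep'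
    rw [map_mul, hw2, res_res, res_od] at em'
    obtain ⟨op, cp, hop, kp⟩ := half_span hc hU hm (ε := 1) (by norm_num)
      (res halfSet_subset_succ b' - res (halfSet_mono (Set.subset_univ U)) α * res halfSet_subset o2)
      (by rw [map_sub, od_mul, ← ep', ← res_od _ o2, h2, map_zero, mul_zero, add_zero, sub_self])
    obtain ⟨om, cm, hom, km⟩ := half_span hc hU hm (ε := -1) (by norm_num)
      (res halfSet_subset_succ b' - res (halfSet_mono (Set.subset_univ U)) β * res halfSet_subset o2)
      (by rw [map_sub, od_mul, ← em', ← res_od _ o2, h2, map_zero, mul_zero, add_zero, sub_self])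
    have rp := congrArg (res (blockSet_subset_half (ε := 1))) kp
    have rm := congrArg (res (blockSet_subset_half (ε := -1))) km
    rw [map_sub, map_mul, e', map_add, res_res, res_res _ _ o2, res_res _ _ op, res_od] at rp
    rw [map_sub, map_mul, map_add, res_res, res_res _ _ o2, res_res _ _ om, res_od] at rm
    refine (hw.ind U hU (op - om) o2 (res blockSet_subset_half cm - res blockSet_subset_half cp)
      (by rw [map_sub, hop, hom, sub_zero]) h2 ?_).2
    rw [map_sub, map_sub, ← sub_eq_of_eq_add' rp, ← sub_eq_of_eq_add' rm]
    noncomm_ring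

end

end FreeToralRank

namespace FreeToralRank

open Polynomial

open scoped TensorProduct Topology ContDiff
open Filter

set_option linter.unusedSectionVars false

section

variable {ι : Type} [Fintype ι] [DecidableEq ι] {c : ℕ → ι} {n : ℕ} {U : Set (ι → ℝ)}

lemma blockGen_exists (hc : ∀ i ≤ n, ∀ j ≤ n, c i = c j → i = j) :
    ∃ w, BlockGen c (n + 1) n w := by
  have : ∀ m ≤ n, ∃ w, BlockGen c (m + 1) n w := by
    intro m
    induction m with
    | zero => exact fun _ => blockGen_one hc
    | succ m ih => exact fun hm => blockGen_succ hc hm (ih (Nat.le_of_succ_le hm))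
  exact this n le_rfl

lemma forms_nontrivial (hU : U.Nonempty) : Nontrivial (Forms U) := by
  obtain ⟨x, hx⟩ := hU
  have : Nontrivial (SGerm U) := by
    refine ⟨1, 0, fun h => ?_⟩
    rw [← germ_one, ← germ_zero, germ_eq] at h
    exact one_ne_zero ((eventually_nhdsSet_iff_forall.1 h x hx).self_of_nhds)
  exact (Algebra.TensorProduct.lift (AlgHom.id ℂ (SGerm U))
    ((Algebra.ofId ℂ (SGerm U)).comp ExteriorAlgebra.algebraMapInv)
    fun _ _ => Commute.all _ _).toRingHom.domain_nontrivial

lemma const_exact (hU : U.Nonempty) (z : ℂ) (b : Forms U)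
    (h : algebraMap ℂ (Forms U) z = od b) : z = 0 := by
  have := forms_nontrivial hU
  have h1 := congrArg (opr 0) h
  rw [Algebra.algebraMap_eq_smul_one, map_smul, opr_one, show (0 : ℤ) = -1 + 1 by norm_num,
    ← od_opr, opr_neg (by norm_num), map_zero, ← Algebra.algebraMap_eq_smul_one] at h1
  exact (algebraMap ℂ (Forms U)).injective (h1.trans (map_zero _).symm)

/-- The Poincaré lemma. -/
lemma univ_span (a : Forms (Set.univ : Set (ι → ℝ))) (ha : od a = 0) :
    ∃ z b, a = algebraMap ℂ _ z + od b := by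
  let k : SMap (Set.univ : Set (ι → ℝ)) (Set.univ : Set (ι → ℝ)) :=
    ⟨fun _ => 0, Eventually.of_forall fun _ => contDiffAt_const, fun _ _ => trivial⟩
  obtain ⟨b, hb⟩ := Htpy.exact (f := k) (g := SMap.incl subset_rfl)
    (Htpy.of_segment fun _ _ _ _ => trivial) ha
  have h : ∀ a, k.pb a ∈ (⊥ : Subalgebra ℂ (Forms (Set.univ : Set (ι → ℝ)))) := by
    intro a
    induction a using om_induction with
    | hfn f =>
      obtain ⟨f, hf, rfl⟩ := germ_surj f
      rw [SMap.pb_fn, SMap.germ_germ]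
      refine Algebra.mem_bot.2 ⟨f 0, ?_⟩
      rw [Algebra.algebraMap_eq_smul_one, ← fn_one, ← fn_smul, ← germ_one, germ_smul]
      congr 1
      rw [germ_eq]
      exact Eventually.of_forall fun x => by simp [k]
    | hdx i =>
      rw [SMap.pb_dx, od_fn]
      convert Subalgebra.zero_mem _
      refine Finset.sum_eq_zero fun j _ => ?_
      rw [SMap.coord, pd_germ]
      have : pderivFun j (fun x => ((k.toFun x i : ℝ) : ℂ)) = 0 := by
        funext x
        simp [pderivFun, k]
      simp only [this, germ_zero, fn_zero, zero_mul]
    | hmul a b h1 h2 => rw [map_mul]; exact Subalgebra.mul_mem _ h1 h2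
    | hadd a b h1 h2 => rw [map_add]; exact Subalgebra.add_mem _ h1 h2
  obtain ⟨z, hz⟩ := Algebra.mem_bot.1 (h a)
  exact ⟨z, b, by rw [hz, ← hb]; exact (res_self subset_rfl a).symm⟩

lemma sph_univ : (deRham (ι := ι) (F := SGerm (Set.univ : Set (ι → ℝ)))).Sph [] := by
  refine ⟨fun g hg => by simp at hg, fun a ha => ?_, fun z b h => ?_⟩
  · rw [deRham_D] at ha
    obtain ⟨z, b, h⟩ := univ_span a ha
    exact ⟨z, b, by rw [deRham_D]; exact h⟩
  · rw [deRham_D] at h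
    exact const_exact Set.univ_nonempty z b h

lemma isGen_map_pb {ι' : Type} [Fintype ι'] [DecidableEq ι'] {K : Set (ι → ℝ)}
    {K' : Set (ι' → ℝ)} (h : SMap K' K) {g : Gen (Forms K)} (hg : deRham.IsGen g) :
    deRham.IsGen (g.map h.pb) := by
  refine ⟨?_, ?_, hg.pos, fun he => ?_, fun he => ?_⟩
  · have := hg.closed
    rw [deRham_D] at this ⊢
    exact (h.pb_od g.w).symm.trans (by rw [this, map_zero])
  · exact (h.pb_opr _ g.w).symm.trans (congrArg h.pb hg.homog)
  · have := hg.sq he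
    rw [deRham_D] at this ⊢
    exact (h.pb_od g.e).symm.trans (by rw [this, map_mul]; rfl)
  · exact (h.pb_opr _ g.e).symm.trans (congrArg h.pb (hg.homog_e he))

lemma blockGen_isGen (hn : 1 ≤ n) {w} (hw : BlockGen c (n + 1) n w) :
    ∃ e, deRham.IsGen ⟨w, e, (n : ℤ)⟩ := by
  have hom : opr (n : ℤ) w = w := by
    have := hw.homog
    rwa [Nat.cast_succ, add_sub_cancel_right] at this
  obtain ⟨o1, o2, b, h1, h2, h⟩ := hw.span _ (BlockInv.univ c n) (w * w)
    (by rw [od_mul, hw.closed, zero_mul, mul_zero, add_zero])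
  obtain ⟨z1, b1, rfl⟩ := univ_span o1 h1
  obtain ⟨z2, b2, rfl⟩ := univ_span o2 h2
  rw [res_self] at h
  have hww : opr (2 * n : ℤ) (w * w) = w * w := by
    rw [two_mul]
    exact opr_homog_mul hom hom
  have n0 : (2 * n : ℤ) ≠ 0 := by omega
  have n1 : (2 * n : ℤ) ≠ n := by omega
  have h' : w * w = z1 • 1 + z2 • w + od (res blockSet_subset b1 +
      oinv w * res blockSet_subset b2 + b) := by
    rw [h]
    simp only [map_add, od_mul, res_od, od_oinv, oinv_oinv, hw.closed,
      Algebra.algebraMap_eq_smul_one, map_zero, neg_zero, zero_mul, mul_add, mul_smul_comm, mul_one, map_smul, map_one]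
    abel
  have key : w * w = od (opr (2 * n - 1 : ℤ) (res blockSet_subset b1 +
      oinv w * res blockSet_subset b2 + b)) := by
    rw [od_opr, sub_add_cancel, ← hww, h', map_add, map_add, map_smul, map_smul,
      opr_homog hom, if_neg n1, opr_homog opr_one, if_neg n0, smul_zero, smul_zero, zero_add,
      zero_add]
  refine ⟨opr (2 * n - 1 : ℤ) (res blockSet_subset b1 + oinv w * res blockSet_subset b2 + b),
    ?_, hom, (Nat.one_le_cast (α := ℤ)).2 hn, fun _ => ?_, fun _ => ?_⟩
  · rw [deRham_D, hw.closed]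
  · rw [deRham_D, key]
  · exact (opr_opr _ _ _).trans (if_pos rfl)

lemma Sph_block (hn : 1 ≤ n) (hc : ∀ i ≤ n, ∀ j ≤ n, c i = c j → i = j) (hU : BlockInv c n U)
    (L : List (Gen (Forms U))) (hL : deRham.Sph L) :
    ∃ L' : List (Gen (Forms (blockSet c (n + 1) U))), deRham.Sph L' ∧
      L'.map Gen.deg = (n : ℤ) :: L.map Gen.deg := by
  obtain ⟨w, hw⟩ := blockGen_exists hc
  obtain ⟨e, he⟩ := blockGen_isGen hn hw
  have hg := isGen_map_pb (SMap.incl (blockSet_mono (c := c) (m := n + 1) (Set.subset_univ U))) he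
  refine ⟨_, Stage.Sph.cons_of_map (res blockSet_subset) L _ hg
    (fun g hg => isGen_map_pb _ (hL.gen g hg)) (fun a ha => ?_) (fun z z' b h => ?_), ?_⟩
  · rw [deRham_D] at ha
    obtain ⟨o1, o2, b, h1, h2, h⟩ := hw.span U hU a ha
    obtain ⟨z, b1, rfl⟩ := hL.span o1 (by rw [deRham_D, h1])
    obtain ⟨z', b2, rfl⟩ := hL.span o2 (by rw [deRham_D, h2])
    refine ⟨z, z', res blockSet_subset b1 + oinv (res (blockSet_mono (Set.subset_univ U)) w) *
      res blockSet_subset b2 + b, ?_⟩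
    rw [h]
    simp only [deRham_D, map_add, od_mul, res_od, od_oinv, oinv_oinv]
    rw [← res_od _ w, hw.closed]
    change _ = _ + res _ w * _ + _
    simp only [map_zero, neg_zero, zero_mul]
    noncomm_ring
  · rw [deRham_D] at h
    have hcl : ∀ z, od (evalC L z) = 0 := fun z => by
      have := Stage.closed_evalC hL.gen z
      rwa [deRham_D] at this
    obtain ⟨⟨b1, h1⟩, b2, h2⟩ := hw.ind U hU _ _ b (hcl z) (hcl z') h
    exact ⟨hL.ind z b1 (by rw [deRham_D, h1]), hL.ind z' b2 (by rw [deRham_D, h2])⟩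
  · simp only [List.map_cons, List.map_map]
    rfl

end

section

variable {k : ℕ} (n : Fin k → ℕ)

/-- The product of punctured Euclidean spaces over some of the factors. -/
def prodSet (s : List (Fin k)) : Set ((Σ i, Fin (n i + 1)) → ℝ) :=
  {x | ∀ i ∈ s, ∃ j, x ⟨i, j⟩ ≠ 0}

/-- The coordinates of a factor. -/
def factorCoord (i : Fin k) (j : ℕ) : Σ i, Fin (n i + 1) := ⟨i, Fin.ofNat (n i + 1) j⟩

lemma factorCoord_inj (i : Fin k) :
    ∀ a ≤ n i, ∀ b ≤ n i, factorCoord n i a = factorCoord n i b → a = b := by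
  intro a ha b hb h
  have h1 := congrArg Fin.val (eq_of_heq (Sigma.mk.inj h).2)
  simpa [Nat.mod_eq_of_lt (Nat.lt_succ_of_le ha), Nat.mod_eq_of_lt (Nat.lt_succ_of_le hb)] using h1

lemma prodSet_cons (i : Fin k) (s : List (Fin k)) :
    prodSet n (i :: s) = blockSet (factorCoord n i) (n i + 1) (prodSet n s) := by
  ext x
  constructor
  · intro h
    refine ⟨fun j hj => h j (List.mem_cons_of_mem _ hj), ?_⟩
    obtain ⟨j, hj⟩ := h i List.mem_cons_self
    exact ⟨j, j.2, by simpa [factorCoord] using hj⟩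
  · rintro ⟨h, j, -, hj⟩ i' hi'
    rcases List.mem_cons.1 hi' with rfl | hi'
    · exact ⟨_, hj⟩
    · exact h i' hi'

lemma prodSet_inv (i : Fin k) (s : List (Fin k)) (hi : i ∉ s) :
    BlockInv (factorCoord n i) (n i) (prodSet n s) := by
  refine ⟨?_, fun x hx j _ t i' hi' => ?_⟩
  · have : prodSet n s = ⋂ i ∈ s.toFinset, ⋃ j, {x | x ⟨i, j⟩ ≠ 0} := by
      ext x
      simp [prodSet]
    rw [this]
    exact isOpen_biInter_finset fun i _ => isOpen_iUnion fun j =>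
      isOpen_ne_fun (continuous_apply _) continuous_const
  · obtain ⟨j', hj'⟩ := hx i' hi'
    refine ⟨j', ?_⟩
    rwa [Function.update_of_ne]
    intro e
    have e' : i' = i := congrArg Sigma.fst e
    exact hi (e' ▸ hi')

lemma exists_sph_prodSet (hn : ∀ i, 1 ≤ n i) (s : List (Fin k)) (hs : s.Nodup) :
    ∃ L : List (Gen (Forms (prodSet n s))), deRham.Sph L ∧
      L.map Gen.deg = s.map fun i => (n i : ℤ) := by
  induction s with
  | nil =>
    have : prodSet n [] = Set.univ := by
      ext x
      simp [prodSet]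
    rw [this]
    exact ⟨[], sph_univ, rfl⟩
  | cons i s ih =>
    obtain ⟨L, hL, hd⟩ := ih hs.of_cons
    obtain ⟨L', hL', hd'⟩ := Sph_block (hn i) (factorCoord_inj n i)
      (prodSet_inv n i s (List.nodup_cons.1 hs).1) L hL
    rw [prodSet_cons]
    exact ⟨L', hL', by rw [hd', hd, List.map_cons]⟩

end

end FreeToralRank

namespace FreeToralRank

open Polynomial

open scoped TensorProduct Topology ContDiff
open Filter

set_option linter.unusedSectionVars false

section

variable {ι : Type} [Fintype ι] [DecidableEq ι] {K : Set (ι → ℝ)}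

/-- Forms near a set extend to open neighbourhoods. -/
lemma exists_extend (a : Forms K) :
    ∃ (U : Set (ι → ℝ)) (_ : IsOpen U) (h : K ⊆ U) (b : Forms U), res h b = a := by
  induction a using om_induction with
  | hfn f =>
    obtain ⟨f, hf, rfl⟩ := germ_surj f
    obtain ⟨U, hU, hKU, h⟩ := eventually_nhdsSet_iff_exists.1 hf
    refine ⟨U, hU, hKU, fn (germ f ?_), ?_⟩
    · rw [SmoothNear, hU.nhdsSet_eq, eventually_principal]
      exact h
    · rw [res_fn, SMap.germ_germ]
      rfl
  | hdx i =>
    refine ⟨Set.univ, isOpen_univ, Set.subset_univ K, dx i, ?_⟩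
    rw [res, SMap.pb_dx, coord_incl]
  | hmul a b h1 h2 =>
    obtain ⟨U, hU, hK, a', rfl⟩ := h1
    obtain ⟨V, hV, hK', b', rfl⟩ := h2
    refine ⟨U ∩ V, hU.inter hV, Set.subset_inter hK hK', res Set.inter_subset_left a' *
      res Set.inter_subset_right b', ?_⟩
    rw [map_mul, res_res, res_res]
  | hadd a b h1 h2 =>
    obtain ⟨U, hU, hK, a', rfl⟩ := h1
    obtain ⟨V, hV, hK', b', rfl⟩ := h2
    refine ⟨U ∩ V, hU.inter hV, Set.subset_inter hK hK', res Set.inter_subset_left a' +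
      res Set.inter_subset_right b', ?_⟩
    rw [map_add, res_res, res_res]

/-- The coefficients of a form. -/
noncomputable def coefAt {F : Type} [CommRing F] [Algebra ℂ F]
    (l : ExteriorAlgebra ℂ (ι → ℂ) →ₗ[ℂ] ℂ) : Om ι F →ₗ[ℂ] F :=
  (TensorProduct.rid ℂ F).toLinearMap ∘ₗ TensorProduct.map LinearMap.id l

lemma coefAt_coefMap {F F' : Type} [CommRing F] [Algebra ℂ F] [CommRing F'] [Algebra ℂ F']
    (u : F →ₗ[ℂ] F') (l : ExteriorAlgebra ℂ (ι → ℂ) →ₗ[ℂ] ℂ) (a : Om ι F) :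
    coefAt l (coefMap u a) = u (coefAt l a) := by
  refine LinearMap.congr_fun (f := coefAt l ∘ₗ coefMap u) (g := u ∘ₗ coefAt l)
    (om_ext fun f w => ?_) a
  simp [coefAt, coefMap]

lemma exists_coefficients : ∃ (J : Type) (_ : Fintype J)
    (b : Module.Basis J ℂ (ExteriorAlgebra ℂ (ι → ℂ))),
    ∀ (F : Type) [CommRing F] [Algebra ℂ F] (a : Om ι F),
      a = ∑ j, coefAt (b.coord j) a ⊗ₜ[ℂ] b j := by
  refine ⟨_, inferInstance, (Module.finBasis ℂ (ι → ℂ)).ExteriorAlgebra, fun F _ _ a => ?_⟩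
  set b := (Module.finBasis ℂ (ι → ℂ)).ExteriorAlgebra
  refine LinearMap.congr_fun (f := LinearMap.id)
    (g := ∑ j, (TensorProduct.mk ℂ F _).flip (b j) ∘ₗ coefAt (b.coord j)) (om_ext fun f w => ?_) a
    |>.trans (by simp)
  simp only [LinearMap.id_apply, LinearMap.sum_apply, LinearMap.comp_apply, coefAt,
    TensorProduct.map_tmul, LinearEquiv.coe_coe, TensorProduct.rid_tmul, LinearMap.flip_apply,
    TensorProduct.mk_apply, TensorProduct.smul_tmul, ← TensorProduct.tmul_sum]
  congr 1
  exact (b.sum_repr w).symm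

/-- Forms on an open set that vanish near a subset vanish on a neighbourhood of the subset. -/
lemma exists_res_eq_zero {U : Set (ι → ℝ)} (hU : IsOpen U) (h : K ⊆ U) (a : Forms U)
    (ha : res h a = 0) :
    ∃ (V : Set (ι → ℝ)) (_ : IsOpen V) (_ : K ⊆ V) (hV : V ⊆ U), res hV a = 0 := by
  obtain ⟨J, _, b, hb⟩ := exists_coefficients (ι := ι)
  have key : ∀ f : SGerm U, (SMap.incl h).germ f = 0 →
      ∃ (V : Set (ι → ℝ)) (_ : IsOpen V) (_ : K ⊆ V) (hV : V ⊆ U), (SMap.incl hV).germ f = 0 := by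
    intro f hf
    obtain ⟨f, hs, rfl⟩ := germ_surj f
    rw [SMap.germ_germ, ← germ_zero, germ_eq] at hf
    obtain ⟨V, hV, hKV, hz⟩ := eventually_nhdsSet_iff_exists.1 hf
    refine ⟨V ∩ U, hV.inter hU, Set.subset_inter hKV h, Set.inter_subset_right, ?_⟩
    rw [SMap.germ_germ, ← germ_zero]
    exact germ_eq_of_isOpen (hV.inter hU) fun x hx => hz x hx.1
  have h0 : ∀ j, (SMap.incl h).germ (coefAt (b.coord j) a) = 0 := by
    intro j
    have := coefAt_coefMap (SMap.incl h).germ.toLinearMap (b.coord j) a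
    rw [← res_eq_coefMap, ha, map_zero] at this
    exact this.symm
  choose V hV hKV hVU hz using fun j => key _ (h0 j)
  have hW : (⋂ j, V j) ∩ U ⊆ U := Set.inter_subset_right
  refine ⟨(⋂ j, V j) ∩ U, (isOpen_iInter_of_finite hV).inter hU,
    Set.subset_inter (Set.subset_iInter hKV) h, hW, ?_⟩
  rw [hb _ (res hW a)]
  refine Finset.sum_eq_zero fun j _ => ?_
  rw [res_eq_coefMap, coefAt_coefMap]
  have hWV : (⋂ j, V j) ∩ U ⊆ V j := Set.inter_subset_left.trans (Set.iInter_subset V j)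
  have : (SMap.incl hW).germ (coefAt (b.coord j) a) =
      (SMap.incl hWV).germ ((SMap.incl (hVU j)).germ (coefAt (b.coord j) a)) := by
    obtain ⟨f, hs, hf⟩ := germ_surj (coefAt (b.coord j) a)
    rw [hf, SMap.germ_germ, SMap.germ_germ, SMap.germ_germ]
    rfl
  rw [AlgHom.toLinearMap_apply, this, hz, map_zero, TensorProduct.zero_tmul]

/-- Closed forms near a set extend to closed forms on open neighbourhoods. -/
lemma exists_extend_closed (a : Forms K) (ha : od a = 0) :
    ∃ (U : Set (ι → ℝ)) (_ : IsOpen U) (h : K ⊆ U) (b : Forms U), res h b = a ∧ od b = 0 := by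
  obtain ⟨U, hU, h, b, rfl⟩ := exists_extend a
  obtain ⟨V, hV, hKV, hVU, h0⟩ := exists_res_eq_zero hU h (od b) (by rw [res_od, ha])
  exact ⟨V, hV, hKV, res hVU b, res_res _ _ _, by rw [← res_od, h0]⟩

end

section

lemma exists_contDiff_near {E F : Type} [NormedAddCommGroup E] [NormedSpace ℝ E]
    [FiniteDimensional ℝ E] [NormedAddCommGroup F] [NormedSpace ℝ F] [FiniteDimensional ℝ F]
    [TietzeExtension.{0} F] {K : Set E} (hK : IsCompact K) {f : E → F} (hf : ContinuousOn f K) {ε : ℝ} (hε : 0 < ε) :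
    ∃ g : E → F, ContDiff ℝ ∞ g ∧ ∀ x ∈ K, dist (g x) (f x) < ε := by
  obtain ⟨h, hh⟩ := ContinuousMap.exists_restrict_eq hK.isClosed ⟨K.domRestrict f, hf.domRestrict⟩
  have hd := (ContinuousMap.dense_setOfPred_contDiff (E := E) (F := F)) h
  rw [mem_closure_iff_nhds_basis
    (nhds_basis_uniformity Metric.uniformity_basis_dist.compactConvergenceUniformity)] at hd
  obtain ⟨g, hg, hgd⟩ := hd ⟨K, ε⟩ ⟨hK, hε⟩
  refine ⟨g, hg, fun x hx => ?_⟩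
  have h1 := hgd x hx
  have h2 : h x = f x := DFunLike.congr_fun hh ⟨x, hx⟩
  rw [← h2]
  exact h1

lemma exists_uniform_near {E F : Type*} [MetricSpace E] [MetricSpace F] {K : Set E}
    (hK : IsCompact K) {f : E → F} (hf : ∀ x ∈ K, ContinuousAt f x) {ε : ℝ} (hε : 0 < ε) :
    ∃ δ > 0, ∀ x ∈ K, ∀ y, dist y x < δ → dist (f y) (f x) < ε := by
  have := hK.uniformContinuousAt_of_continuousAt f hf (Metric.dist_mem_uniformity hε)
  obtain ⟨δ, hδ, h⟩ := Metric.mem_uniformity_dist.1 this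
  exact ⟨δ, hδ, fun x hx y hy => by
    rw [dist_comm]
    exact h (by rwa [dist_comm]) hx⟩

lemma exists_ball_subset_of_compact {E : Type*} [MetricSpace E] {K U : Set E} (hK : IsCompact K)
    (hU : IsOpen U) (h : K ⊆ U) : ∃ ε > 0, ∀ x ∈ K, Metric.ball x ε ⊆ U := by
  obtain ⟨δ, hδ, h'⟩ := hK.exists_thickening_subset_open hU h
  exact ⟨δ, hδ, fun x hx => (Metric.ball_subset_thickening hx δ).trans h'⟩

end

end FreeToralRank

namespace FreeToralRank

open Polynomial

open scoped TensorProduct Topology ContDiff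
open Filter

set_option linter.unusedSectionVars false

section

variable {ι κ : Type} [Fintype ι] [DecidableEq ι] [Fintype κ] [DecidableEq κ]

lemma Htpy.of_near {K' : Set (κ → ℝ)} {K : Set (ι → ℝ)} {f g : SMap K' K}
    (h : ∀ x ∈ K', ∃ z ε, Metric.ball z ε ⊆ K ∧ f.toFun x ∈ Metric.ball z ε ∧
      g.toFun x ∈ Metric.ball z ε) : Htpy f g := by
  refine Htpy.of_segment fun x hx s hs => ?_
  obtain ⟨z, ε, hz, hf, hg⟩ := h x hx
  exact hz (convex_ball z ε hf hg (sub_nonneg.2 hs.2) hs.1 (by ring))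

/-- A globally smooth map as a map between sets. -/
def SMap.ofContDiff {K' : Set (κ → ℝ)} {K : Set (ι → ℝ)} (f : (κ → ℝ) → ι → ℝ)
    (hf : ContDiff ℝ ∞ f) (h : Set.MapsTo f K' K) : SMap K' K :=
  ⟨f, Eventually.of_forall fun _ => hf.contDiffAt, h⟩

/-- If a compact set `Xs` is a smooth retract up to homotopy of an open set `M`, then any compact
set homeomorphic to `Xs` has the same de Rham cohomology as `M`. -/
theorem exists_quasiIso {M Xs : Set (ι → ℝ)} {K : Set (κ → ℝ)} (hM : IsOpen M) (hXM : Xs ⊆ M)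
    (hXs : IsCompact Xs) (hK : IsCompact K) (r : SMap M M) (hr : ∀ x ∈ M, r.toFun x ∈ Xs)
    (hrX : ∀ x ∈ Xs, r.toFun x = x) (hrid : Htpy r (SMap.incl subset_rfl))
    {φ : (ι → ℝ) → κ → ℝ} {ψ : (κ → ℝ) → ι → ℝ} (hφ : ContinuousOn φ Xs) (hψ : ContinuousOn ψ K)
    (hφK : Set.MapsTo φ Xs K) (hψX : Set.MapsTo ψ K Xs) (hφψ : ∀ y ∈ K, φ (ψ y) = y)
    (hψφ : ∀ x ∈ Xs, ψ (φ x) = x) :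
    ∃ f : SMap K M, (∀ a : Forms K, od a = 0 → ∃ c b, od c = 0 ∧ a = f.pb c + od b) ∧
      ∀ c : Forms M, od c = 0 → ∀ b, f.pb c = od b → ∃ b', c = od b' := by
  obtain ⟨ε, hε, hball⟩ := exists_ball_subset_of_compact hXs hM hXM
  obtain ⟨f, hf, hfψ⟩ := exists_contDiff_near hK hψ (half_pos hε)
  have hfM : Set.MapsTo f K M := fun y hy =>
    hball _ (hψX hy) ((hfψ y hy).trans (half_lt_self hε))
  refine ⟨SMap.ofContDiff f hf hfM, fun a ha => ?_, fun c hc b hb => ?_⟩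
  · obtain ⟨U, hU, hKU, η, rfl, hη⟩ := exists_extend_closed a ha
    obtain ⟨δ, hδ, hδU⟩ := exists_ball_subset_of_compact hK hU hKU
    obtain ⟨g, hg, hgφ⟩ := exists_contDiff_near hXs hφ (half_pos hδ)
    let G : SMap M U := (SMap.ofContDiff g hg fun x hx =>
      hδU _ (hφK hx) ((hgφ x hx).trans (half_lt_self hδ)) : SMap Xs U).comp
        ⟨r.toFun, r.smooth, fun x hx => hr x hx⟩
    have hGc : ∀ x ∈ Xs, ContinuousAt G.toFun x := by
      intro x hx
      have h := G.smooth
      exact (eventually_nhdsSet_iff_forall.1 h x (hXM hx)).self_of_nhds.continuousAt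
    obtain ⟨δ', hδ', hG⟩ := exists_uniform_near hXs hGc (half_pos hδ)
    obtain ⟨f₂, hf₂, hfψ₂⟩ := exists_contDiff_near hK hψ (lt_min hε hδ')
    have hfM₂ : Set.MapsTo f₂ K M := fun y hy =>
      hball _ (hψX hy) ((hfψ₂ y hy).trans_le (min_le_left _ _))
    have h1 : Htpy (SMap.ofContDiff f hf hfM) (SMap.ofContDiff f₂ hf₂ hfM₂) :=
      Htpy.of_near fun y hy => ⟨ψ y, ε, hball _ (hψX hy), (hfψ y hy).trans (half_lt_self hε),
        (hfψ₂ y hy).trans_le (min_le_left _ _)⟩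
    have h2 : Htpy (G.comp (SMap.ofContDiff f₂ hf₂ hfM₂)) (SMap.incl hKU) := by
      refine Htpy.of_near fun y hy => ⟨y, δ, hδU y hy, ?_, Metric.mem_ball_self hδ⟩
      have e1 := hG (ψ y) (hψX hy) (f₂ y) ((hfψ₂ y hy).trans_le (min_le_right _ _))
      have e2 : dist (G.toFun (ψ y)) y < δ / 2 := by
        have := hgφ (ψ y) (hψX hy)
        rw [hφψ y hy] at this
        change dist (g (r.toFun (ψ y))) y < δ / 2
        rwa [hrX _ (hψX hy)]
      exact (dist_triangle _ _ _).trans_lt ((add_lt_add e1 e2).trans_eq (add_halves δ))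
    have hcl : od (G.pb η) = 0 := by rw [← G.pb_od, hη, map_zero]
    obtain ⟨b₁, hb₁⟩ := h1.exact hcl
    obtain ⟨b₂, hb₂⟩ := h2.exact hη
    refine ⟨G.pb η, b₁ + b₂, hcl, ?_⟩
    rw [SMap.pb_comp, hb₁] at hb₂
    rw [map_add, ← add_assoc]
    exact hb₂
  · obtain ⟨U, hU, hKU, b₀, rfl⟩ := exists_extend b
    have hV : IsOpen (U ∩ f ⁻¹' M) := hU.inter (hM.preimage hf.continuous)
    have hKV : K ⊆ U ∩ f ⁻¹' M := fun y hy => ⟨hKU hy, hfM hy⟩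
    let F : SMap (U ∩ f ⁻¹' M) M := SMap.ofContDiff f hf fun y hy => hy.2
    obtain ⟨W, hW, hKW, hWV, h0⟩ := exists_res_eq_zero hV hKV
      (F.pb c - od (res Set.inter_subset_left b₀)) (by
        rw [map_sub, res_od, res_res, ← hb, sub_eq_zero]
        exact (SMap.pb_comp F (SMap.incl hKV) c).symm)
    let F' : SMap W M := F.comp (SMap.incl hWV)
    have hF' : F'.pb c = od (res hWV (res Set.inter_subset_left b₀)) := by
      rw [map_sub, sub_eq_zero, res_od] at h0
      exact (SMap.pb_comp F (SMap.incl hWV) c).trans h0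
    obtain ⟨δ, hδ, hδW⟩ := exists_ball_subset_of_compact hK hW hKW
    obtain ⟨δ', hδ', hfu⟩ := exists_uniform_near hK (fun x _ => hf.continuous.continuousAt (x := x))
      (half_pos hε)
    obtain ⟨g, hg, hgφ⟩ := exists_contDiff_near hXs hφ (lt_min hδ hδ')
    let G : SMap M W := (SMap.ofContDiff g hg fun x hx =>
      hδW _ (hφK hx) ((hgφ x hx).trans_le (min_le_left _ _)) : SMap Xs W).comp
        ⟨r.toFun, r.smooth, fun x hx => hr x hx⟩
    have h1 : Htpy (F'.comp G) r := by
      refine Htpy.of_near fun x hx => ⟨r.toFun x, ε, hball _ (hr x hx), ?_, Metric.mem_ball_self hε⟩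
      have e1 := hfu (φ (r.toFun x)) (hφK (hr x hx)) (g (r.toFun x))
        ((hgφ _ (hr x hx)).trans_le (min_le_right _ _))
      have e2 := hfψ (φ (r.toFun x)) (hφK (hr x hx))
      rw [hψφ _ (hr x hx)] at e2
      exact (dist_triangle _ _ _).trans_lt ((add_lt_add e1 e2).trans_eq (add_halves ε))
    obtain ⟨b₁, hb₁⟩ := h1.exact hc
    obtain ⟨b₂, hb₂⟩ := hrid.exact hc
    refine ⟨G.pb (res hWV (res Set.inter_subset_left b₀)) + b₁ + b₂, ?_⟩
    rw [hb₁, SMap.pb_comp, hF', G.pb_od] at hb₂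
    rw [map_add, map_add, ← hb₂]
    exact (res_self _ c).symm

/-- The cohomology of a compact set homeomorphic to a smooth retract of an open set. -/
theorem exists_sph_of_homeo {M Xs : Set (ι → ℝ)} {K : Set (κ → ℝ)} (hM : IsOpen M) (hXM : Xs ⊆ M)
    (hXs : IsCompact Xs) (hK : IsCompact K) (r : SMap M M) (hr : ∀ x ∈ M, r.toFun x ∈ Xs)
    (hrX : ∀ x ∈ Xs, r.toFun x = x) (hrid : Htpy r (SMap.incl subset_rfl))
    {φ : (ι → ℝ) → κ → ℝ} {ψ : (κ → ℝ) → ι → ℝ} (hφ : ContinuousOn φ Xs) (hψ : ContinuousOn ψ K)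
    (hφK : Set.MapsTo φ Xs K) (hψX : Set.MapsTo ψ K Xs) (hφψ : ∀ y ∈ K, φ (ψ y) = y)
    (hψφ : ∀ x ∈ Xs, ψ (φ x) = x) (L : List (Gen (Forms M))) (hL : deRham.Sph L) :
    ∃ L' : List (Gen (Forms K)), deRham.Sph L' ∧ L'.map Gen.deg = L.map Gen.deg := by
  obtain ⟨f, hs, hi⟩ := exists_quasiIso hM hXM hXs hK r hr hrX hrid hφ hψ hφK hψX hφψ hψφ
  have hcl : ∀ c, od (evalC L c) = 0 := fun c => by
    have := deRham.closed_evalC hL.gen c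
    rwa [deRham_D] at this
  refine ⟨L.map (Gen.map f.pb), Stage.Sph.of_map f.pb L (fun g hg => isGen_map_pb f (hL.gen g hg))
    (fun a ha => ?_) (fun c b h => ?_), by rw [List.map_map]; rfl⟩
  · rw [deRham_D] at ha
    obtain ⟨c, b, hc, rfl⟩ := hs a ha
    obtain ⟨c', b', rfl⟩ := hL.span c (by rw [deRham_D]; exact hc)
    refine ⟨c', f.pb b' + b, ?_⟩
    rw [deRham_D, deRham_D, map_add, map_add, f.pb_od, add_assoc]
  · rw [deRham_D] at h
    obtain ⟨b', hb'⟩ := hi _ (hcl c) b h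
    exact hL.ind c b' (by rw [deRham_D]; exact hb')

end

end FreeToralRank

namespace FreeToralRank

open Polynomial

open scoped TensorProduct Topology ContDiff
open Filter

set_option linter.unusedSectionVars false

section

lemma continuousOn_extend {X A B : Type*} [TopologicalSpace X] [TopologicalSpace A]
    [TopologicalSpace B] {e : X → A} {f : X → B} (he : Topology.IsEmbedding e) (hf : Continuous f)
    (g : A → B) : ContinuousOn (Function.extend e f g) (Set.range e) := by
  rw [continuousOn_iff_continuous_domRestrict]
  have : (Set.range e).domRestrict (Function.extend e f g) = f ∘ he.toHomeomorph.symm := by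
    funext ⟨y, x, hx⟩
    subst hx
    have h1 : he.toHomeomorph.symm ⟨e x, x, rfl⟩ = x := by
      rw [Homeomorph.symm_apply_eq]
      rfl
    rw [Function.comp_apply, h1]
    exact he.injective.extend_apply _ _ _
  rw [this]
  exact hf.comp (Homeomorph.continuous _)

variable {k : ℕ} (n : Fin k → ℕ)

/-- The squared norm of a component. -/
noncomputable def blockSq (i : Fin k) (x : (Σ i, Fin (n i + 1)) → ℝ) : ℝ := ∑ j, x ⟨i, j⟩ ^ 2

lemma blockSq_pos {x : (Σ i, Fin (n i + 1)) → ℝ} (hx : x ∈ prodSet n (List.finRange k))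
    (i : Fin k) : 0 < blockSq n i x := by
  obtain ⟨j, hj⟩ := hx i (List.mem_finRange i)
  exact Finset.sum_pos' (fun _ _ => sq_nonneg _) ⟨j, Finset.mem_univ j, by positivity⟩

lemma contDiff_blockSq (i : Fin k) : ContDiff ℝ ∞ (blockSq n i) :=
  ContDiff.sum fun _ _ => (contDiff_apply ℝ ℝ _).pow 2

lemma isOpen_prodSet (s : List (Fin k)) : IsOpen (prodSet n s) := by
  have : prodSet n s = ⋂ i ∈ s.toFinset, ⋃ j, {x | x ⟨i, j⟩ ≠ 0} := by
    ext x
    simp [prodSet]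
  rw [this]
  exact isOpen_biInter_finset fun i _ => isOpen_iUnion fun j =>
    isOpen_ne_fun (continuous_apply _) continuous_const

/-- Normalization of each component. -/
noncomputable def normalizeBlocks (x : (Σ i, Fin (n i + 1)) → ℝ) (q : Σ i, Fin (n i + 1)) : ℝ :=
  x q / Real.sqrt (blockSq n q.1 x)

/-- The product of unit spheres in a single Euclidean space. -/
def sphereSet : Set ((Σ i, Fin (n i + 1)) → ℝ) := {x | ∀ i, blockSq n i x = 1}

lemma sphereSet_subset : sphereSet n ⊆ prodSet n (List.finRange k) := by
  intro x hx i _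
  by_contra! h
  have h1 := hx i
  rw [blockSq, Finset.sum_eq_zero fun j _ => by rw [h j]; norm_num] at h1
  exact zero_ne_one h1

lemma normalizeBlocks_mem {x : (Σ i, Fin (n i + 1)) → ℝ} (hx : x ∈ prodSet n (List.finRange k)) :
    normalizeBlocks n x ∈ sphereSet n := by
  intro i
  have h := blockSq_pos n hx i
  calc ∑ j, (x ⟨i, j⟩ / Real.sqrt (blockSq n i x)) ^ 2
      = (∑ j, x ⟨i, j⟩ ^ 2) / blockSq n i x := by
        rw [Finset.sum_div]
        exact Finset.sum_congr rfl fun j _ => by rw [div_pow, Real.sq_sqrt h.le]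
    _ = 1 := div_self h.ne'

lemma normalizeBlocks_eq {x : (Σ i, Fin (n i + 1)) → ℝ} (hx : x ∈ sphereSet n) :
    normalizeBlocks n x = x := by
  funext q
  rw [normalizeBlocks, hx q.1, Real.sqrt_one, div_one]

/-- Normalization as a smooth map. -/
noncomputable def normalizeMap :
    SMap (prodSet n (List.finRange k)) (prodSet n (List.finRange k)) where
  toFun := normalizeBlocks n
  smooth := by
    rw [(isOpen_prodSet n _).nhdsSet_eq, eventually_principal]
    intro x hx
    rw [contDiffAt_pi]
    intro q
    have h := blockSq_pos n hx q.1
    exact (contDiff_apply ℝ ℝ q).contDiffAt.div ((contDiff_blockSq n q.1).contDiffAt.sqrt h.ne')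
      (Real.sqrt_pos.2 h).ne'
  maps _ hx := sphereSet_subset n (normalizeBlocks_mem n hx)

lemma htpy_normalizeMap : Htpy (normalizeMap n) (SMap.incl subset_rfl) := by
  refine Htpy.of_segment fun x hx s hs i hi => ?_
  obtain ⟨j, hj⟩ := hx i hi
  refine ⟨j, ?_⟩
  change (1 - s) * (x ⟨i, j⟩ / Real.sqrt (blockSq n i x)) + s * x ⟨i, j⟩ ≠ 0
  have h := Real.sqrt_pos.2 (blockSq_pos n hx i)
  have h1 : 0 < (1 - s) / Real.sqrt (blockSq n i x) + s := by
    rcases hs.1.eq_or_lt with rfl | h0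
    · simpa using h
    · exact add_pos_of_nonneg_of_pos (div_nonneg (sub_nonneg.2 hs.2) h.le) h0
  rw [show (1 - s) * (x ⟨i, j⟩ / Real.sqrt (blockSq n i x)) + s * x ⟨i, j⟩ =
    ((1 - s) / Real.sqrt (blockSq n i x) + s) * x ⟨i, j⟩ by ring]
  exact mul_ne_zero h1.ne' hj

/-- The product of spheres inside a single Euclidean space. -/
def flatten (x : ∀ i : Fin k, Metric.sphere (0 : EuclideanSpace ℝ (Fin (n i + 1))) 1)
    (q : Σ i, Fin (n i + 1)) : ℝ := (x q.1 : EuclideanSpace ℝ (Fin (n q.1 + 1))) q.2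

lemma continuous_flatten : Continuous (flatten n) := by
  refine continuous_pi fun q => ?_
  have h1 : Continuous fun x : ∀ i : Fin k, Metric.sphere (0 : EuclideanSpace ℝ (Fin (n i + 1))) 1 =>
      (x q.1 : EuclideanSpace ℝ (Fin (n q.1 + 1))) :=
    continuous_subtype_val.comp (continuous_apply q.1)
  exact (EuclideanSpace.proj (𝕜 := ℝ) q.2).continuous.comp h1

lemma flatten_injective : Function.Injective (flatten n) := by
  intro x y h
  funext i
  ext j
  exact congrFun h ⟨i, j⟩

lemma range_flatten : Set.range (flatten n) = sphereSet n := by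
  ext x
  constructor
  · rintro ⟨y, rfl⟩ i
    have h := (y i).2
    rw [mem_sphere_zero_iff_norm, EuclideanSpace.norm_eq, Real.sqrt_eq_one] at h
    simpa [blockSq, flatten] using h
  · intro hx
    refine ⟨fun i => ⟨WithLp.toLp 2 fun j => x ⟨i, j⟩, ?_⟩, rfl⟩
    rw [mem_sphere_zero_iff_norm, EuclideanSpace.norm_eq, Real.sqrt_eq_one]
    simpa [blockSq] using hx i

/-- The cohomology of an embedded product of spheres. -/
theorem exists_sph_range (hn : ∀ i, 1 ≤ n i) {κ : Type} [Fintype κ] [DecidableEq κ]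
    (φ : (∀ i : Fin k, Metric.sphere (0 : EuclideanSpace ℝ (Fin (n i + 1))) 1) → κ → ℝ)
    (hφ : Continuous φ) (hinj : Function.Injective φ) :
    ∃ L : List (Gen (Forms (Set.range φ))), deRham.Sph L ∧
      L.map Gen.deg = (List.finRange k).map fun i => (n i : ℤ) := by
  obtain ⟨L, hL, hd⟩ := exists_sph_prodSet n hn (List.finRange k) (List.nodup_finRange k)
  have h1 := (continuous_flatten n).isClosedEmbedding (flatten_injective n)
  have h2 := hφ.isClosedEmbedding hinj
  have hmem : ∀ x ∈ sphereSet n, ∃ y, flatten n y = x := fun x hx => by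
    rwa [← range_flatten] at hx
  obtain ⟨L', hL', hd'⟩ := exists_sph_of_homeo (isOpen_prodSet n _) (sphereSet_subset n)
    (by rw [← range_flatten]; exact isCompact_range (continuous_flatten n)) (isCompact_range hφ)
    (normalizeMap n) (fun x hx => normalizeBlocks_mem n hx) (fun x hx => normalizeBlocks_eq n hx)
    (htpy_normalizeMap n)
    (φ := Function.extend (flatten n) φ 0) (ψ := Function.extend φ (flatten n) 0)
    (by rw [← range_flatten]; exact continuousOn_extend h1.isEmbedding hφ _)
    (continuousOn_extend h2.isEmbedding (continuous_flatten n) _)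
    (fun x hx => by
      obtain ⟨y, rfl⟩ := hmem x hx
      rw [(flatten_injective n).extend_apply]
      exact ⟨y, rfl⟩)
    (by
      rintro _ ⟨y, rfl⟩
      rw [hinj.extend_apply, ← range_flatten]
      exact ⟨y, rfl⟩)
    (by
      rintro _ ⟨y, rfl⟩
      rw [hinj.extend_apply, (flatten_injective n).extend_apply])
    (fun x hx => by
      obtain ⟨y, rfl⟩ := hmem x hx
      rw [(flatten_injective n).extend_apply, hinj.extend_apply]) L hL
  exact ⟨L', hL', hd'.trans hd⟩

end

end FreeToralRank

namespace FreeToralRank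

open Polynomial

open scoped TensorProduct Topology ContDiff
open Filter

set_option linter.unusedSectionVars false

section

variable {r : ℕ} {X : Type} [TopologicalSpace X] [CompactSpace X] [T2Space X] [FirstCountableTopology X]

/-- Averaging a Tietze extension of a character of an orbit gives a nonvanishing equivariant
function. -/
lemma exists_equivariant (ρ : (Fin r → Circle) →* Equiv.Perm X)
    (hcont : Continuous fun q : (Fin r → Circle) × X => ρ q.1 q.2)
    (hfree : ∀ g x, ρ g x = x → g = 1) (i : Fin r) (x₀ : X) :
    ∃ f : X → ℂ, Continuous f ∧ (∀ t x, f (ρ t x) = t i * f x) ∧ f x₀ ≠ 0 := by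
  have ho : Continuous fun t => ρ t x₀ := hcont.comp (by fun_prop : Continuous fun t => (t, x₀))
  have hinj : Function.Injective fun t => ρ t x₀ := by
    intro s t h
    have h1 : ρ (t⁻¹ * s) x₀ = x₀ := by
      rw [map_mul, Equiv.Perm.mul_apply]
      change ρ t⁻¹ ((fun t => ρ t x₀) s) = x₀
      rw [h]
      change (ρ t⁻¹ * ρ t) x₀ = x₀
      rw [← map_mul, inv_mul_cancel, map_one, Equiv.Perm.one_apply]
    exact (inv_mul_eq_one.1 (hfree _ _ h1)).symm
  obtain ⟨h, hh⟩ := ContinuousMap.exists_extension (ho.isClosedEmbedding hinj)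
    (⟨fun t => (t i : ℂ), continuous_subtype_val.comp (continuous_apply i)⟩ : C(Fin r → Circle, ℂ))
  have hh : ∀ t, h (ρ t x₀) = t i := fun t => DFunLike.congr_fun hh t
  let : MeasurableSpace (Fin r → Circle) := borel _
  have : BorelSpace (Fin r → Circle) := ⟨rfl⟩
  let μ : MeasureTheory.Measure (Fin r → Circle) := MeasureTheory.Measure.haarMeasure ⊤
  have hμ : MeasureTheory.IsProbabilityMeasure μ :=
    ⟨by have := MeasureTheory.Measure.haarMeasure_self (G := Fin r → Circle) (K₀ := ⊤)
        simpa using this⟩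
  refine ⟨fun x => ∫ t, ((t i)⁻¹ : Circle) * h (ρ t x) ∂μ, ?_, fun s x => ?_, ?_⟩
  · have : Continuous fun q : X × (Fin r → Circle) => (((q.2 i)⁻¹ : Circle) : ℂ) * h (ρ q.2 q.1) := by
      have h1 : Continuous fun q : X × (Fin r → Circle) => ρ q.2 q.1 := hcont.comp continuous_swap
      have h2 : Continuous fun q : X × (Fin r → Circle) => (q.2 i)⁻¹ := by fun_prop
      exact (continuous_subtype_val.comp h2).mul (h.continuous.comp h1)
    exact continuous_parametric_integral_of_continuous (μ := μ) this isCompact_univ |>.congr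
      fun x => by rw [MeasureTheory.Measure.restrict_univ]
  · rw [← MeasureTheory.integral_const_mul, ← MeasureTheory.integral_mul_left_eq_self
      (fun t : Fin r → Circle => (s i : ℂ) * (((t i)⁻¹ : Circle) * h (ρ t x))) s]
    refine MeasureTheory.integral_congr_ae (Eventually.of_forall fun t => ?_)
    change (((t i)⁻¹ : Circle) : ℂ) * h (ρ t (ρ s x)) =
      (s i : ℂ) * ((((s * t) i)⁻¹ : Circle) * h (ρ (s * t) x))
    have h1 : ρ (s * t) x = ρ t (ρ s x) := by
      rw [mul_comm, map_mul, Equiv.Perm.mul_apply]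
    have h2 : (s i : ℂ) * (((s * t) i)⁻¹ : Circle) = ((t i)⁻¹ : Circle) := by
      rw [← Circle.coe_mul, Pi.mul_apply, mul_inv, mul_inv_cancel_left]
    rw [h1, ← mul_assoc, h2]
  · have : ∀ t : Fin r → Circle, (((t i)⁻¹ : Circle) : ℂ) * h (ρ t x₀) = 1 := fun t => by
      rw [hh, ← Circle.coe_mul, inv_mul_cancel, Circle.coe_one]
    simp only [this, MeasureTheory.integral_const, MeasureTheory.probReal_univ, one_smul]
    exact one_ne_zero

/-- The phase of a complex number. -/
noncomputable def phase (z : ℂ) : Circle := Circle.exp z.arg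

lemma phase_eq {z : ℂ} (hz : z ≠ 0) : (phase z : ℂ) = z / ‖z‖ := by
  rw [phase, Circle.coe_exp, eq_div_iff (by simpa using hz), mul_comm]
  exact Complex.norm_mul_exp_arg_mul_I z

lemma phase_mul (t : Circle) {z : ℂ} (hz : z ≠ 0) : phase (t * z) = t * phase z := by
  apply Circle.ext
  rw [phase_eq (mul_ne_zero (Circle.coe_ne_zero t) hz), Circle.coe_mul, phase_eq hz, norm_mul,
    Circle.norm_coe, one_mul, mul_div_assoc]

lemma continuousAt_phase {z : ℂ} (hz : z ≠ 0) : ContinuousAt phase z := by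
  refine Topology.IsInducing.continuousAt_iff (Y := Circle) (f := phase)
    (g := fun w : Circle => (w : ℂ)) Topology.IsInducing.subtypeVal |>.2 ?_
  have h : (fun z : ℂ => z / (‖z‖ : ℂ)) =ᶠ[𝓝 z] (fun w => (phase w : ℂ)) := by
    filter_upwards [isOpen_ne.mem_nhds hz] with w hw using (phase_eq hw).symm
  refine ContinuousAt.congr ?_ h
  exact continuousAt_id.div (Complex.continuous_ofReal.comp continuous_norm).continuousAt
    (by simpa using hz)

/-- A free torus action on a compact subset of a Euclidean space embeds equivariantly in a unitary
representation, with coordinate characters separating the torus factors. -/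
theorem exists_equivariant_embedding (ρ : (Fin r → Circle) →* Equiv.Perm X)
    (hcont : Continuous fun q : (Fin r → Circle) × X => ρ q.1 q.2)
    (hfree : ∀ g x, ρ g x = x → g = 1) {E : Type} (c : E → X → ℝ) (hc : ∀ e, Continuous (c e))
    (hci : ∀ x y, (∀ e, c e x = c e y) → x = y) :
    ∃ (P : Type) (_ : Fintype P) (_ : DecidableEq P) (z : Fin r → P → X → ℂ) (F : P × E → X → ℝ),
      (∀ i p, Continuous (z i p)) ∧ (∀ q, Continuous (F q)) ∧
      (∀ t x i p, z i p (ρ t x) = t i * z i p x) ∧ (∀ t x q, F q (ρ t x) = F q x) ∧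
      (∀ x, ∃ p, ∀ i, z i p x ≠ 0) ∧
      ∀ x y, (∀ i p, z i p x = z i p y) → (∀ q, F q x = F q y) → x = y := by
  classical
  choose f hf hfe hf0 using exists_equivariant ρ hcont hfree
  obtain ⟨s, hs⟩ := isCompact_univ.elim_finite_subcover (fun x₀ : X => {x | ∀ i, f i x₀ x ≠ 0})
    (fun x₀ => by
      have : {x | ∀ i, f i x₀ x ≠ 0} = ⋂ i, {x | f i x₀ x ≠ 0} := by
        ext x
        simp
      rw [this]
      exact isOpen_iInter_of_finite fun i => isOpen_ne_fun (hf i x₀) continuous_const)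
    (fun x _ => Set.mem_iUnion.2 ⟨x, fun i => hf0 i x⟩)
  let z : Fin r → s → X → ℂ := fun i p => f i p
  let τ : s → X → Fin r → Circle := fun p x i => phase (z i p x)
  let F : s × E → X → ℝ := fun q x => (∏ i, ‖z i q.1 x‖) * c q.2 (ρ (τ q.1 x)⁻¹ x)
  have hτ : ∀ p x, (∀ i, z i p x ≠ 0) → ∀ t, τ p (ρ t x) = t * τ p x := by
    intro p x hx t
    funext i
    change phase (f i p (ρ t x)) = t i * phase (f i p x)
    rw [hfe, phase_mul _ (hx i)]
  refine ⟨s, inferInstance, inferInstance, z, F, fun i p => hf i p, fun q => ?_,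
    fun t x i p => hfe i p t x, fun t x q => ?_, fun x => ?_, fun x y hz hF => ?_⟩
  · rw [continuous_iff_continuousAt]
    intro x
    have hprod : Continuous fun x => ∏ i, ‖z i q.1 x‖ :=
      continuous_finsetProd _ fun i _ => (hf i q.1).norm
    by_cases hx : ∀ i, z i q.1 x ≠ 0
    · have h1 : ContinuousAt (τ q.1) x := continuousAt_pi.2 fun i =>
        (continuousAt_phase (hx i)).comp_of_eq (hf i q.1).continuousAt rfl
      exact hprod.continuousAt.mul ((hc q.2).continuousAt.comp
        (hcont.continuousAt.comp (h1.inv.prodMk continuousAt_id)))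
    · push Not at hx
      obtain ⟨i, hi⟩ := hx
      have hx0 : ∏ i, ‖z i q.1 x‖ = 0 :=
        Finset.prod_eq_zero (Finset.mem_univ i) (by rw [hi, norm_zero])
      obtain ⟨C, hC⟩ := isCompact_univ.exists_bound_of_continuousOn (hc q.2).continuousOn
      have h1 : Tendsto (fun x => (∏ i, ‖z i q.1 x‖) * C) (𝓝 x) (𝓝 0) := by
        have := (hprod.mul (continuous_const (y := C))).tendsto x
        change Tendsto _ _ (𝓝 ((∏ i, ‖z i q.1 x‖) * C)) at this
        rwa [hx0, zero_mul] at this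
      change Tendsto (F q) (𝓝 x) (𝓝 ((∏ i, ‖z i q.1 x‖) * _))
      rw [hx0, zero_mul]
      refine squeeze_zero_norm (fun y => ?_) h1
      have h2 : 0 ≤ ∏ i, ‖z i q.1 y‖ := Finset.prod_nonneg fun _ _ => norm_nonneg _
      rw [norm_mul, Real.norm_of_nonneg h2]
      exact mul_le_mul_of_nonneg_left (hC _ (Set.mem_univ _)) h2
  · have h1 : ∏ i, ‖z i q.1 (ρ t x)‖ = ∏ i, ‖z i q.1 x‖ := by
      refine Finset.prod_congr rfl fun i _ => ?_
      change ‖f i q.1 (ρ t x)‖ = ‖f i q.1 x‖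
      rw [hfe, norm_mul, Circle.norm_coe, one_mul]
    change (∏ i, ‖z i q.1 (ρ t x)‖) * c q.2 (ρ (τ q.1 (ρ t x))⁻¹ (ρ t x)) =
      (∏ i, ‖z i q.1 x‖) * c q.2 (ρ (τ q.1 x)⁻¹ x)
    rw [h1]
    by_cases hx : ∀ i, z i q.1 x ≠ 0
    · rw [hτ q.1 x hx t, ← Equiv.Perm.mul_apply, ← map_mul, mul_inv, mul_comm t⁻¹, mul_assoc,
        inv_mul_cancel, mul_one]
    · push Not at hx
      obtain ⟨i, hi⟩ := hx
      rw [Finset.prod_eq_zero (Finset.mem_univ i) (by rw [hi, norm_zero]), zero_mul, zero_mul]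
  · obtain ⟨p, hp⟩ := Set.mem_iUnion.1 (hs (Set.mem_univ x))
    obtain ⟨hp, hx⟩ := Set.mem_iUnion.1 hp
    exact ⟨⟨p, hp⟩, hx⟩
  · obtain ⟨p, hp⟩ := Set.mem_iUnion.1 (hs (Set.mem_univ x))
    obtain ⟨hp, hx⟩ := Set.mem_iUnion.1 hp
    have h1 : ∀ i, z i ⟨p, hp⟩ y = z i ⟨p, hp⟩ x := fun i => (hz i _).symm
    have h2 : τ ⟨p, hp⟩ y = τ ⟨p, hp⟩ x := funext fun i => congrArg phase (h1 i)
    have h3 : ρ (τ ⟨p, hp⟩ x)⁻¹ x = ρ (τ ⟨p, hp⟩ x)⁻¹ y := by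
      refine hci _ _ fun e => ?_
      have := hF (⟨p, hp⟩, e)
      simp only [F, h1, h2] at this
      exact mul_left_cancel₀ (Finset.prod_ne_zero_iff.2 fun i _ => norm_ne_zero_iff.2 (hx i)) this
    exact (ρ _).injective h3

end

end FreeToralRank

namespace FreeToralRank

open Polynomial

open scoped TensorProduct Topology ContDiff
open Filter

set_option linter.unusedSectionVars false

section

variable {ι κ : Type} [Fintype ι] [DecidableEq ι] [Fintype κ] [DecidableEq κ]
  {K : Set (ι → ℝ)} {K' : Set (κ → ℝ)}

lemma smoothNear_ofReal {f : (ι → ℝ) → ℝ} (hf : ContDiff ℝ ∞ f) :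
    SmoothNear K fun x => (f x : ℂ) :=
  Eventually.of_forall fun _ => (Complex.ofRealCLM.contDiff.comp hf).contDiffAt

/-- The germs of the components of a vector field. -/
noncomputable def vfield (K : Set (ι → ℝ)) (V : (ι → ℝ) → ι → ℝ) (hV : ContDiff ℝ ∞ V) (i : ι) :
    SGerm K :=
  germ (fun x => (V x i : ℂ)) (smoothNear_ofReal (contDiff_pi.1 hV i))

lemma sum_vfield_pd {V : (ι → ℝ) → ι → ℝ} (hV : ContDiff ℝ ∞ V) {f W : (ι → ℝ) → ℝ}
    (hf : SmoothNear K fun x => (f x : ℂ)) (hW : SmoothNear K fun x => (W x : ℂ))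
    (e : ∀ᶠ x in 𝓝ˢ K, DifferentiableAt ℝ f x ∧ HasLineDerivAt ℝ f (W x) x (V x)) :
    ∑ l, vfield K V hV l * DiffRing.pd l (germ _ hf) = germ _ hW := by
  simp only [pd_germ, vfield, germ_mul]
  rw [germ_sum, germ_eq]
  filter_upwards [e] with x hx
  have h1 : fderiv ℝ f x (V x) = W x :=
    (hx.1.hasFDerivAt.hasLineDerivAt (V x)).unique hx.2
  have h2 : ∀ l, pderivFun l (fun x => (f x : ℂ)) x = (fderiv ℝ f x (Pi.single l 1) : ℂ) := by
    intro l
    have h3 : HasFDerivAt (fun x => (f x : ℂ)) (Complex.ofRealCLM.comp (fderiv ℝ f x)) x :=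
      Complex.ofRealCLM.hasFDerivAt.comp x hx.1.hasFDerivAt
    rw [pderivFun, h3.fderiv]
    rfl
  rw [Finset.sum_apply, ← h1]
  conv_rhs => rw [pi_eq_sum_univ' (V x)]
  rw [map_sum, Complex.ofReal_sum]
  refine Finset.sum_congr rfl fun l _ => ?_
  rw [Pi.mul_apply, h2, map_smul, smul_eq_mul, Complex.ofReal_mul]

/-- Pullbacks intertwine contractions with related vector fields. -/
lemma SMap.pb_octr (h : SMap K' K) {V : (ι → ℝ) → ι → ℝ} (hV : ContDiff ℝ ∞ V)
    {V' : (κ → ℝ) → κ → ℝ} (hV' : ContDiff ℝ ∞ V') (hh : ContDiff ℝ ∞ h.toFun)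
    (e : ∀ z, HasLineDerivAt ℝ h.toFun (V (h.toFun z)) z (V' z)) (a : Forms K) :
    h.pb (octr (vfield K V hV) a) = octr (vfield K' V' hV') (h.pb a) := by
  refine pull_octr (fun i => ?_) a
  have hs : ContDiff ℝ ∞ fun z => V (h.toFun z) i := (contDiff_pi.1 hV i).comp hh
  rw [vfield, SMap.germ_germ]
  refine (sum_vfield_pd hV' (h.smooth_coord i) (smoothNear_ofReal hs)
    (Eventually.of_forall fun z => ⟨?_, ?_⟩)).symm
  · exact (contDiff_pi.1 hh i).differentiable (by simp) z
  · exact hasDerivAt_pi.1 (e z) i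

variable (B : (ι → ℝ) →L[ℝ] ι → ℝ)

/-- The flow of a linear vector field with `B ^ 3 = -B`. -/
noncomputable def rot (s : ℝ) (x : ι → ℝ) : ι → ℝ :=
  x + Real.sin (2 * Real.pi * s) • B x + (1 - Real.cos (2 * Real.pi * s)) • B (B x)

/-- The velocity of the flow. -/
noncomputable def rotField (x : ι → ℝ) : ι → ℝ := (2 * Real.pi) • B x

lemma contDiff_rotField : ContDiff ℝ ∞ (rotField B) := B.contDiff.const_smul _

/-- The contraction with the velocity of the flow. -/
noncomputable abbrev rotV (K : Set (ι → ℝ)) : ι → SGerm K :=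
  vfield K (rotField B) (contDiff_rotField B)

lemma olie_octr_rot {B B' : (ι → ℝ) →L[ℝ] ι → ℝ} (h : ∀ x, B (B' x) = B' (B x)) (a : Forms K) :
    olie (rotV B K) (octr (rotV B' K) a) = octr (rotV B' K) (olie (rotV B K) a) := by
  have key : ∀ (B B' : (ι → ℝ) →L[ℝ] ι → ℝ) (k : ι) (hs : SmoothNear K fun x =>
      ((rotField B' (rotField B x) k : ℝ) : ℂ)),
      ∑ l, rotV B K l * DiffRing.pd l (rotV B' K k) = germ _ hs := by
    intro B B' k hs
    refine sum_vfield_pd _ _ _ (Eventually.of_forall fun x => ⟨?_, ?_⟩)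
    · exact (contDiff_pi.1 (contDiff_rotField B') k).differentiable (by simp) x
    · have h1 : HasFDerivAt (rotField B') ((2 * Real.pi) • B') x :=
        ((2 * Real.pi) • B').hasFDerivAt
      exact hasDerivAt_pi.1 (h1.hasLineDerivAt (rotField B x)) k
  have hs : ∀ (B B' : (ι → ℝ) →L[ℝ] ι → ℝ) (k : ι), SmoothNear K fun x =>
      ((rotField B' (rotField B x) k : ℝ) : ℂ) := fun B B' k =>
    smoothNear_ofReal (contDiff_pi.1 ((contDiff_rotField B').comp (contDiff_rotField B)) k)
  refine olie_octr (fun k => ?_) a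
  rw [key B B' k (hs _ _ k), key B' B k (hs _ _ k), germ_eq]
  refine Eventually.of_forall fun x => ?_
  simp only [rotField, map_smul, h]

variable {B}

lemma contDiff_rot : ContDiff ℝ ∞ fun z : Option ι → ℝ => rot B (z none) fun i => z (some i) := by
  have h1 : ContDiff ℝ ∞ fun (z : Option ι → ℝ) i => z (some i) :=
    contDiff_pi.2 fun i => contDiff_apply ℝ ℝ (some i)
  have h2 : ContDiff ℝ ∞ fun z : Option ι → ℝ => 2 * Real.pi * z none :=
    contDiff_const.mul (contDiff_apply ℝ ℝ none)
  exact (h1.add (h2.sin.smul (B.contDiff.comp h1))).add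
    ((contDiff_const.sub h2.cos).smul (B.contDiff.comp (B.contDiff.comp h1)))

/-- The flow as a map from the cylinder. -/
noncomputable def rotMap (hK : ∀ s, ∀ x ∈ K, rot B s x ∈ K) : SMap (cyl K) K where
  toFun z := rot B (z none) fun i => z (some i)
  smooth := Eventually.of_forall fun _ => contDiff_rot.contDiffAt
  maps _ hz := hK _ _ hz.1

/-- The horizontal lift of a linear field to the cylinder. -/
noncomputable def liftField (B' : (ι → ℝ) →L[ℝ] ι → ℝ) (z : Option ι → ℝ) : Option ι → ℝ :=
  join 0 (rotField B' fun i => z (some i))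

lemma contDiff_liftField (B' : (ι → ℝ) →L[ℝ] ι → ℝ) : ContDiff ℝ ∞ (liftField B') := by
  refine contDiff_pi.2 fun o => ?_
  cases o with
  | none => exact contDiff_const
  | some i => exact contDiff_pi.1 ((contDiff_rotField B').comp
      (contDiff_pi.2 fun i => contDiff_apply ℝ ℝ (some i))) i

lemma rotMap_pb_lift (hK : ∀ s, ∀ x ∈ K, rot B s x ∈ K) {B' : (ι → ℝ) →L[ℝ] ι → ℝ}
    (h : ∀ x, B (B' x) = B' (B x)) (a : Forms K) :
    (rotMap hK).pb (octr (rotV B' K) a) =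
      octr (vfield (cyl K) (liftField B') (contDiff_liftField B')) ((rotMap hK).pb a) := by
  refine SMap.pb_octr _ _ _ contDiff_rot (fun z => ?_) a
  set x : ι → ℝ := fun i => z (some i)
  have e : ∀ t : ℝ, (rotMap hK).toFun (z + t • liftField B' z) =
      rot B (z none) x + t • rotField B' (rot B (z none) x) := by
    intro t
    have h1 : (fun i => (z + t • liftField B' z) (some i)) = x + t • rotField B' x := rfl
    have h2 : (z + t • liftField B' z) none = z none := by
      change z none + t * 0 = z none
      ring
    change rot B ((z + t • liftField B' z) none) (fun i => (z + t • liftField B' z) (some i)) = _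
    rw [h1, h2]
    simp only [rot, rotField, map_add, map_smul, h]
    module
  change HasDerivAt (fun t : ℝ => (rotMap hK).toFun (z + t • liftField B' z)) _ 0
  simp only [e]
  have h1 := ((hasDerivAt_id (0 : ℝ)).smul_const (rotField B' (rot B (z none) x))).const_add
    (rot B (z none) x)
  rw [one_smul] at h1
  exact h1

lemma vfield_single {K : Set (κ → ℝ)} (i : κ) :
    vfield K (fun _ => Pi.single i 1) contDiff_const = Pi.single i 1 := by
  funext j
  rw [vfield]
  by_cases h : j = i
  · subst h
    simp only [Pi.single_eq_same]
    rw [← germ_one, germ_eq]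
    exact Eventually.of_forall fun _ => Complex.ofReal_one
  · simp only [Pi.single_eq_of_ne h]
    rw [← germ_zero, germ_eq]
    exact Eventually.of_forall fun _ => Complex.ofReal_zero

lemma rotMap_pb_vertical (hK : ∀ s, ∀ x ∈ K, rot B s x ∈ K) (hB : ∀ x, B (B (B x)) = -B x)
    (a : Forms K) :
    (rotMap hK).pb (octr (rotV B K) a) = octr (Pi.single none 1) ((rotMap hK).pb a) := by
  rw [← vfield_single]
  refine SMap.pb_octr _ _ _ contDiff_rot (fun z => ?_) a
  set x : ι → ℝ := fun i => z (some i)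
  have e : ∀ t : ℝ, (rotMap hK).toFun (z + t • Pi.single none 1) = rot B (z none + t) x := by
    intro t
    have h1 : (fun i => (z + t • Pi.single none 1 : Option ι → ℝ) (some i)) = x := by
      funext i
      simp [x]
    have h2 : (z + t • Pi.single none 1 : Option ι → ℝ) none = z none + t := by simp
    change rot B ((z + t • Pi.single none 1 : Option ι → ℝ) none)
      (fun i => (z + t • Pi.single none 1 : Option ι → ℝ) (some i)) = _
    rw [h1, h2]
  change HasDerivAt (fun t : ℝ => (rotMap hK).toFun (z + t • Pi.single none 1)) _ 0
  simp only [e]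
  change HasDerivAt (fun t : ℝ => rot B (z none + t) x) (rotField B (rot B (z none) x)) 0
  have h0 : HasDerivAt (fun t : ℝ => 2 * Real.pi * (z none + t)) (2 * Real.pi * 1) 0 :=
    ((hasDerivAt_id (0 : ℝ)).const_add (z none)).const_mul (2 * Real.pi)
  have h1 := ((h0.sin.smul_const (B x)).const_add x).add
    ((h0.cos.const_sub 1).smul_const (B (B x)))
  refine h1.congr_deriv ?_
  simp only [rot, rotField, map_add, map_smul, hB, add_zero]
  module

end

end FreeToralRank

namespace FreeToralRank

open Polynomial

open scoped TensorProduct Topology ContDiff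
open Filter

set_option linter.unusedSectionVars false

section

variable {ι : Type} [Fintype ι] [DecidableEq ι] {K : Set (ι → ℝ)} {B : (ι → ℝ) →L[ℝ] ι → ℝ}

lemma rotMap_pb_olie (hK : ∀ s, ∀ x ∈ K, rot B s x ∈ K) (hB : ∀ x, B (B (B x)) = -B x)
    (a : Forms K) :
    (rotMap hK).pb (olie (rotV B K) a) = olie (Pi.single none 1) ((rotMap hK).pb a) := by
  rw [olie_apply, olie_apply, map_add, SMap.pb_od, rotMap_pb_vertical hK hB, ← SMap.pb_od,
    rotMap_pb_vertical hK hB, SMap.pb_od]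

lemma rotMap_slice (hK : ∀ s, ∀ x ∈ K, rot B s x ∈ K) {s : ℝ} (hs : s ∈ Set.Icc (0 : ℝ) 1)
    (h1 : Real.sin (2 * Real.pi * s) = 0) (h2 : Real.cos (2 * Real.pi * s) = 1) (a : Forms K) :
    fib (sliceMap K s hs).germ.toLinearMap ((rotMap hK).pb a) = a := by
  rw [← slice_eq_fib, slice_eq_pb, ← SMap.pb_comp]
  refine SMap.pb_of_eq_id _ (Eventually.of_forall fun x => ?_) a
  change rot B s x = x
  rw [rot, h1, h2]
  simp

/-- The homotopy operator that averages forms over a periodic linear flow. -/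
lemma exists_average (hK : ∀ s, ∀ x ∈ K, rot B s x ∈ K) (hB : ∀ x, B (B (B x)) = -B x) :
    ∃ N : Forms K →ₗ[ℂ] Forms K, (∀ a, N (od a) = od (N a)) ∧
      (∀ m a, N (opr m a) = opr m (N a)) ∧
      (∀ B' : (ι → ℝ) →L[ℝ] ι → ℝ, (∀ x, B (B' x) = B' (B x)) →
        ∀ a, N (octr (rotV B' K) a) = octr (rotV B' K) (N a)) ∧
      ∀ a, olie (rotV B K) (a + N (olie (rotV B K) a)) = 0 := by
  have hu : Continuous fun s : ℝ => (1 : ℂ) - s := by fun_prop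
  let u := intGerm (K := K) (fun s => 1 - s) hu
  let w := intGerm (K := K) (fun _ => 1) continuous_const
  have hod : ∀ a, fib u ((rotMap hK).pb (od a)) = od (fib u ((rotMap hK).pb a)) := fun a => by
    rw [SMap.pb_od, fib_od (fun i f => pd_intGerm _ i f)]
  have hoctr : ∀ B' : (ι → ℝ) →L[ℝ] ι → ℝ, (∀ x, B (B' x) = B' (B x)) → ∀ a,
      fib u ((rotMap hK).pb (octr (rotV B' K) a)) =
        octr (rotV B' K) (fib u ((rotMap hK).pb a)) := by
    intro B' h a
    rw [rotMap_pb_lift hK h]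
    refine fib_octr ?_ (fun i f => ?_) _
    · rw [vfield, ← germ_zero, germ_eq]
      exact Eventually.of_forall fun _ => Complex.ofReal_zero
    · rw [← intGerm_proj_mul]
      refine congrArg (fun t => intGerm _ hu (t * f)) ?_
      have e := (cylProj K).germ_germ (f := fun x => (rotField B' x i : ℂ))
        (smoothNear_ofReal (contDiff_pi.1 (contDiff_rotField B') i))
      exact e.symm
  have hav : ∀ a, a + fib u ((rotMap hK).pb (olie (rotV B K) a)) =
      fib w ((rotMap hK).pb a) := by
    intro a
    rw [rotMap_pb_olie hK hB, fib_olie u (w - (sliceMap K 0 zero_mem_unit).germ.toLinearMap)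
      (fun f => intGerm_none' f)]
    have h2 : ∀ b : Forms (cyl K),
        fib (ι := ι) (w - (sliceMap K 0 zero_mem_unit).germ.toLinearMap) b =
        fib w b - fib (sliceMap K 0 zero_mem_unit).germ.toLinearMap b := by
      intro b
      rw [← LinearMap.sub_apply]
      refine LinearMap.congr_fun (om_ext fun f w => ?_) b
      simp [TensorProduct.sub_tmul]
    rw [h2, rotMap_slice hK _ (by simp) (by simp)]
    abel
  have hlie : ∀ a, fib u ((rotMap hK).pb (olie (rotV B K) a)) =
      olie (rotV B K) (fib u ((rotMap hK).pb a)) := fun a => by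
    rw [olie_apply, olie_apply, map_add, map_add, hod, hoctr B (fun _ => rfl),
      hoctr B (fun _ => rfl), hod]
  refine ⟨fib u ∘ₗ (rotMap hK).pb.toLinearMap, hod, fun m a => ?_, hoctr, fun a => ?_⟩
  · change fib u ((rotMap hK).pb (opr m a)) = opr m (fib u ((rotMap hK).pb a))
    rw [SMap.pb_opr, fib_opr]
  · change olie (rotV B K) (a + fib u ((rotMap hK).pb (olie (rotV B K) a))) = 0
    rw [map_add, ← hlie, hav, rotMap_pb_olie hK hB,
      fib_olie w ((sliceMap K 1 one_mem_unit).germ.toLinearMap -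
        (sliceMap K 0 zero_mem_unit).germ.toLinearMap) (fun f => intGerm_none f)]
    have h2 : ∀ b : Forms (cyl K),
        fib (ι := ι) ((sliceMap K 1 one_mem_unit).germ.toLinearMap -
          (sliceMap K 0 zero_mem_unit).germ.toLinearMap) b =
        fib (sliceMap K 1 one_mem_unit).germ.toLinearMap b -
          fib (sliceMap K 0 zero_mem_unit).germ.toLinearMap b := by
      intro b
      rw [← LinearMap.sub_apply]
      refine LinearMap.congr_fun (om_ext fun f w => ?_) b
      simp [TensorProduct.sub_tmul]
    rw [h2, rotMap_slice hK _ (by simp) (by simp), rotMap_slice hK _ (by simp) (by simp), sub_self]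

/-- The averaging operator of a finite family of commuting periodic linear flows. -/
lemma exists_average_family {σ : Type} (B : σ → (ι → ℝ) →L[ℝ] ι → ℝ)
    (hK : ∀ i, ∀ s, ∀ x ∈ K, rot (B i) s x ∈ K) (hB : ∀ i x, B i (B i (B i x)) = -B i x)
    (hc : ∀ i j x, B i (B j x) = B j (B i x)) (l : List σ) :
    ∃ Av J : Forms K →ₗ[ℂ] Forms K, (∀ a, Av (od a) = od (Av a)) ∧
      (∀ m a, Av (opr m a) = opr m (Av a)) ∧
      (∀ j a, Av (octr (rotV (B j) K) a) = octr (rotV (B j) K) (Av a)) ∧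
      (∀ a, (∀ i, olie (rotV (B i) K) a = 0) → Av a = a) ∧
      (∀ a, Av a - a = od (J a) + J (od a)) ∧ ∀ i ∈ l, ∀ a, olie (rotV (B i) K) (Av a) = 0 := by
  induction l with
  | nil => exact ⟨LinearMap.id, 0, by simp, by simp, by simp, by simp, by simp, by simp⟩
  | cons i l ih =>
    obtain ⟨Av, J, h1, h2, h3, h4, h5, h6⟩ := ih
    obtain ⟨N, n1, n2, n3, n4⟩ := exists_average (hK i) (hB i)
    set L := olie (rotV (B i) K) with hL
    have n3' := fun j => n3 (B j) (hc i j)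
    have hLod : ∀ a, L (od a) = od (L a) := olie_od _
    have hLoctr : ∀ j a, L (octr (rotV (B j) K) a) = octr (rotV (B j) K) (L a) := fun j =>
      olie_octr_rot (hc i j)
    refine ⟨Av + N ∘ₗ L ∘ₗ Av, J + N ∘ₗ octr (rotV (B i) K) ∘ₗ Av, fun a => ?_, fun m a => ?_,
      fun j a => ?_, fun a ha => ?_, fun a => ?_, fun j hj a => ?_⟩
    · simp only [LinearMap.add_apply, LinearMap.comp_apply, h1, hLod, n1, map_add]
    · simp only [LinearMap.add_apply, LinearMap.comp_apply, h2, hL, olie_opr, n2, map_add]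
    · simp only [LinearMap.add_apply, LinearMap.comp_apply, h3, hLoctr, n3', map_add]
    · simp only [LinearMap.add_apply, LinearMap.comp_apply, h4 a ha, hL, ha i, map_zero, add_zero]
    · have := h5 a
      simp only [LinearMap.add_apply, LinearMap.comp_apply, hL, olie_apply, map_add, n1, h1]
      rw [add_sub_right_comm, this]
      abel
    · simp only [LinearMap.add_apply, LinearMap.comp_apply]
      rcases List.mem_cons.1 hj with rfl | hj
      · exact n4 (Av a)
      · have e : ∀ b, olie (rotV (B j) K) (N (L b)) = N (L (olie (rotV (B j) K) b)) := fun b => by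
          simp only [olie_apply, map_add, n1, n3', hLod, hLoctr]
        rw [map_add, e, h6 j hj, map_zero, map_zero, add_zero]

end

end FreeToralRank

namespace FreeToralRank

open Polynomial

open scoped TensorProduct Topology ContDiff
open Filter

set_option linter.unusedSectionVars false

namespace Stage

section

variable {σ σ' A : Type} [Ring A] [Algebra ℂ A] {T : Stage σ A}

lemma d_mul_closed {X : A} (hX : T.D 0 X = 0) (b : A) : T.D 0 (b * X) = T.D 0 b * X := by
  rw [T.D_mul, hX, mul_zero, add_zero]

lemma closed_mul_d {X : A} (hX : T.D 0 X = 0) (b : A) : X * T.D 0 b = T.D 0 (T.ε X * b) := by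
  rw [T.D_mul, T.D_ε, hX, T.εε]
  simp

/-- Replacing the generators by cohomologous ones does not change the classes of monomials. -/
lemma exists_coef_of_cohomologous {L' L : List (Gen A)}
    (h : List.Forall₂ (fun g' g : Gen A => ∃ b, g'.w = g.w + T.D 0 b) L' L)
    (hL' : ∀ g ∈ L', T.D 0 g.w = 0) (hL : ∀ g ∈ L, T.D 0 g.w = 0) :
    ∃ φ : Coef L'.length → Coef L.length, Function.Surjective φ ∧ (∀ c, φ c = 0 → c = 0) ∧
      ∀ c, T.D 0 (evalC L' c) = 0 ∧ ∃ b, evalC L' c = evalC L (φ c) + T.D 0 b := by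
  induction h with
  | nil => exact ⟨id, Function.surjective_id, fun _ h => h, fun c => ⟨T.D_algebraMap _ _, 0, by simp⟩⟩
  | @cons g' g L' L hg h ih =>
    obtain ⟨φ, h1, h2, h3⟩ := ih (fun g hg => hL' g (by simp [hg])) fun g hg => hL g (by simp [hg])
    obtain ⟨b, hb⟩ := hg
    refine ⟨fun c => (φ c.1, φ c.2), fun c => ?_, fun c hc => ?_, fun c => ⟨?_, ?_⟩⟩
    · obtain ⟨c1, hc1⟩ := h1 c.1
      obtain ⟨c2, hc2⟩ := h1 c.2
      exact ⟨(c1, c2), Prod.ext hc1 hc2⟩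
    · exact Prod.ext (h2 _ (congrArg Prod.fst hc)) (h2 _ (congrArg Prod.snd hc))
    · change T.D 0 (evalC L' c.1 + g'.w * evalC L' c.2) = 0
      rw [map_add, (h3 _).1, d_mul_closed (h3 _).1, hL' g' (by simp)]
      simp
    · obtain ⟨b1, e1⟩ := (h3 c.1).2
      obtain ⟨b2, e2⟩ := (h3 c.2).2
      refine ⟨b1 + T.ε g.w * b2 + b * evalC L' c.2, ?_⟩
      change evalC L' c.1 + g'.w * evalC L' c.2 =
        evalC L (φ c.1) + g.w * evalC L (φ c.2) + T.D 0 _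
      rw [map_add, map_add, d_mul_closed (h3 _).1, ← closed_mul_d (hL g (by simp)), hb, e1, add_mul,
        e2]
      noncomm_ring

/-- A presentation of the cohomology descends to a homotopically averaged subalgebra. -/
lemma Sph.average {L : List (Gen A)} (hL : T.Sph L) {B : Subalgebra ℂ A} {T' : Stage σ' B}
    (hD : ∀ b, (T'.D 0 b : A) = T.D 0 b) (hpr : ∀ m b, (T'.pr m b : A) = T.pr m b)
    {Av J : A →ₗ[ℂ] A} (h1 : ∀ a, Av (T.D 0 a) = T.D 0 (Av a))
    (h2 : ∀ m a, Av (T.pr m a) = T.pr m (Av a)) (h3 : ∀ a ∈ B, Av a = a)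
    (h4 : ∀ a, Av a - a = T.D 0 (J a) + J (T.D 0 a)) (h5 : ∀ a, Av a ∈ B) :
    ∃ L' : List (Gen B), T'.Sph L' ∧ L'.map Gen.deg = L.map Gen.deg := by
  have key : ∀ g, T.IsGen g → ∃ g' : Gen B, T'.IsGen g' ∧ g'.deg = g.deg ∧
      ∃ b, (g'.w : A) = g.w + T.D 0 b := by
    intro g hg
    have hw : Av g.w = g.w + T.D 0 (J g.w) := by
      have := h4 g.w
      rw [hg.closed, map_zero, add_zero] at this
      rw [← this]
      abel
    have hAv : T.D 0 (Av g.w) = 0 := by rw [← h1, hg.closed, map_zero]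
    set e1 := g.e + T.ε g.w * J g.w + J g.w * Av g.w with he1
    refine ⟨⟨⟨Av g.w, h5 _⟩, ⟨Av (T.pr (2 * g.deg - 1) e1), h5 _⟩, g.deg⟩,
      ⟨Subtype.ext ?_, Subtype.ext ?_, hg.pos, fun he => Subtype.ext ?_, fun _ => Subtype.ext ?_⟩,
      rfl, J g.w, hw⟩
    · rw [hD]
      exact hAv
    · rw [hpr]
      exact (h2 _ _).symm.trans (congrArg Av hg.homog)
    · rw [hD]
      change T.D 0 (Av (T.pr (2 * g.deg - 1) e1)) = Av g.w * Av g.w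
      have hsq : T.D 0 e1 = Av g.w * Av g.w := by
        rw [he1, map_add, map_add, hg.sq he, d_mul_closed hAv, ← closed_mul_d hg.closed]
        conv_rhs => rw [hw]
        rw [hw]
        noncomm_ring
      have hh : T.pr g.deg (Av g.w) = Av g.w := by rw [← h2, hg.homog]
      rw [← h1, T.d_pr, hsq, T.pr_mul _ _ _ _ hh, show 2 * g.deg - 1 + 1 - g.deg = g.deg by ring,
        hh]
      have := mul_mem (h5 g.w) (h5 g.w)
      exact h3 _ this
    · rw [hpr]
      change T.pr _ (Av (T.pr _ e1)) = Av (T.pr _ e1)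
      rw [← h2, T.pr_pr]
  have key2 : ∀ L : List (Gen A), (∀ g ∈ L, T.IsGen g) → ∃ L' : List (Gen B),
      (∀ g ∈ L', T'.IsGen g) ∧ L'.map Gen.deg = L.map Gen.deg ∧
      List.Forall₂ (fun g' g : Gen A => ∃ b, g'.w = g.w + T.D 0 b) (L'.map (Gen.map B.val)) L := by
    intro L
    induction L with
    | nil => exact fun _ => ⟨[], by simp, rfl, List.Forall₂.nil⟩
    | cons g L ih =>
      intro hL
      obtain ⟨L', i1, i2, i3⟩ := ih fun g hg => hL g (by simp [hg])
      obtain ⟨g', j1, j2, j3⟩ := key g (hL g (by simp))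
      refine ⟨g' :: L', ?_, by simp [i2, j2], List.Forall₂.cons j3 i3⟩
      simpa using ⟨j1, i1⟩
  obtain ⟨L', i1, i2, i3⟩ := key2 L hL.gen
  have hcl : ∀ g ∈ L'.map (Gen.map B.val), T.D 0 g.w = 0 := by
    intro g hg
    obtain ⟨g', hg', rfl⟩ := List.mem_map.1 hg
    exact (hD g'.w).symm.trans (congrArg Subtype.val (i1 g' hg').closed)
  obtain ⟨φ, p1, p2, p3⟩ := exists_coef_of_cohomologous i3 hcl fun g hg => (hL.gen g hg).closed
  have hval : ∀ (L' : List (Gen B)), ∃ ψ : Coef L'.length → Coef (L'.map (Gen.map B.val)).length,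
      (∀ c, evalC (L'.map (Gen.map B.val)) (ψ c) = ((evalC L' c : B) : A)) ∧ Function.Surjective ψ ∧
      ∀ c, ψ c = 0 → c = 0 := by
    intro L'
    induction L' with
    | nil => exact ⟨id, fun _ => rfl, Function.surjective_id, fun _ h => h⟩
    | cons g L ih =>
      obtain ⟨φ, h1, h2, h3⟩ := ih
      refine ⟨fun c => (φ c.1, φ c.2), fun c => ?_, fun c => ?_, fun c hc =>
        Prod.ext (h3 _ (congrArg Prod.fst hc)) (h3 _ (congrArg Prod.snd hc))⟩
      · exact congrArg₂ (fun a b => a + (g.w : A) * b) (h1 c.1) (h1 c.2)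
      · obtain ⟨c1, hc1⟩ := h2 c.1
        obtain ⟨c2, hc2⟩ := h2 c.2
        exact ⟨(c1, c2), Prod.ext hc1 hc2⟩
  obtain ⟨ψ, q1, q2, q3⟩ := hval L'
  refine ⟨L', ⟨i1, fun a ha => ?_, fun c b hcb => ?_⟩, i2⟩
  · obtain ⟨c, b, h⟩ := hL.span (a : A) (by rw [← hD, ha]; rfl)
    obtain ⟨c, rfl⟩ := p1 c
    obtain ⟨c, rfl⟩ := q2 c
    obtain ⟨b', hb'⟩ := (p3 (ψ c)).2
    refine ⟨c, ⟨Av (b - b'), h5 _⟩, Subtype.ext ?_⟩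
    change (a : A) = ((evalC L' c : B) : A) + (T'.D 0 ⟨Av (b - b'), h5 _⟩ : A)
    rw [hD]
    change (a : A) = ((evalC L' c : B) : A) + T.D 0 (Av (b - b'))
    have e : T.D 0 (b - b') = (a : A) - (evalC L' c : B) := by
      rw [map_sub, h, ← q1, hb']
      abel
    have hm : (a : A) - (evalC L' c : B) ∈ B := sub_mem a.2 (evalC L' c).2
    rw [← h1, e, h3 _ hm]
    abel
  · obtain ⟨b', hb'⟩ := (p3 (ψ c)).2
    refine q3 c (p2 _ (hL.ind _ (b - b') ?_))
    rw [map_sub, ← hD, ← hcb, ← q1, hb']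
    abel

end

end Stage

end FreeToralRank

namespace FreeToralRank

open Polynomial

open scoped TensorProduct Topology ContDiff
open Filter

set_option linter.unusedSectionVars false

lemma Stage.exists_primitive_one {σ A : Type} [Ring A] [Algebra ℂ A] (T : Stage σ A)
    {p : σ → ℂ} (hsq : ∀ a, T.D p (T.D p a) = 0) {N : ℕ} (hN : ∀ m a, (N : ℤ) < m → T.pr m a = 0)
    {θ : A} (h1 : T.pr 1 θ = θ) (h2 : T.D p θ = 1 + T.D 0 θ) : ∃ b, T.D p b = 1 := by
  set u := -T.D 0 θ with hu
  have hu2 : T.pr 2 u = u := by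
    rw [hu, map_neg]
    conv_rhs => rw [← h1, T.d_pr]
    norm_num
  have hD : T.D p θ = 1 - u := by rw [h2, hu, sub_neg_eq_add]
  have hDu : T.D p u = 0 := by
    have := hsq θ
    rw [hD, map_sub, T.D_one, zero_sub] at this
    exact neg_eq_zero.1 this
  have hDpow : ∀ n : ℕ, T.D p (u ^ n) = 0 := by
    intro n
    induction n with
    | zero => rw [pow_zero, T.D_one]
    | succ n ih => rw [pow_succ, T.D_mul, ih, hDu, zero_mul, mul_zero, add_zero]
  have hpow : ∀ n : ℕ, T.pr (2 * n) (u ^ n) = u ^ n := by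
    intro n
    induction n with
    | zero => simpa using T.pr_one
    | succ n ih =>
      rw [pow_succ', T.pr_mul 2 _ _ _ hu2]
      conv_rhs => rw [← ih]
      rw [show 2 * ((n + 1 : ℕ) : ℤ) - 2 = 2 * n by push_cast; ring]
  have hnil : u ^ (N + 1) = 0 := by
    rw [← hpow, hN]
    push_cast
    omega
  refine ⟨θ * ∑ j ∈ Finset.range (N + 1), u ^ j, ?_⟩
  rw [T.D_mul, hD, map_sum, Finset.sum_eq_zero fun j _ => hDpow j, mul_zero, add_zero,
    mul_neg_geom_sum, hnil, sub_zero]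

section

variable {ι F : Type} [Fintype ι] [DecidableEq ι] [CommRing F] [Algebra ℂ F] [DiffRing ι F]

lemma olie_one (v : ι → F) : olie v (1 : Om ι F) = 0 := by
  have := olie_mul v (1 : Om ι F) 1
  simpa using this

lemma opr_dx (i : ι) : opr 1 (dx (F := F) i) = dx i := by
  rw [dx, opr_tmul, ed, ← mul_one (ExteriorAlgebra.ι ℂ _)]
  have h := lpr_ι_mul (Pi.single i 1 : ι → ℂ) 0 1
  rw [lpr_zero_one, zero_add] at h
  rw [h]

/-- The forms invariant under a family of vector fields. -/
noncomputable def invForms {σ : Type} (v : σ → ι → F) : Subalgebra ℂ (Om ι F) where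
  carrier := {a | ∀ s, olie (v s) a = 0}
  mul_mem' {a b} ha hb s := by rw [olie_mul, ha s, hb s, zero_mul, mul_zero, add_zero]
  add_mem' {a b} ha hb s := by rw [map_add, ha s, hb s, add_zero]
  algebraMap_mem' c s := by
    rw [Algebra.algebraMap_eq_smul_one, map_smul, olie_one, smul_zero]

/-- The Cartan model of a commuting family of vector fields. -/
noncomputable def cartanModel {σ : Type} [Fintype σ] (v : σ → ι → F)
    (hv : ∀ s t a, olie (v s) (octr (v t) a) = octr (v t) (olie (v s) a)) (S : Set σ)
    (hS : ∀ s, s ∉ S → v s = 0) : Stage σ (invForms v) :=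
  (cartanStage v S hS).restrict (invForms v)
    (fun a ha s => by
      change olie (v s) (oinv a) = 0
      rw [olie_oinv, ha s, map_zero])
    (fun m a ha s => by
      change olie (v s) (opr m a) = 0
      rw [olie_opr, ha s, map_zero])
    (fun p a ha s => by
      change olie (v s) (cartanD v p a) = 0
      rw [cartanD_apply, map_add, olie_od, ha s, map_sum, map_zero, zero_add]
      refine Finset.sum_eq_zero fun t _ => ?_
      rw [map_smul, hv, ha s, map_zero, smul_zero])

end

section

variable {ι : Type} [Fintype ι] [DecidableEq ι] {K : Set (ι → ℝ)}

/-- The algebraic rank estimate for commuting periodic linear flows that are independent on a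
compact set with the cohomology of a product of spheres. -/
lemma card_le_of_rotations {σ : Type} [Fintype σ] [DecidableEq σ]
    (B : σ → (ι → ℝ) →L[ℝ] ι → ℝ)
    (hK : ∀ i, ∀ s, ∀ x ∈ K, rot (B i) s x ∈ K) (hB : ∀ i x, B i (B i (B i x)) = -B i x)
    (hc : ∀ i j x, B i (B j x) = B j (B i x))
    (hθ : ∀ i, ∃ θ : Forms K, opr 1 θ = θ ∧
      ∀ j, octr (rotV (B j) K) θ = if j = i then 1 else 0)
    {L : List (Gen (Forms K))} (hL : deRham.Sph L) :
    Fintype.card σ ≤ L.countP fun g => Odd g.deg := by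
  obtain ⟨Av, J, h1, h2, h3, h4, h5, h6⟩ :=
    exists_average_family B hK hB hc (Finset.univ : Finset σ).toList
  have h6 : ∀ i a, olie (rotV (B i) K) (Av a) = 0 := fun i => h6 i (by simp)
  let κ := Fin (L.countP fun g => Even g.deg)
  let v : σ ⊕ κ → ι → SGerm K := Sum.elim (fun i => rotV (B i) K) fun _ => 0
  have hzero : ∀ a : Forms K, olie (0 : ι → SGerm K) a = 0 := fun a => by
    rw [olie_apply, octr_zero_field]
    simp
  have hmem : ∀ a : Forms K, (∀ i, olie (rotV (B i) K) a = 0) → a ∈ invForms v := by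
    rintro a ha (i | j)
    · exact ha i
    · exact hzero a
  have hv : ∀ s t a, olie (v s) (octr (v t) a) = octr (v t) (olie (v s) a) := by
    rintro (i | i) (j | j) a
    · exact olie_octr_rot (hc i j) a
    · change olie _ (octr 0 _) = octr 0 _
      simp [octr_zero_field]
    · change olie 0 _ = octr _ (olie 0 _)
      simp [hzero]
    · change olie 0 _ = octr _ (olie 0 _)
      simp [hzero]
  let T := cartanModel v hv (Set.range Sum.inl) (by
    rintro (i | j) h
    · exact absurd ⟨i, rfl⟩ h
    · rfl)
  have hT : ∀ p a, (T.D p a : Forms K) = cartanD v p a := fun p a => rfl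
  obtain ⟨L', hS, hdeg⟩ := hL.average (T' := T) (Av := Av) (J := J)
    (fun b => by rw [hT, cartanD_zero, deRham_D]) (fun m b => rfl)
    (fun a => by rw [deRham_D, deRham_D, h1]) h2 (fun a ha => h4 a fun i => ha (Sum.inl i))
    (fun a => by rw [deRham_D, deRham_D, h5]) (fun a => hmem _ fun i => h6 i a)
  have hcount : ∀ (P : ℤ → Prop) [DecidablePred P], L'.countP (fun g => P g.deg) =
      L.countP fun g => P g.deg := by
    intro P _
    have e := congrArg (List.countP fun z => decide (P z)) hdeg
    rwa [List.countP_map, List.countP_map] at e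
  have hsq : ∀ p a, T.D p (T.D p a) = 0 := fun p a => Subtype.ext <| by
    rw [hT, hT, cartanD_sq]
    refine Finset.sum_eq_zero fun s _ => ?_
    rw [a.2 s, smul_zero]
  have main := T.card_le_of_exact rfl L' hS (by rw [Nat.card_fin, hcount]) hsq ?_
  · rwa [hcount, Nat.card_eq_fintype_card] at main
  rintro p ⟨i, hi⟩
  obtain ⟨θ, t1, t2⟩ := hθ i
  have hone : Av 1 = 1 := h4 1 fun i => olie_one _
  let η : invForms v := ⟨(p (Sum.inl i))⁻¹ • Av θ, hmem _ fun j => by rw [map_smul, h6, smul_zero]⟩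
  refine T.exists_primitive_one (hsq p) (N := Fintype.card ι)
    (fun m a hm => Subtype.ext (opr_gt hm (a : Forms K))) (θ := η) (Subtype.ext ?_)
    (Subtype.ext ?_)
  · change opr 1 ((p (Sum.inl i))⁻¹ • Av θ) = (p (Sum.inl i))⁻¹ • Av θ
    rw [map_smul, ← h2, t1]
  · change cartanD v p (η : Forms K) = 1 + cartanD v 0 (η : Forms K)
    rw [cartanD_zero, cartanD_apply, add_comm, add_left_inj, Fintype.sum_sum_type,
      Finset.sum_eq_single i]
    · change p (Sum.inl i) • octr (rotV (B i) K) ((p (Sum.inl i))⁻¹ • Av θ) +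
        ∑ j : κ, p (Sum.inr j) • octr 0 _ = 1
      rw [map_smul, ← h3, t2, if_pos rfl, hone, smul_smul, mul_inv_cancel₀ hi]
      simp [octr_zero_field]
    · intro j _ hj
      change p (Sum.inl j) • octr (rotV (B j) K) ((p (Sum.inl i))⁻¹ • Av θ) = 0
      rw [map_smul, ← h3, t2, if_neg hj]
      simp
    · simp

/-- Linear flows with orthogonal nonvanishing velocities have dual one-forms. -/
lemma exists_dual_form {σ : Type} [DecidableEq σ] (B : σ → (ι → ℝ) →L[ℝ] ι → ℝ)
    (hne : ∀ i, ∀ x ∈ K, ∑ q, B i x q * B i x q ≠ 0)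
    (horth : ∀ i j, i ≠ j → ∀ x, ∑ q, B i x q * B j x q = 0) (i : σ) :
    ∃ θ : Forms K, opr 1 θ = θ ∧ ∀ j, octr (rotV (B j) K) θ = if j = i then 1 else 0 := by
  have hBq : ∀ q, ContDiff ℝ ∞ fun x => B i x q := contDiff_pi.1 (B i).contDiff
  have hcN : ContDiff ℝ ∞ fun x => ∑ q, B i x q * B i x q :=
    ContDiff.sum fun q _ => (hBq q).mul (hBq q)
  have hev : ∀ᶠ x in 𝓝ˢ K, ∑ q, B i x q * B i x q ≠ 0 := by
    rw [eventually_nhdsSet_iff_forall]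
    exact fun x hx => hcN.continuous.continuousAt.eventually_ne (hne i x hx)
  have hsm : ∀ q, SmoothNear K fun x =>
      ((B i x q / (2 * Real.pi * ∑ q, B i x q * B i x q) : ℝ) : ℂ) := by
    intro q
    filter_upwards [hev] with x hx
    refine Complex.ofRealCLM.contDiff.contDiffAt.comp x ?_
    exact (hBq q).contDiffAt.div (contDiff_const.mul hcN).contDiffAt
      (mul_ne_zero (by positivity) hx)
  refine ⟨∑ q, fn (germ _ (hsm q)) * dx q, ?_, fun j => ?_⟩
  · rw [map_sum]
    refine Finset.sum_congr rfl fun q _ => ?_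
    have := opr_homog_mul (opr_fn (germ _ (hsm q))) (opr_dx (F := SGerm K) q)
    simpa using this
  · rw [map_sum]
    have e : ∀ q, octr (rotV (B j) K) (fn (germ _ (hsm q)) * dx q) =
        fn (germ _ (hsm q) * rotV (B j) K q) := fun q => by
      rw [octr_mul, octr_fn, zero_mul, zero_add, oinv_fn, octr_dx, fn_mul]
    rw [Finset.sum_congr rfl fun q _ => e q, ← fn_sum]
    have e2 : ∑ q, germ _ (hsm q) * rotV (B j) K q = if j = i then 1 else 0 := by
      simp only [vfield, germ_mul]
      rw [germ_sum]
      have h2 : ∀ x, (∑ q, fun x => ((B i x q / (2 * Real.pi * ∑ q, B i x q * B i x q) : ℝ) : ℂ) *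
          ((rotField (B j) x q : ℝ) : ℂ)) x =
          (((∑ q, B i x q * B j x q) / ∑ q, B i x q * B i x q : ℝ) : ℂ) := fun x => by
        rw [Finset.sum_apply]
        simp only [← Complex.ofReal_mul]
        rw [← Complex.ofReal_sum, Finset.sum_div]
        congr 1
        refine Finset.sum_congr rfl fun q _ => ?_
        change _ * (2 * Real.pi * B j x q) = _
        have := Real.pi_ne_zero
        rw [div_mul_eq_mul_div, mul_left_comm, mul_div_mul_left _ _ (by positivity)]
      split_ifs with h
      · subst h
        rw [← germ_one, germ_eq]
        filter_upwards [hev] with x hx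
        refine (h2 x).trans ?_
        rw [div_self hx, Complex.ofReal_one]
        rfl
      · rw [← germ_zero, germ_eq]
        refine Eventually.of_forall fun x => (h2 x).trans ?_
        rw [horth i j (Ne.symm h), zero_div, Complex.ofReal_zero]
        rfl
    rw [e2]
    split_ifs
    · exact fn_one
    · exact fn_zero

end

end FreeToralRank

namespace FreeToralRank

open Polynomial

open scoped TensorProduct Topology ContDiff
open Filter

set_option linter.unusedSectionVars false

section

variable {σ P R : Type} [Fintype σ] [DecidableEq σ] [Fintype P] [DecidableEq P] [Fintype R]
  [DecidableEq R]

/-- The generator of the simultaneous rotation of a family of planes. -/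
noncomputable def planeRot (i : σ) :
    ((σ × P × Bool) ⊕ R → ℝ) →L[ℝ] (σ × P × Bool) ⊕ R → ℝ :=
  LinearMap.toContinuousLinearMap
    { toFun := fun x => Sum.elim (fun a => if a.1 = i then
        (if a.2.2 then x (Sum.inl (a.1, a.2.1, false)) else -x (Sum.inl (a.1, a.2.1, true)))
        else 0) 0
      map_add' := fun x y => by
        funext a
        rcases a with ⟨j, p, b⟩ | a
        · rcases b <;> by_cases h : j = i <;> simp [h, add_comm]
        · simp
      map_smul' := fun c x => by
        funext a
        rcases a with ⟨j, p, b⟩ | a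
        · rcases b <;> by_cases h : j = i <;> simp [h]
        · simp }

lemma planeRot_true (i j : σ) (p : P) (x : (σ × P × Bool) ⊕ R → ℝ) :
    planeRot i x (Sum.inl (j, p, true)) = if j = i then x (Sum.inl (j, p, false)) else 0 := rfl

lemma planeRot_false (i j : σ) (p : P) (x : (σ × P × Bool) ⊕ R → ℝ) :
    planeRot i x (Sum.inl (j, p, false)) = if j = i then -x (Sum.inl (j, p, true)) else 0 := rfl

lemma planeRot_inr (i : σ) (a : R) (x : (σ × P × Bool) ⊕ R → ℝ) :
    planeRot i x (Sum.inr a) = 0 := rfl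

lemma planeRot_cube (i : σ) (x : (σ × P × Bool) ⊕ R → ℝ) :
    planeRot i (planeRot i (planeRot i x)) = -planeRot i x := by
  funext a
  rcases a with ⟨j, p, _ | _⟩ | a <;>
    simp only [Pi.neg_apply, planeRot_true, planeRot_false, planeRot_inr] <;> (try split_ifs) <;> simp

lemma planeRot_comm (i j : σ) (x : (σ × P × Bool) ⊕ R → ℝ) :
    planeRot i (planeRot j x) = planeRot j (planeRot i x) := by
  funext a
  rcases a with ⟨l, p, _ | _⟩ | a <;>
    simp only [planeRot_true, planeRot_false, planeRot_inr] <;> split_ifs <;> simp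

lemma planeRot_orth {i j : σ} (h : i ≠ j) (x : (σ × P × Bool) ⊕ R → ℝ) :
    ∑ q, planeRot i x q * planeRot j x q = 0 := by
  refine Finset.sum_eq_zero fun a _ => ?_
  rcases a with ⟨l, p, _ | _⟩ | a <;>
    simp only [planeRot_true, planeRot_false, planeRot_inr] <;> (try split_ifs) <;> simp_all

/-- The real coordinates of a family of complex functions and a family of real functions. -/
noncomputable def realCoords {X : Type} (z : σ → P → X → ℂ) (F : R → X → ℝ) (x : X) :
    (σ × P × Bool) ⊕ R → ℝ :=
  Sum.elim (fun a => if a.2.2 then (z a.1 a.2.1 x).im else (z a.1 a.2.1 x).re) fun q => F q x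

variable {X : Type} {z : σ → P → X → ℂ} {F : R → X → ℝ}

lemma continuous_realCoords [TopologicalSpace X] (hz : ∀ i p, Continuous (z i p))
    (hF : ∀ q, Continuous (F q)) : Continuous (realCoords z F) := by
  refine continuous_pi fun a => ?_
  rcases a with ⟨l, p, _ | _⟩ | a
  · exact Complex.continuous_re.comp (hz l p)
  · exact Complex.continuous_im.comp (hz l p)
  · exact hF a

lemma realCoords_injective
    (h : ∀ x y, (∀ i p, z i p x = z i p y) → (∀ q, F q x = F q y) → x = y) :
    Function.Injective (realCoords z F) := by
  intro x y e
  refine h x y (fun i p => Complex.ext ?_ ?_) fun q => congrFun e (Sum.inr q)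
  · exact congrFun e (Sum.inl (i, p, false))
  · exact congrFun e (Sum.inl (i, p, true))

lemma realCoords_ne {x : X} (h : ∃ p, ∀ i, z i p x ≠ 0) (i : σ) :
    ∑ q, planeRot i (realCoords z F x) q * planeRot i (realCoords z F x) q ≠ 0 := by
  obtain ⟨p, hp⟩ := h
  intro h0
  rw [Finset.sum_eq_zero_iff_of_nonneg fun q _ => mul_self_nonneg _] at h0
  refine hp i (Complex.ext ?_ ?_)
  · have := mul_self_eq_zero.1 (h0 (Sum.inl (i, p, true)) (Finset.mem_univ _))
    rwa [planeRot_true, if_pos rfl] at this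
  · have := mul_self_eq_zero.1 (h0 (Sum.inl (i, p, false)) (Finset.mem_univ _))
    rwa [planeRot_false, if_pos rfl, neg_eq_zero] at this

lemma rot_realCoords {i : σ} {s : ℝ} {x y : X}
    (h1 : ∀ p, z i p y = Circle.exp (2 * Real.pi * s) * z i p x)
    (h2 : ∀ j, j ≠ i → ∀ p, z j p y = z j p x) (h3 : ∀ q, F q y = F q x) :
    rot (planeRot i) s (realCoords z F x) = realCoords z F y := by
  have hre : (Circle.exp (2 * Real.pi * s) : ℂ).re = Real.cos (2 * Real.pi * s) := by
    rw [Circle.coe_exp, Complex.exp_ofReal_mul_I_re]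
  have him : (Circle.exp (2 * Real.pi * s) : ℂ).im = Real.sin (2 * Real.pi * s) := by
    rw [Circle.coe_exp, Complex.exp_ofReal_mul_I_im]
  funext a
  simp only [rot, Pi.add_apply, Pi.smul_apply, smul_eq_mul]
  rcases a with ⟨l, p, _ | _⟩ | a
  · rw [planeRot_false, planeRot_false]
    change (z l p x).re + _ * (if l = i then -(z l p x).im else 0) + _ = (z l p y).re
    rw [planeRot_true]
    by_cases h : l = i
    · subst h
      rw [if_pos rfl, if_pos rfl, if_pos rfl, h1, Complex.mul_re, hre, him]
      change _ + _ + _ * -(z l p x).re = _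
      ring
    · rw [if_neg h, if_neg h, h2 l h]
      simp
  · rw [planeRot_true, planeRot_true]
    change (z l p x).im + _ * (if l = i then (z l p x).re else 0) + _ = (z l p y).im
    rw [planeRot_false]
    by_cases h : l = i
    · subst h
      rw [if_pos rfl, if_pos rfl, if_pos rfl, h1, Complex.mul_im, hre, him]
      change _ + _ + _ * -(z l p x).im = _
      ring
    · rw [if_neg h, if_neg h, h2 l h]
      simp
  · rw [planeRot_inr, planeRot_inr]
    change F a x + _ + _ = F a y
    rw [h3]
    ring

end

end FreeToralRank

/-- Theorem 1.5 (free toral rank): if the torus `(S^1)^r` acts freely and continuously on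
`X = S^{n_1} × ⋯ × S^{n_k}`, then `r` is at most the number of odd-dimensional factors. -/
theorem free_toral_rank_of_products_of_spheres
    (k : ℕ) (hk : 1 ≤ k) (n : Fin k → ℕ) (hn : ∀ i, 1 ≤ n i) (r : ℕ)
    (ρ : (Fin r → Circle) →*
      Equiv.Perm (Π i : Fin k, Metric.sphere (0 : EuclideanSpace ℝ (Fin (n i + 1))) 1))
    (hcont : Continuous fun q : (Fin r → Circle) ×
        (Π i : Fin k, Metric.sphere (0 : EuclideanSpace ℝ (Fin (n i + 1))) 1) =>
        ρ q.1 q.2)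
    (hfree : ∀ g x, ρ g x = x → g = 1) :
    r ≤ (Finset.univ.filter fun i => Odd (n i)).card := by
  obtain ⟨P, _, _, z, F, hz, hF, hzt, hFt, hne, hinj⟩ :=
    FreeToralRank.exists_equivariant_embedding ρ hcont hfree (fun e x => FreeToralRank.flatten n x e)
      (fun e => (continuous_apply e).comp (FreeToralRank.continuous_flatten n))
      fun x y h => FreeToralRank.flatten_injective n (funext h)
  obtain ⟨L, hL, hdeg⟩ := FreeToralRank.exists_sph_range n hn (FreeToralRank.realCoords z F) (FreeToralRank.continuous_realCoords hz hF)
    (FreeToralRank.realCoords_injective hinj)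
  have key := FreeToralRank.card_le_of_rotations (K := Set.range (FreeToralRank.realCoords z F)) FreeToralRank.planeRot ?_ FreeToralRank.planeRot_cube
    FreeToralRank.planeRot_comm (FreeToralRank.exists_dual_form FreeToralRank.planeRot ?_ fun i j h => FreeToralRank.planeRot_orth h) hL
  · have e := congrArg (List.countP fun d : ℤ => decide (Odd d)) hdeg
    rw [List.countP_map, List.countP_map] at e
    rw [Fintype.card_fin] at key
    refine key.trans (e.trans ?_).le
    rw [List.countP_eq_length_filter, Finset.card_def, Finset.filter_val]
    change _ = (Multiset.filter _ (List.finRange k : Multiset (Fin k))).card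
    rw [Multiset.filter_coe, Multiset.coe_card]
    congr 1
    refine List.filter_congr fun i _ => ?_
    simp
  · rintro i s _ ⟨x, rfl⟩
    refine ⟨ρ (Pi.mulSingle i (Circle.exp (2 * Real.pi * s))) x, (FreeToralRank.rot_realCoords (fun p => ?_)
      (fun j hj p => ?_) fun q => hFt _ _ _).symm⟩
    · rw [hzt, Pi.mulSingle_eq_same]
    · rw [hzt, Pi.mulSingle_eq_of_ne hj]
      simp
  · rintro i _ ⟨x, rfl⟩
    exact FreeToralRank.realCoords_ne (hne x) i
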